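/- arXiv:math/9711208 — 2 statements merged into one kernel-verified Lean document; each statement's English description precedes it below -/
import Mathlib

section
/- Let X be a σ-compact locally compact Hausdorff space. If the group of surjective linear isometries of C₀(X) is algebraically reflexive, then the group of surjective linear isometries of C₀(X, B(H)) is algebraically reflexive; that is, if every bounded linear map on C₀(X) that agrees at each point with some surjective linear isometry of C₀(X) is itself a surjective linear isometry, then every bounded linear map Φ on C₀(X, B(H)) such that for each f ∈ C₀(X, B(H)) there is a surjective linear isometry Φ_f of C₀(X, B(H)) with Φ(f) = Φ_f(f), is itself a surjective linear isometry of C₀(X, B(H)). -/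
open scoped ZeroAtInfty

/-- A surjective linear isometry of a normed space onto itself. -/
def IsSurjectiveLinearIsometry {A : Type*} [SeminormedAddCommGroup A] [Module ℂ A]
    (Φ : A → A) : Prop :=
  IsLinearMap ℂ Φ ∧ Function.Surjective Φ ∧ ∀ a : A, ‖Φ a‖ = ‖a‖

namespace IsoRefl
open InnerProductSpace
set_option linter.unusedSimpArgs false
section A
variable {H : Type*} [NormedAddCommGroup H] [InnerProductSpace ℂ H]

lemma rk_lower (η ξ : H) (hη : ‖η‖ = 1) (hξ : ‖ξ‖ = 1) (B : H →L[ℂ] H) (N : ℝ) :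
    N + (inner ℂ η (B ξ)).re ≤ ‖(N : ℂ) • rankOne ℂ η ξ + B‖ := by
  have h1 : ‖((N : ℂ) • rankOne ℂ η ξ + B) ξ‖ ≤ ‖(N : ℂ) • rankOne ℂ η ξ + B‖ := by
    simpa [hξ] using ((N : ℂ) • rankOne ℂ η ξ + B).le_opNorm ξ
  have h2 : (inner ℂ η (((N : ℂ) • rankOne ℂ η ξ + B) ξ)).re
      ≤ ‖((N : ℂ) • rankOne ℂ η ξ + B) ξ‖ := by
    have := norm_inner_le_norm (𝕜 := ℂ) η (((N : ℂ) • rankOne ℂ η ξ + B) ξ)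
    rw [hη, one_mul] at this
    exact (Complex.re_le_norm _).trans this
  refine le_trans (le_of_eq ?_) (h2.trans h1)
  simp [inner_add_right, inner_smul_right, hξ, hη]

lemma rk_arith {N b ω β t : ℝ} (hN : 0 ≤ N) (hb0 : 0 ≤ b) (hω : 0 ≤ ω) (hω1 : ω ≤ 1)
    (hβ : 0 ≤ β) (hβb : β ≤ b) (ht : -b ≤ t) :
    (1 - ω ^ 2) * (N ^ 2 + 2 * N * t + β ^ 2) + 2 * ((N + b) * (b * ω)) + (b * ω) ^ 2
      ≤ N ^ 2 + 2 * N * t + 8 * b ^ 2 := by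
  have e5 : β ^ 2 ≤ b ^ 2 := pow_le_pow_left₀ hβ hβb 2
  have hω2 : ω ^ 2 ≤ ω := by nlinarith
  have hω3 : ω ^ 2 ≤ 1 := by nlinarith
  have e6 : (1 - ω ^ 2) * β ^ 2 ≤ b ^ 2 := by nlinarith [sq_nonneg β, sq_nonneg ω]
  have e7 : -(2 * N * t) * ω ^ 2 ≤ 2 * N * b * ω := by
    have h9 : 0 ≤ N * (t + b) := mul_nonneg hN (by linarith)
    have h8 : 0 ≤ N * b := by positivity
    have h10 : 0 ≤ N * (t + b) * ω ^ 2 := by positivity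
    have h11 : N * b * ω ^ 2 ≤ N * b * ω := mul_le_mul_of_nonneg_left hω2 h8
    linarith
  have e8 : b ^ 2 * ω ≤ b ^ 2 * 1 := mul_le_mul_of_nonneg_left hω1 (sq_nonneg b)
  have e9 : b ^ 2 * ω ^ 2 ≤ b ^ 2 * 1 := mul_le_mul_of_nonneg_left hω3 (sq_nonneg b)
  have e10 := sq_nonneg (N * ω - 2 * b)
  linarith

lemma rk_upper (η ξ : H) (hη : ‖η‖ = 1) (hξ : ‖ξ‖ = 1) (B : H →L[ℂ] H) (N : ℝ) (hN : 0 ≤ N) :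
    ‖(N : ℂ) • rankOne ℂ η ξ + B‖ ^ 2 ≤ N ^ 2 + 2 * N * (inner ℂ η (B ξ)).re + 8 * ‖B‖ ^ 2 := by
  set b := ‖B‖ with hb
  set t := (inner ℂ η (B ξ)).re with ht
  have hb0 : 0 ≤ b := norm_nonneg _
  have hBξ : ‖B ξ‖ ≤ b := by simpa [hξ] using B.le_opNorm ξ
  have ht1 : |t| ≤ b := by
    have := norm_inner_le_norm (𝕜 := ℂ) η (B ξ)
    rw [hη, one_mul] at this
    exact (Complex.abs_re_le_norm _).trans (this.trans hBξ)
  obtain ⟨ht2, ht3⟩ := abs_le.1 ht1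
  have hR : 0 ≤ N ^ 2 + 2 * N * t + 8 * b ^ 2 := by
    nlinarith [sq_nonneg (N - b), mul_nonneg hN (by linarith : 0 ≤ t + b)]
  have key : ∀ v : H, ‖v‖ = 1 → ‖((N : ℂ) • rankOne ℂ η ξ + B) v‖ ^ 2
      ≤ N ^ 2 + 2 * N * t + 8 * b ^ 2 := by
    intro v hv
    set α := inner ℂ ξ v with hα
    set w := v - α • ξ with hw
    have hvw : v = α • ξ + w := by simp [hw]
    have hξw : inner ℂ ξ w = 0 := by
      simp [hw, inner_sub_right, inner_smul_right, hξ, hα]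
    have hpy : ‖α‖ ^ 2 + ‖w‖ ^ 2 = 1 := by
      have := norm_add_sq (𝕜 := ℂ) (α • ξ) w
      rw [← hvw, hv, inner_smul_left, hξw, norm_smul, hξ] at this
      simp at this; linarith
    have hα1 : ‖α‖ ≤ 1 := by nlinarith [norm_nonneg α, norm_nonneg w]
    have hw1 : ‖w‖ ≤ 1 := by nlinarith [norm_nonneg α, norm_nonneg w]
    have e1 : ((N : ℂ) • rankOne ℂ η ξ + B) v = α • ((N : ℂ) • η + B ξ) + B w := by
      have : ((N : ℂ) • rankOne ℂ η ξ + B) v = (N : ℂ) • α • η + B v := by simp [hα]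
      rw [this]
      conv_lhs => rw [hvw]
      rw [map_add, map_smul, smul_add, smul_comm]; abel
    have hBw : ‖B w‖ ≤ b * ‖w‖ := B.le_opNorm w
    have e2 : ‖(N : ℂ) • η + B ξ‖ ^ 2 = N ^ 2 + 2 * N * t + ‖B ξ‖ ^ 2 := by
      rw [norm_add_sq (𝕜 := ℂ), norm_smul, inner_smul_left, hη]
      simp [ht]; ring
    have e2' : ‖(N : ℂ) • η + B ξ‖ ≤ N + b := by
      refine (norm_add_le _ _).trans ?_
      rw [norm_smul, hη]; simp [abs_of_nonneg hN, hBξ]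
    have e3 : ‖α • ((N : ℂ) • η + B ξ) + B w‖ ^ 2 ≤
        ‖α‖ ^ 2 * ‖(N : ℂ) • η + B ξ‖ ^ 2 + 2 * ((N + b) * (b * ‖w‖)) + (b * ‖w‖) ^ 2 := by
      have h3 := norm_add_le (α • ((N : ℂ) • η + B ξ)) (B w)
      rw [norm_smul] at h3
      have h4 : ‖α • ((N : ℂ) • η + B ξ) + B w‖ ^ 2
          ≤ (‖α‖ * ‖(N : ℂ) • η + B ξ‖ + b * ‖w‖) ^ 2 := by
        apply pow_le_pow_left₀ (norm_nonneg _); linarith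
      have h5 : ‖α‖ * ‖(N : ℂ) • η + B ξ‖ ≤ N + b := by
        nlinarith [norm_nonneg α, norm_nonneg ((N : ℂ) • η + B ξ)]
      have h6 : 0 ≤ b * ‖w‖ := by positivity
      nlinarith
    rw [e1]
    refine e3.trans ?_
    rw [e2]
    have e4 : ‖α‖ ^ 2 = 1 - ‖w‖ ^ 2 := by linarith
    rw [e4]
    exact rk_arith hN hb0 (norm_nonneg _) hw1 (norm_nonneg _) hBξ ht2
  have h := ContinuousLinearMap.opNorm_le_of_unit_norm (f := (N : ℂ) • rankOne ℂ η ξ + B)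
    (Real.sqrt_nonneg (N ^ 2 + 2 * N * t + 8 * b ^ 2))
    (fun v hv => Real.le_sqrt_of_sq_le (key v hv))
  calc _ ≤ (Real.sqrt (N ^ 2 + 2 * N * t + 8 * b ^ 2)) ^ 2 :=
        pow_le_pow_left₀ (norm_nonneg _) h 2
    _ = _ := Real.sq_sqrt hR

/-- norm growth gives a lower bound for a matrix coefficient -/
lemma coeff_ge {η' ξ' : H} (hη' : ‖η'‖ = 1) (hξ' : ‖ξ'‖ = 1) {s : ℝ} {B' : H →L[ℂ] H}
    (h : ∀ N : ℝ, 1 ≤ N → N + s ≤ ‖(N : ℂ) • rankOne ℂ η' ξ' + B'‖) :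
    s ≤ (inner ℂ η' (B' ξ')).re := by
  by_contra hst
  push Not at hst
  set t := (inner ℂ η' (B' ξ')).re with ht
  set C := 8 * ‖B'‖ ^ 2
  have hC : 0 ≤ C := by positivity
  set N := max (1 + |s|) ((C + 1) / (2 * (s - t)))
  have hN : (C + 1) / (2 * (s - t)) ≤ N := le_max_right _ _
  have hN1 : 1 + |s| ≤ N := le_max_left _ _
  rw [div_le_iff₀ (by linarith)] at hN
  have h0 : (0:ℝ) ≤ |s| := abs_nonneg s
  have h2 := rk_upper η' ξ' hη' hξ' B' N (by linarith)
  have h3 := h N (by linarith)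
  have h4 : (N + s) ^ 2 ≤ ‖(N : ℂ) • rankOne ℂ η' ξ' + B'‖ ^ 2 := by
    apply pow_le_pow_left₀ (by linarith [neg_abs_le s]); linarith
  nlinarith [sq_nonneg s]

/-- norm comparison gives comparison of matrix coefficients -/
lemma coeff_le {η ξ η' ξ' : H} (hη : ‖η‖ = 1) (hξ : ‖ξ‖ = 1) (hη' : ‖η'‖ = 1) (hξ' : ‖ξ'‖ = 1)
    {B B' : H →L[ℂ] H}
    (h : ∀ N : ℝ, 1 ≤ N → ‖(N : ℂ) • rankOne ℂ η ξ + B‖ ≤ ‖(N : ℂ) • rankOne ℂ η' ξ' + B'‖) :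
    (inner ℂ η (B ξ)).re ≤ (inner ℂ η' (B' ξ')).re :=
  coeff_ge hη' hξ' fun N hN => (rk_lower η ξ hη hξ B N).trans (h N hN)

end A
end IsoRefl

namespace IsoRefl
open InnerProductSpace
section B
variable {H : Type*} [NormedAddCommGroup H] [InnerProductSpace ℂ H] [CompleteSpace H]

lemma normsq_cfc (e : H →L[ℂ] H) (q : ℝ → ℝ) (hq : Continuous q) :
    ‖e * cfc q (star e * e)‖ ^ 2 = ‖cfc (fun s => q s * s * q s) (star e * e)‖ := by
  have ha : IsSelfAdjoint (star e * e) := IsSelfAdjoint.star_mul_self e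
  rw [sq, ← CStarRing.norm_star_mul_self]
  congr 1
  have h1 : IsSelfAdjoint (cfc q (star e * e)) := cfc_predicate q _
  rw [star_mul, h1.star_eq]
  have h2 : cfc (fun s : ℝ => s) (star e * e) = star e * e := cfc_id' ℝ _
  rw [cfc_mul (fun s => q s * s) q, cfc_mul q (fun s => s), h2]
  simp only [mul_assoc]

lemma lin_cfc (e : H →L[ℂ] H) (q : ℝ → ℝ) (hq : Continuous q) (c d : ℝ) :
    (c : ℂ) • e + (d : ℂ) • (e * cfc q (star e * e))
        = e * cfc (fun s => c + d * q s) (star e * e) := by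
  have ha : IsSelfAdjoint (star e * e) := IsSelfAdjoint.star_mul_self e
  have hdq : Continuous fun s => d * q s := continuous_const.mul hq
  rw [cfc_add (a := star e * e) (fun _ => c) (fun s => d * q s) continuousOn_const hdq.continuousOn,
    cfc_const c (star e * e), cfc_const_mul d q (star e * e) hq.continuousOn, mul_add]
  simp only [Algebra.algebraMap_eq_smul_one, mul_smul_comm, mul_one, Complex.coe_smul]

lemma partial_iso_of_center (e : H →L[ℂ] H) (he : ‖e‖ = 1)
    (hyp : ∀ B : H →L[ℂ] H, ‖B‖ ≤ 1 → (∀ N : ℝ, 1 ≤ N → N + 1 ≤ ‖(N : ℂ) • e + B‖) →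
      ‖(2 : ℂ) • e - B‖ ≤ 1) :
    (star e * e) * (star e * e) = star e * e := by
  have ha : IsSelfAdjoint (star e * e) := IsSelfAdjoint.star_mul_self e
  have hna : ‖star e * e‖ = 1 := by rw [CStarRing.norm_star_mul_self, he, one_mul]
  have hnt : Nontrivial (H →L[ℂ] H) := ⟨e, 0, by rintro rfl; simp at he⟩
  set a := star e * e with ha_def
  have hpos : ∀ s ∈ spectrum ℝ a, 0 ≤ s := spectrum_nonneg_of_nonneg (star_mul_self_nonneg e)
  have hle : ∀ s ∈ spectrum ℝ a, s ≤ 1 := fun s hs => by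
    have := spectrum.norm_le_norm_of_mem hs
    rw [hna] at this
    exact (le_abs_self s).trans this
  have hone : (1 : ℝ) ∈ spectrum ℝ a := by
    obtain ⟨⟨s, hs, hs1⟩, -⟩ := IsGreatest.norm_cfc (id : ℝ → ℝ) a
    rw [cfc_id ℝ a, hna] at hs1
    simp only [id, Real.norm_eq_abs, abs_of_nonneg (hpos s hs)] at hs1
    rwa [← hs1]
  have hspec : ∀ s ∈ spectrum ℝ a, s = 0 ∨ s = 1 := by
    intro s₀ hs₀
    by_contra hcon
    push Not at hcon
    have h0 : 0 < s₀ := lt_of_le_of_ne (hpos s₀ hs₀) (Ne.symm hcon.1)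
    have h1 : s₀ < 1 := lt_of_le_of_ne (hle s₀ hs₀) hcon.2
    let m : ℝ → ℝ := fun s => max (-1) (1 - 2 * (1 - s) / (1 - s₀))
    let q : ℝ → ℝ := fun s => (Real.sqrt (max s s₀))⁻¹ * m s
    have hmax : ∀ s, 0 < max s s₀ := fun s => lt_of_lt_of_le h0 (le_max_right _ _)
    have hmc : Continuous m := by fun_prop
    have hq : Continuous q := by
      refine Continuous.mul (Continuous.inv₀ (by fun_prop) fun s => ?_) hmc
      exact (Real.sqrt_pos.2 (hmax s)).ne'
    have hq1 : q 1 = 1 := by simp [q, m, max_eq_left h1.le]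
    have hq0 : q s₀ = - (Real.sqrt s₀)⁻¹ := by
      have : m s₀ = -1 := by
        have : (1 - s₀) ≠ 0 := by linarith
        simp only [m, mul_div_assoc, div_self this]; norm_num
      simp [q, this]
    have hqb : ∀ s ∈ spectrum ℝ a, q s * s * q s ≤ 1 := by
      intro s hs
      have hm : m s ^ 2 ≤ 1 := by
        have h3 : -1 ≤ m s := le_max_left _ _
        have h4 : m s ≤ 1 := by
          refine max_le (by norm_num) ?_
          have : 0 ≤ 2 * (1 - s) / (1 - s₀) :=
            div_nonneg (by linarith [hle s hs]) (by linarith)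
          linarith
        nlinarith
      have hs2 : (Real.sqrt (max s s₀))⁻¹ ^ 2 * s ≤ 1 := by
        rw [inv_pow, Real.sq_sqrt (hmax s).le, inv_mul_le_iff₀ (hmax s)]
        simp
      have : q s * s * q s = ((Real.sqrt (max s s₀))⁻¹ ^ 2 * s) * m s ^ 2 := by
        simp only [q]; ring
      rw [this]
      have h6 : 0 ≤ (Real.sqrt (max s s₀))⁻¹ ^ 2 * s :=
        mul_nonneg (sq_nonneg _) (hpos s hs)
      nlinarith [sq_nonneg (m s)]
    clear_value q
    have hB : ‖e * cfc q a‖ ≤ 1 := by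
      have h2 := normsq_cfc e q hq
      have h3 : ‖cfc (fun s => q s * s * q s) a‖ ≤ 1 := by
        refine norm_cfc_le zero_le_one fun s hs => ?_
        rw [Real.norm_eq_abs, abs_of_nonneg]
        · exact hqb s hs
        · nlinarith [mul_nonneg (hpos s hs) (mul_self_nonneg (q s))]
      rw [← h2] at h3
      nlinarith [norm_nonneg (e * cfc q a)]
    have hlin : ∀ c d : ℝ, (c : ℂ) • e + (d : ℂ) • (e * cfc q a)
        = e * cfc (fun s => c + d * q s) a := by
      intro c d
      exact lin_cfc e q hq c d
    have hgrow : ∀ N : ℝ, 1 ≤ N → N + 1 ≤ ‖(N : ℂ) • e + e * cfc q a‖ := by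
      intro N hN
      have h2 := hlin N 1
      simp only [Complex.ofReal_one, one_smul, one_mul] at h2
      rw [h2]
      have hc : Continuous fun s => N + q s := by fun_prop
      have h3 := normsq_cfc e (fun s => N + q s) hc
      have h4 := norm_apply_le_norm_cfc (fun s => (N + q s) * s * (N + q s)) a hone
        (by fun_prop)
      rw [← h3, hq1, mul_one, Real.norm_eq_abs, abs_of_nonneg (mul_self_nonneg _), ← sq] at h4
      exact (pow_le_pow_iff_left₀ (by linarith) (norm_nonneg _) two_ne_zero).1 h4
    have hfin := hyp _ hB hgrow
    have h2 := hlin 2 (-1)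
    simp only [Complex.ofReal_neg, Complex.ofReal_one, neg_smul, one_smul, Complex.ofReal_ofNat,
      ← sub_eq_add_neg, neg_mul, one_mul] at h2
    rw [h2] at hfin
    have h3 := normsq_cfc e (fun s => 2 - q s) (by fun_prop)
    have h4 := norm_apply_le_norm_cfc (fun s => (2 - q s) * s * (2 - q s)) a hs₀ (by fun_prop)
    rw [← h3, hq0, Real.norm_eq_abs] at h4
    have h5 := (le_abs_self _).trans h4
    have h6 : ‖e * cfc (fun s => 2 - q s) a‖ ^ 2 ≤ 1 := by
      nlinarith [norm_nonneg (e * cfc (fun s => 2 - q s) a)]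
    have hr : 0 < Real.sqrt s₀ := Real.sqrt_pos.2 h0
    have hr2 : Real.sqrt s₀ * Real.sqrt s₀ = s₀ := Real.mul_self_sqrt h0.le
    have h7 : (2 - -(Real.sqrt s₀)⁻¹) * s₀ * (2 - -(Real.sqrt s₀)⁻¹)
        = (2 * Real.sqrt s₀ + 1) ^ 2 := by
      rw [← hr2]; field_simp; simp [Real.sqrt_mul_self hr.le]; try ring
    nlinarith
  have h1 : a * a = cfc (fun s : ℝ => s * s) a := by
    rw [cfc_mul (fun s : ℝ => s) (fun s => s) a, cfc_id' ℝ a]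
  rw [h1]
  conv_rhs => rw [← cfc_id' ℝ a]
  refine cfc_congr fun s hs => ?_
  rcases hspec s hs with h | h <;> simp [h]

/-- Surjective isometries of `B(H)` preserve normalized rank-one operators. -/
lemma isom_rankOne (R : (H →L[ℂ] H) ≃ₗᵢ[ℂ] (H →L[ℂ] H)) {η ξ : H} (hη : ‖η‖ = 1) (hξ : ‖ξ‖ = 1) :
    ∃ u v : H, ‖u‖ = 1 ∧ ‖v‖ = 1 ∧ R (rankOne ℂ η ξ) = rankOne ℂ u v := by
  set e := R (rankOne ℂ η ξ) with he_def
  have he : ‖e‖ = 1 := by rw [he_def, R.norm_map, norm_rankOne, hη, hξ, one_mul]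
  have P1 : ∀ (s : ℝ) (B : H →L[ℂ] H), (∀ N : ℝ, 1 ≤ N → N + s ≤ ‖(N : ℂ) • e + B‖) →
      s ≤ (inner ℂ η (R.symm B ξ)).re := by
    intro s B h
    refine coeff_ge hη hξ fun N hN => (h N hN).trans (le_of_eq ?_)
    rw [← R.norm_map ((N : ℂ) • rankOne ℂ η ξ + R.symm B), map_add, map_smul,
      R.apply_symm_apply]
  have P2 : ∀ B : H →L[ℂ] H, ‖B‖ ≤ 1 → (∀ N : ℝ, 1 ≤ N → N + 1 ≤ ‖(N : ℂ) • e + B‖) →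
      ‖(2 : ℂ) • e - B‖ ≤ 1 := by
    intro B hB h
    have h1 := P1 1 B h
    set C := R.symm B with hC
    have hCn : ‖C‖ ≤ 1 := by rw [hC, R.symm.norm_map]; exact hB
    have e1 : (2 : ℂ) • e - B = R ((2 : ℂ) • rankOne ℂ η ξ - C) := by simp [he_def, hC]
    rw [e1, R.norm_map]
    have hCv : ∀ v, ‖C v‖ ≤ ‖v‖ := fun v => by
      simpa using C.le_of_opNorm_le hCn v
    have eq1 : C ξ = η := by
      have h2 := norm_sub_sq (𝕜 := ℂ) η (C ξ)
      have h3 := hCv ξ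
      rw [hξ] at h3
      simp only [RCLike.re_eq_complex_re] at h2
      rw [hη] at h2
      have h4 : ‖η - C ξ‖ ^ 2 ≤ 0 := by nlinarith [norm_nonneg (C ξ)]
      have h5 : ‖η - C ξ‖ = 0 := by nlinarith [norm_nonneg (η - C ξ)]
      exact (sub_eq_zero.1 (norm_eq_zero.1 h5)).symm
    have hCa : ‖ContinuousLinearMap.adjoint C η‖ ≤ 1 := by
      have := (ContinuousLinearMap.adjoint C).le_opNorm η
      rw [LinearIsometryEquiv.norm_map, hη] at this
      linarith
    have eq2 : ContinuousLinearMap.adjoint C η = ξ := by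
      have h2 := norm_sub_sq (𝕜 := ℂ) (ContinuousLinearMap.adjoint C η) ξ
      rw [ContinuousLinearMap.adjoint_inner_left, eq1, hξ, inner_self_eq_norm_sq, hη] at h2
      have h5 : ‖ContinuousLinearMap.adjoint C η - ξ‖ = 0 := by
        nlinarith [norm_nonneg (ContinuousLinearMap.adjoint C η - ξ),
          norm_nonneg (ContinuousLinearMap.adjoint C η)]
      exact sub_eq_zero.1 (norm_eq_zero.1 h5)
    refine ContinuousLinearMap.opNorm_le_bound _ zero_le_one fun v => ?_
    rw [one_mul]
    refine le_trans (le_of_eq ?_) (hCv v)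
    have h6 : inner ℂ η (C v) = inner ℂ ξ v := by
      rw [← ContinuousLinearMap.adjoint_inner_left, eq2]
    have h7 : ((2 : ℂ) • rankOne ℂ η ξ - C) v = (2 : ℂ) • (inner ℂ η (C v)) • η - C v := by
      simp [h6]
    rw [h7]
    have h8 := norm_sub_sq (𝕜 := ℂ) ((2 : ℂ) • (inner ℂ η (C v)) • η) (C v)
    rw [smul_smul, norm_smul, inner_smul_left, hη] at h8
    set α := inner ℂ η (C v)
    have h9 : RCLike.re ((starRingEnd ℂ) (2 * α) * α) = 2 * ‖α‖ ^ 2 := by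
      rw [(starRingEnd ℂ).map_mul, mul_assoc, Complex.conj_mul', ← Complex.ofReal_pow]
      simp
      rw [← Complex.ofReal_pow, Complex.ofReal_re]
    rw [h9, norm_mul] at h8
    have h10 : ‖(2 : ℂ) • α • η - C v‖ ^ 2 = ‖C v‖ ^ 2 := by
      rw [smul_smul, h8]; simp; ring
    exact (pow_left_inj₀ (norm_nonneg _) (norm_nonneg _) two_ne_zero).1 h10
  have hproj := partial_iso_of_center e he P2
  set a := star e * e with ha
  have hsa : star a = a := (IsSelfAdjoint.star_mul_self e).star_eq
  have hadj : ContinuousLinearMap.adjoint a = a := hsa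
  have hen : ∀ v w, inner ℂ (e v) (e w) = inner ℂ v (a w) := by
    intro v w
    rw [ha, mul_apply_eq_comp, ContinuousLinearMap.star_eq_adjoint,
      ContinuousLinearMap.adjoint_inner_right]
  have haa : ∀ v, a (a v) = a v := fun v => by
    rw [← mul_apply_eq_comp, hproj]
  have hea : ∀ v, e (a v) = e v := by
    intro v
    have : inner ℂ (e (v - a v)) (e (v - a v)) = 0 := by
      rw [hen, map_sub, haa, sub_self, inner_zero_right]
    rw [inner_self_eq_zero, map_sub, sub_eq_zero] at this
    exact this.symm
  have hiso : ∀ v, a v = v → ‖e v‖ = ‖v‖ := by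
    intro v hv
    have h1 := hen v v
    rw [hv, inner_self_eq_norm_sq_to_K, inner_self_eq_norm_sq_to_K] at h1
    have h2 : ‖e v‖ ^ 2 = ‖v‖ ^ 2 := by exact_mod_cast h1
    exact (pow_left_inj₀ (norm_nonneg _) (norm_nonneg _) two_ne_zero).1 h2
  -- a nonzero vector in the range
  obtain ⟨v, hv1, hav⟩ : ∃ v, ‖v‖ = 1 ∧ a v = v := by
    have : ∃ w, a w ≠ 0 := by
      by_contra hcon
      push Not at hcon
      have : e = 0 := by ext w; rw [← hea, hcon]; simp
      simp [this] at he
    obtain ⟨w, hw⟩ := this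
    refine ⟨((‖a w‖ : ℂ)⁻¹) • a w, ?_, ?_⟩
    · rw [norm_smul]; simp [norm_ne_zero_iff.2 hw]
    · rw [map_smul, haa]
  have horth : ∀ w, a w = w → inner ℂ v w = 0 → w = 0 := by
    intro w' haw' hvw'
    by_contra hw0
    set w := ((‖w'‖ : ℂ)⁻¹) • w' with hw
    have hw1 : ‖w‖ = 1 := by rw [hw, norm_smul]; simp [hw0]
    have haw : a w = w := by rw [hw, map_smul, haw']
    have hvw : inner ℂ v w = 0 := by rw [hw, inner_smul_right, hvw', mul_zero]
    have ev := hiso v hav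
    have ew := hiso w haw
    have k1 := P1 1 (rankOne ℂ (e v) v) fun N hN => by
      have := ((N : ℂ) • e + rankOne ℂ (e v) v).le_opNorm v
      have h3 : ((N : ℂ) • e + rankOne ℂ (e v) v) v = ((N + 1 : ℝ) : ℂ) • e v := by
        simp [hv1, add_smul]
      rw [h3, norm_smul, ev, hv1, mul_one, mul_one, Complex.norm_real, Real.norm_eq_abs] at this
      exact (le_abs_self _).trans this
    have k2 := P1 0 (-rankOne ℂ (e v) v) fun N hN => by
      have := ((N : ℂ) • e + -rankOne ℂ (e v) v).le_opNorm w
      have h3 : ((N : ℂ) • e + -rankOne ℂ (e v) v) w = (N : ℂ) • e w := by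
        simp [hvw]
      rw [h3, norm_smul, ew, hw1, mul_one, mul_one, Complex.norm_real, Real.norm_eq_abs] at this
      rw [add_zero]
      exact (le_abs_self _).trans this
    rw [map_neg] at k2
    simp only [neg_apply, inner_neg_right, Complex.neg_re] at k2
    linarith
  refine ⟨e v, v, (hiso v hav).trans hv1, hv1, ?_⟩
  ext w
  have h1 : a w = inner ℂ v w • v := by
    have h2 := horth (a w - inner ℂ v w • v) (by rw [map_sub, map_smul, haa, hav]) (by
      have h3 : inner ℂ v (a w) = inner ℂ v w := by
        rw [← ContinuousLinearMap.adjoint_inner_left, hadj, hav]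
      rw [inner_sub_right, inner_smul_right, h3, inner_self_eq_norm_sq_to_K, hv1]; simp)
    exact sub_eq_zero.1 h2
  rw [← hea w, h1, map_smul, rankOne_apply]

end B
end IsoRefl

namespace IsoRefl
open InnerProductSpace
section C
set_option linter.unusedSectionVars false
variable {H : Type*} [NormedAddCommGroup H] [InnerProductSpace ℂ H] [CompleteSpace H]

lemma exists_unit_orth (hH : ¬ FiniteDimensional ℂ H) (x y : H) :
    ∃ z : H, ‖z‖ = 1 ∧ inner ℂ x z = 0 ∧ inner ℂ y z = 0 := by
  set K : Submodule ℂ H := Submodule.span ℂ {x, y} with hK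
  have hfd : FiniteDimensional ℂ K := FiniteDimensional.span_of_finite ℂ (by simp)
  have hne : Kᗮ ≠ ⊥ := by
    intro h
    rw [Submodule.orthogonal_eq_bot_iff] at h
    apply hH
    rw [h] at hfd
    exact Module.Finite.of_surjective (Submodule.subtype (⊤ : Submodule ℂ H))
      (fun x => ⟨⟨x, trivial⟩, rfl⟩)
  obtain ⟨w, hw, hw0⟩ := Submodule.exists_mem_ne_zero_of_ne_bot hne
  have hwx : inner ℂ x w = 0 := hw x (Submodule.subset_span (by simp))
  have hwy : inner ℂ y w = 0 := hw y (Submodule.subset_span (by simp))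
  refine ⟨((‖w‖ : ℂ)⁻¹) • w, ?_, ?_, ?_⟩
  · rw [norm_smul]; simp [hw0]
  · rw [inner_smul_right, hwx, mul_zero]
  · rw [inner_smul_right, hwy, mul_zero]

lemma adj_lemma {a b c d p q : H} (hc : c ≠ 0) (hd : d ≠ 0)
    (h : rankOne ℂ a b + rankOne ℂ c d = rankOne ℂ p q) :
    (∃ k : ℂ, a = k • c) ∨ (∃ k : ℂ, b = k • d) := by
  by_contra hcon
  push Not at hcon
  obtain ⟨h1, h2⟩ := hcon
  have happ : ∀ z, inner ℂ b z • a + inner ℂ d z • c = inner ℂ q z • p := fun z => by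
    have := congrArg (fun T : H →L[ℂ] H => T z) h
    simpa using this
  set k : ℂ := inner ℂ d b / inner ℂ d d with hk
  have hdd : inner ℂ d d ≠ 0 := by simpa using hd
  set z := b - k • d with hz
  have hz0 : z ≠ 0 := fun h0 => h2 k (sub_eq_zero.1 h0)
  have hdz : inner ℂ d z = 0 := by
    rw [hz, inner_sub_right, inner_smul_right, hk, div_mul_cancel₀ _ hdd, sub_self]
  have hbz : inner ℂ b z ≠ 0 := by
    have h3 : b = z + k • d := by rw [hz]; abel
    rw [h3, inner_add_left, inner_smul_left, hdz, mul_zero, add_zero]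
    simpa using hz0
  have e1 := happ z
  rw [hdz, zero_smul, add_zero] at e1
  have ha0 : a ≠ 0 := fun h0 => h1 0 (by simp [h0])
  have hqz : inner ℂ q z ≠ 0 := by
    intro h0
    rw [h0, zero_smul] at e1
    rcases smul_eq_zero.1 e1 with h4 | h4
    · exact hbz h4
    · exact ha0 h4
  have hp : p = ((inner ℂ q z)⁻¹ * inner ℂ b z) • a := by
    rw [← smul_smul, e1, smul_smul, inv_mul_cancel₀ hqz, one_smul]
  have e2 := happ d
  rw [hp, smul_smul] at e2
  set m := inner ℂ q d * ((inner ℂ q z)⁻¹ * inner ℂ b z)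
  have e3 : inner ℂ d d • c = (m - inner ℂ b d) • a := by
    rw [sub_smul, ← e2]; abel
  have hm : m - inner ℂ b d ≠ 0 := by
    intro h0
    rw [h0, zero_smul] at e3
    rcases smul_eq_zero.1 e3 with h4 | h4
    · exact hdd h4
    · exact hc h4
  apply h1 ((m - inner ℂ b d)⁻¹ * inner ℂ d d)
  rw [← smul_smul, e3, smul_smul, inv_mul_cancel₀ hm, one_smul]

lemma dichotomy (F : H →+ (H →L[ℂ] H)) (hF : ∀ x, ∃ u v, F x = rankOne ℂ u v) {x₀ u₀ v₀ : H}
    (hu : u₀ ≠ 0) (hv : v₀ ≠ 0) (h0 : F x₀ = rankOne ℂ u₀ v₀) :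
    (∀ x, ∃ a, F x = rankOne ℂ a v₀) ∨ (∀ x, ∃ b, F x = rankOne ℂ u₀ b) := by
  have each : ∀ x, (∃ a, F x = rankOne ℂ a v₀) ∨ (∃ b, F x = rankOne ℂ u₀ b) := by
    intro x
    obtain ⟨a, b, hab⟩ := hF x
    obtain ⟨p, q, hpq⟩ := hF (x + x₀)
    rw [map_add, hab, h0] at hpq
    rcases adj_lemma hu hv hpq with ⟨k, hk⟩ | ⟨k, hk⟩
    · right
      refine ⟨(starRingEnd ℂ) k • b, ?_⟩
      rw [hab, hk]
      ext z
      simp [smul_smul, mul_comm, inner_smul_left]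
    · left
      refine ⟨(starRingEnd ℂ) k • a, ?_⟩
      rw [hab, hk]
      ext z
      simp [smul_smul, mul_comm, inner_smul_left]
  by_contra hcon
  push Not at hcon
  obtain ⟨⟨x, hx⟩, ⟨x', hx'⟩⟩ := hcon
  obtain ⟨b, hb⟩ : ∃ b, F x = rankOne ℂ u₀ b := (each x).resolve_left (by simpa using hx)
  obtain ⟨a, ha⟩ : ∃ a, F x' = rankOne ℂ a v₀ := (each x').resolve_right (by simpa using hx')
  rcases each (x + x') with ⟨c, hc⟩ | ⟨c, hc⟩
  · apply hx (c - a)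
    have : F x = F (x + x') - F x' := by simp
    rw [this, hc, ha]; simp
  · apply hx' (c - b)
    have : F x' = F (x + x') - F x := by simp
    rw [this, hc, hb]; simp

lemma norm_two (x x₀ y y₀ : H) (hx : ‖x‖ = 1) (hx₀ : ‖x₀‖ = 1) (hy : ‖y‖ = 1) (hy₀ : ‖y₀‖ = 1)
    (hxx : inner ℂ x₀ x = 0) (hyy : inner ℂ y₀ y = 0) :
    ‖rankOne ℂ x y₀ + rankOne ℂ x₀ y‖ ≤ 1 := by
  refine ContinuousLinearMap.opNorm_le_bound _ zero_le_one fun z => ?_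
  rw [one_mul]
  refine (pow_le_pow_iff_left₀ (norm_nonneg _) (norm_nonneg _) two_ne_zero).1 ?_
  set α := inner ℂ y₀ z with hα
  set β := inner ℂ y z with hβ
  have e1 : (rankOne ℂ x y₀ + rankOne ℂ x₀ y) z = α • x + β • x₀ := by simp [hα, hβ]
  have hxx' : inner ℂ x x₀ = 0 := by rw [← inner_conj_symm, hxx, map_zero]
  have hyy' : inner ℂ y y₀ = 0 := by rw [← inner_conj_symm, hyy, map_zero]
  have e2 := norm_add_sq (𝕜 := ℂ) (α • x) (β • x₀)
  rw [inner_smul_left, inner_smul_right, hxx', mul_zero, mul_zero, norm_smul, norm_smul, hx, hx₀]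
    at e2
  rw [e1, e2]
  set t := z - α • y₀ - β • y with ht
  have hz : z = t + (α • y₀ + β • y) := by rw [ht]; abel
  have hn : ‖α • y₀ + β • y‖ ^ 2 = ‖α‖ ^ 2 + ‖β‖ ^ 2 := by
    rw [norm_add_sq (𝕜 := ℂ), inner_smul_left, inner_smul_right, hyy, norm_smul, norm_smul, hy,
      hy₀]
    simp
  have hy1 : inner ℂ y y = 1 := by rw [inner_self_eq_norm_sq_to_K, hy]; simp
  have hy2 : inner ℂ y₀ y₀ = 1 := by rw [inner_self_eq_norm_sq_to_K, hy₀]; simp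
  have ho : inner ℂ (α • y₀ + β • y) t = 0 := by
    rw [ht, inner_add_left, inner_smul_left, inner_smul_left, inner_sub_right, inner_sub_right,
      inner_sub_right, inner_sub_right, inner_smul_right, inner_smul_right, inner_smul_right,
      inner_smul_right, hy1, hy2, hyy, hyy', ← hα, ← hβ]
    ring
  have e3 := norm_add_sq (𝕜 := ℂ) (α • y₀ + β • y) t
  rw [ho, hn, add_comm (α • y₀ + β • y) t, ← hz] at e3
  simp only [map_zero, mul_zero] at e3 ⊢
  nlinarith [sq_nonneg ‖t‖]

/-- rank-one preserving contractions, linear or conjugate linear -/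
structure RP (Ψ : (H →L[ℂ] H) →ₗ[ℝ] (H →L[ℂ] H)) : Prop where
  sig : (∀ (c : ℂ) A, Ψ (c • A) = c • Ψ A) ∨ (∀ (c : ℂ) A, Ψ (c • A) = (starRingEnd ℂ) c • Ψ A)
  norm_le : ∀ A, ‖Ψ A‖ ≤ ‖A‖
  inj : ∀ A, Ψ A = 0 → A = 0
  rk : ∀ x y, ∃ u v, Ψ (rankOne ℂ x y) = rankOne ℂ u v
  nrk : ∀ x y, ‖Ψ (rankOne ℂ x y)‖ = ‖x‖ * ‖y‖

variable {Ψ : (H →L[ℂ] H) →ₗ[ℝ] (H →L[ℂ] H)}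

lemma RP.sig1 (h : RP Ψ) (c : ℂ) : ∃ c' : ℂ, ∀ A, Ψ (c' • A) = c • Ψ A := by
  rcases h.sig with h | h
  · exact ⟨c, h c⟩
  · exact ⟨(starRingEnd ℂ) c, fun A => by rw [h, Complex.conj_conj]⟩

lemma RP.sig2 (h : RP Ψ) (c : ℂ) : ∃ c' : ℂ, ∀ A, Ψ (c • A) = c' • Ψ A := by
  rcases h.sig with h | h
  · exact ⟨c, h c⟩
  · exact ⟨(starRingEnd ℂ) c, fun A => by rw [h]⟩

/-- compose with the adjoint -/
noncomputable def dag (Ψ : (H →L[ℂ] H) →ₗ[ℝ] (H →L[ℂ] H)) : (H →L[ℂ] H) →ₗ[ℝ] (H →L[ℂ] H) :=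
  (starL' ℝ : (H →L[ℂ] H) ≃L[ℝ] (H →L[ℂ] H)).toLinearEquiv.toLinearMap ∘ₗ Ψ

lemma dag_apply (A : H →L[ℂ] H) : dag Ψ A = star (Ψ A) := rfl

lemma star_rankOne (x y : H) : star (rankOne ℂ x y) = rankOne ℂ y x := by
  rw [ContinuousLinearMap.star_eq_adjoint, adjoint_rankOne]

lemma RP.dag (h : RP Ψ) : RP (dag Ψ) where
  sig := by
    rcases h.sig with h | h
    · right; intro c A; simp [dag_apply, h, star_smul]
    · left; intro c A; simp [dag_apply, h, star_smul]
  norm_le A := by rw [dag_apply, norm_star]; exact h.norm_le A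
  inj A hA := h.inj A (star_eq_zero.1 hA)
  rk x y := by
    obtain ⟨u, v, huv⟩ := h.rk x y
    exact ⟨v, u, by rw [dag_apply, huv, star_rankOne]⟩
  nrk x y := by rw [dag_apply, norm_star, h.nrk]

end C
end IsoRefl

namespace IsoRefl
open InnerProductSpace
section D
set_option linter.unusedSectionVars false
set_option linter.unusedSimpArgs false
variable {H : Type*} [NormedAddCommGroup H] [InnerProductSpace ℂ H] [CompleteSpace H]
variable {Ψ : (H →L[ℂ] H) →ₗ[ℝ] (H →L[ℂ] H)}

lemma rankOne_self {v : H} (hv : ‖v‖ = 1) (a : H) : rankOne ℂ a v v = a := by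
  simp [hv]

lemma rankOne_real_left (r : ℝ) (x y : H) : rankOne ℂ (r • x) y = r • rankOne ℂ x y := by
  have : rankOne ℂ ((r : ℂ) • x) y = (r : ℂ) • rankOne ℂ x y := by
    ext z; simp [smul_smul, mul_comm]
  exact this

lemma rankOne_real_right (r : ℝ) (x y : H) : rankOne ℂ x (r • y) = r • rankOne ℂ x y := by
  rw [← star_rankOne, rankOne_real_left, star_smul, star_rankOne]; simp

lemma rankOne_add_left (x x' y : H) :
    rankOne ℂ (x + x') y = rankOne ℂ x y + rankOne ℂ x' y := by
  ext z; simp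

lemma rankOne_add_right (x y y' : H) :
    rankOne ℂ x (y + y') = rankOne ℂ x y + rankOne ℂ x y' := by
  ext z; simp [inner_add_left, add_smul]

lemma rankOne_smul_left (c : ℂ) (x y : H) : rankOne ℂ (c • x) y = c • rankOne ℂ x y := by
  ext z; simp [smul_smul, mul_comm]

lemma rankOne_smul_right (c : ℂ) (x y : H) :
    rankOne ℂ x (c • y) = (starRingEnd ℂ) c • rankOne ℂ x y := by
  ext z; simp [smul_smul, mul_comm, inner_smul_left]

lemma RP.left_case (h : RP Ψ) (hH : ¬ FiniteDimensional ℂ H) {x₀ y₀ u₀ v₀ : H} (hx₀ : ‖x₀‖ = 1)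
    (hy₀ : ‖y₀‖ = 1) (hu₀ : ‖u₀‖ = 1) (hv₀ : ‖v₀‖ = 1)
    (h0 : Ψ (rankOne ℂ x₀ y₀) = rankOne ℂ u₀ v₀)
    (hL : ∀ x, ∃ a, Ψ (rankOne ℂ x y₀) = rankOne ℂ a v₀) :
    ∃ U V : H →ₗᵢ[ℝ] H, ∀ x y, Ψ (rankOne ℂ x y) = rankOne ℂ (U x) (V y) := by
  have hu0 : u₀ ≠ 0 := by rintro rfl; simp at hu₀
  have hv0 : v₀ ≠ 0 := by rintro rfl; simp at hv₀
  have hx0 : x₀ ≠ 0 := by rintro rfl; simp at hx₀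
  have hy0 : y₀ ≠ 0 := by rintro rfl; simp at hy₀
  -- the other family lies in the right class
  have hR : ∀ y, ∃ b, Ψ (rankOne ℂ x₀ y) = rankOne ℂ u₀ b := by
    let F : H →+ (H →L[ℂ] H) := AddMonoidHom.mk' (fun y => Ψ (rankOne ℂ x₀ y)) (by
      intro a b; rw [rankOne_add_right, map_add])
    rcases dichotomy F (fun y => h.rk x₀ y) hu0 hv0 h0 with hc | hc
    · exfalso
      obtain ⟨x, hx, hxx, -⟩ := exists_unit_orth hH x₀ x₀
      obtain ⟨y, hy, hyy, -⟩ := exists_unit_orth hH y₀ y₀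
      obtain ⟨a, ha⟩ := hL x
      obtain ⟨b, hb⟩ := hc y
      have hb' : Ψ (rankOne ℂ x₀ y) = rankOne ℂ b v₀ := hb
      have na : ‖a‖ = 1 := by
        have := h.nrk x y₀
        rw [ha, norm_rankOne, hv₀, hx, hy₀] at this
        linarith
      have nb : ‖b‖ = 1 := by
        have := h.nrk x₀ y
        rw [hb', norm_rankOne, hv₀, hx₀, hy] at this
        linarith
      have k1 := (h.norm_le _).trans (norm_two x x₀ y y₀ hx hx₀ hy hy₀ hxx hyy)
      have k2 := (h.norm_le _).trans (norm_two x (-x₀) y y₀ hx (by simpa using hx₀) hy hy₀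
        (by simpa using hxx) hyy)
      have e2 : rankOne ℂ (-x₀) y = - rankOne ℂ x₀ y := by ext z; simp
      rw [map_add, ha, hb', ← rankOne_add_left, norm_rankOne, hv₀, mul_one] at k1
      rw [e2, map_add, map_neg, ha, hb'] at k2
      have e3 : rankOne ℂ a v₀ + - rankOne ℂ b v₀ = rankOne ℂ (a - b) v₀ := by
        ext z; simp [smul_sub, sub_eq_add_neg]
      rw [e3, norm_rankOne, hv₀, mul_one] at k2
      have := parallelogram_law_with_norm ℂ a b
      rw [na, nb] at this
      nlinarith [norm_nonneg (a + b), norm_nonneg (a - b)]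
    · exact hc
  let U₀ : H → H := fun x => Ψ (rankOne ℂ x y₀) v₀
  let V₀ : H → H := fun y => star (Ψ (rankOne ℂ x₀ y)) u₀
  have hU : ∀ x, Ψ (rankOne ℂ x y₀) = rankOne ℂ (U₀ x) v₀ := by
    intro x
    obtain ⟨a, ha⟩ := hL x
    simp only [U₀, ha, rankOne_self hv₀]
  have hV : ∀ y, Ψ (rankOne ℂ x₀ y) = rankOne ℂ u₀ (V₀ y) := by
    intro y
    obtain ⟨b, hb⟩ := hR y
    simp only [V₀, hb, star_rankOne, rankOne_self hu₀]
  let U : H →ₗᵢ[ℝ] H :=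
    { toFun := U₀
      map_add' := fun a b => by simp only [U₀]; rw [rankOne_add_left, map_add]; rfl
      map_smul' := fun r a => by simp only [U₀]; rw [rankOne_real_left, map_smul]; rfl
      norm_map' := fun x => by
        have := h.nrk x y₀
        rw [hU, norm_rankOne, hv₀, hy₀] at this
        simpa using this }
  let V : H →ₗᵢ[ℝ] H :=
    { toFun := V₀
      map_add' := fun a b => by
        simp only [V₀]; rw [rankOne_add_right, map_add, star_add]; rfl
      map_smul' := fun r a => by
        simp only [V₀]; rw [rankOne_real_right, map_smul, star_smul]; simp
      norm_map' := fun x => by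
        have := h.nrk x₀ x
        rw [hV, norm_rankOne, hu₀, hx₀] at this
        simpa using this }
  have hUa : ∀ x x', U₀ (x + x') = U₀ x + U₀ x' := U.map_add
  have hVa : ∀ x x', V₀ (x + x') = V₀ x + V₀ x' := V.map_add
  have hUn : ∀ x, ‖U₀ x‖ = ‖x‖ := U.norm_map
  have hVn : ∀ x, ‖V₀ x‖ = ‖x‖ := V.norm_map
  have hUi : ∀ x x', U₀ x = U₀ x' → x = x' := fun x x' hx => U.injective hx
  have hVi : ∀ x x', V₀ x = V₀ x' → x = x' := fun x x' hx => V.injective hx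
  have hU0 : U₀ x₀ = u₀ := by simp only [U₀, h0, rankOne_self hv₀]
  have hV0 : V₀ y₀ = v₀ := by simp only [V₀, h0, star_rankOne, rankOne_self hu₀]
  -- multiples of x₀ and y₀
  have hUsc : ∀ c : ℂ, ∃ c' : ℂ, (∀ x, U₀ (c' • x) = c • U₀ x) ∧ ∀ A, Ψ (c' • A) = c • Ψ A := by
    intro c
    obtain ⟨c', hc'⟩ := h.sig1 c
    exact ⟨c', fun x => by simp only [U₀]; rw [rankOne_smul_left, hc']; rfl, hc'⟩
  have hxpar : ∀ (c : ℂ) x y, U₀ x = c • u₀ → Ψ (rankOne ℂ x y) = rankOne ℂ (U₀ x) (V₀ y) := by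
    intro c x y hx
    obtain ⟨c', hc1, hc2⟩ := hUsc c
    have : x = c' • x₀ := hUi _ _ (by rw [hc1, hU0, hx])
    rw [hx, this, rankOne_smul_left, hc2, hV, rankOne_smul_left]
  have hypar : ∀ (c : ℂ) x y, V₀ y = c • v₀ → Ψ (rankOne ℂ x y) = rankOne ℂ (U₀ x) (V₀ y) := by
    intro c x y hy
    obtain ⟨c', hc1, hc2⟩ := hUsc ((starRingEnd ℂ) c)
    have e : Ψ (rankOne ℂ x₀ ((starRingEnd ℂ) c' • y₀)) = rankOne ℂ u₀ (c • v₀) := by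
      rw [rankOne_smul_right, Complex.conj_conj, hc2, h0, rankOne_smul_right]
    have : y = (starRingEnd ℂ) c' • y₀ := hVi _ _ (by
      rw [hy]; simp only [V₀]; rw [e, star_rankOne, rankOne_self hu₀])
    rw [hy, this, rankOne_smul_right, Complex.conj_conj, hc2, hU, rankOne_smul_right]
  refine ⟨U, V, fun x y => ?_⟩
  change Ψ (rankOne ℂ x y) = rankOne ℂ (U₀ x) (V₀ y)
  by_cases hx : x = 0
  · have : U₀ 0 = 0 := U.map_zero
    subst hx; rw [this]; simp
  by_cases hy : y = 0
  · have : V₀ 0 = 0 := V.map_zero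
    subst hy; rw [this]; simp
  have hUx : U₀ x ≠ 0 := by rw [← norm_ne_zero_iff, hUn, norm_ne_zero_iff]; exact hx
  have hVy : V₀ y ≠ 0 := by rw [← norm_ne_zero_iff, hVn, norm_ne_zero_iff]; exact hy
  obtain ⟨a, b, hab⟩ := h.rk x y
  have hne : rankOne ℂ a b ≠ 0 := by
    rw [← norm_ne_zero_iff, ← hab, h.nrk]
    exact mul_ne_zero (norm_ne_zero_iff.2 hx) (norm_ne_zero_iff.2 hy)
  have ha : a ≠ 0 := by rintro rfl; simp at hne
  have hb : b ≠ 0 := by rintro rfl; simp at hne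
  obtain ⟨p, q, h1⟩ := h.rk x (y + y₀)
  rw [rankOne_add_right, map_add, hab, hU] at h1
  obtain ⟨p', q', h2⟩ := h.rk (x + x₀) y
  rw [rankOne_add_left, map_add, hab, hV] at h2
  rcases adj_lemma hUx hv0 h1 with ⟨k, hk⟩ | ⟨k, hk⟩ <;>
  rcases adj_lemma hu0 hVy h2 with ⟨l, hl⟩ | ⟨l, hl⟩
  · have hk0 : k ≠ 0 := by rintro rfl; simp [hk] at ha
    refine hxpar (k⁻¹ * l) x y ?_
    rw [← smul_smul, ← hl, hk, smul_smul, inv_mul_cancel₀ hk0, one_smul]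
  · -- main case
    set m : ℂ := (starRingEnd ℂ) l * k with hm
    have e1 : Ψ (rankOne ℂ x y) = m • rankOne ℂ (U₀ x) (V₀ y) := by
      rw [hab, hk, hl, rankOne_smul_left, rankOne_smul_right, smul_smul, mul_comm]
    by_cases hxp : ∃ c : ℂ, U₀ x = c • u₀
    · obtain ⟨c, hc⟩ := hxp; exact hxpar c x y hc
    by_cases hyp : ∃ c : ℂ, V₀ y = c • v₀
    · obtain ⟨c, hc⟩ := hyp; exact hypar c x y hc
    have hy2 : V₀ y + v₀ ≠ 0 := fun h0 => hyp ⟨-1, by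
      rw [neg_smul, one_smul]; exact eq_neg_of_add_eq_zero_left h0⟩
    obtain ⟨p, q, h3⟩ := h.rk (x + x₀) (y + y₀)
    rw [rankOne_add_left, rankOne_add_right, rankOne_add_right, map_add, map_add, map_add, e1,
      hU, hV, h0] at h3
    have h4 : rankOne ℂ (U₀ x) ((starRingEnd ℂ) m • V₀ y + v₀) + rankOne ℂ u₀ (V₀ y + v₀)
        = rankOne ℂ p q := by
      rw [← h3, rankOne_add_right, rankOne_add_right, rankOne_smul_right, Complex.conj_conj]
    rcases adj_lemma hu0 hy2 h4 with hc | ⟨c, hc⟩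
    · exact absurd hc hxp
    · rw [smul_add] at hc
      have h5 : ((starRingEnd ℂ) m - c) • V₀ y = (c - 1) • v₀ := by
        rw [sub_smul, sub_smul, one_smul, sub_eq_sub_iff_add_eq_add, hc, add_comm]
      have h6 : (starRingEnd ℂ) m - c = 0 := by
        by_contra hne0
        exact hyp ⟨((starRingEnd ℂ) m - c)⁻¹ * (c - 1), by
          rw [← smul_smul, ← h5, smul_smul, inv_mul_cancel₀ hne0, one_smul]⟩
      rw [h6, zero_smul] at h5
      have h7 : c = 1 := by
        rcases smul_eq_zero.1 h5.symm with h8 | h8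
        · exact sub_eq_zero.1 h8
        · exact absurd h8 hv0
      have h8 : m = 1 := by
        have h9 : (starRingEnd ℂ) m = 1 := by rw [← h7]; exact sub_eq_zero.1 h6
        rw [← Complex.conj_conj m, h9, map_one]
      rw [e1, h8, one_smul]
  · -- multiple of ρ(u₀,v₀)
    obtain ⟨c', hc1, hc2⟩ := hUsc (l * (starRingEnd ℂ) k)
    have e1 : Ψ (rankOne ℂ x y - c' • rankOne ℂ x₀ y₀) = 0 := by
      rw [map_sub, hc2, h0, hab, hk, hl, rankOne_smul_left, rankOne_smul_right, smul_smul,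
        sub_self]
    have e2 := sub_eq_zero.1 (h.inj _ e1)
    have e3 : inner ℂ y y • x = (c' * inner ℂ y₀ y) • x₀ := by
      have := congrArg (fun T : H →L[ℂ] H => T y) e2
      simpa [smul_smul] using this
    have hyy : inner ℂ y y ≠ 0 := by simpa using hy
    have e4 : x = ((inner ℂ y y)⁻¹ * (c' * inner ℂ y₀ y)) • x₀ := by
      rw [← smul_smul, ← e3, smul_smul, inv_mul_cancel₀ hyy, one_smul]
    obtain ⟨d, hd⟩ := h.sig2 ((inner ℂ y y)⁻¹ * (c' * inner ℂ y₀ y))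
    refine hxpar d x y ?_
    simp only [U₀]
    rw [e4, rankOne_smul_left, hd, h0]
    change d • (rankOne ℂ u₀ v₀ v₀) = _
    rw [rankOne_self hv₀]
  · have hl0 : l ≠ 0 := by rintro rfl; simp [hl] at hb
    refine hypar (l⁻¹ * k) x y ?_
    rw [← smul_smul, ← hk, hl, smul_smul, inv_mul_cancel₀ hl0, one_smul]

lemma RP.forms (h : RP Ψ) (hH : ¬ FiniteDimensional ℂ H) :
    ∃ U V : H →ₗᵢ[ℝ] H, (∀ x y, Ψ (rankOne ℂ x y) = rankOne ℂ (U x) (V y)) ∨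
      (∀ x y, IsoRefl.dag Ψ (rankOne ℂ x y) = rankOne ℂ (U x) (V y)) := by
  obtain ⟨x₀, hx₀, -, -⟩ := exists_unit_orth hH 0 0
  obtain ⟨u, v, huv⟩ := h.rk x₀ x₀
  have hn := h.nrk x₀ x₀
  rw [huv, norm_rankOne, hx₀, mul_one] at hn
  have hu : ‖u‖ ≠ 0 := by intro h0; rw [h0] at hn; simp at hn
  obtain ⟨u₀, v₀, hu₀, hv₀, h0⟩ : ∃ u₀ v₀ : H, ‖u₀‖ = 1 ∧ ‖v₀‖ = 1 ∧
      Ψ (rankOne ℂ x₀ x₀) = rankOne ℂ u₀ v₀ := by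
    refine ⟨(‖u‖⁻¹ : ℝ) • u, ‖u‖ • v, ?_, ?_, ?_⟩
    · rw [norm_smul, norm_inv, norm_norm, inv_mul_cancel₀ hu]
    · rw [norm_smul, norm_norm, hn]
    · rw [huv, rankOne_real_left, rankOne_real_right, smul_smul, inv_mul_cancel₀ hu, one_smul]
  have hu0 : u₀ ≠ 0 := by rintro rfl; simp at hu₀
  have hv0 : v₀ ≠ 0 := by rintro rfl; simp at hv₀
  let F : H →+ (H →L[ℂ] H) := AddMonoidHom.mk' (fun x => Ψ (rankOne ℂ x x₀)) (by
      intro a b; rw [rankOne_add_left, map_add])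
  rcases dichotomy F (fun x => h.rk x x₀) hu0 hv0 h0 with hc | hc
  · obtain ⟨U, V, hUV⟩ := h.left_case hH hx₀ hx₀ hu₀ hv₀ h0 hc
    exact ⟨U, V, Or.inl hUV⟩
  · obtain ⟨U, V, hUV⟩ := h.dag.left_case hH hx₀ hx₀ hv₀ hu₀
      (by rw [dag_apply, h0, star_rankOne]) (fun x => by
        obtain ⟨b, hb⟩ := hc x
        exact ⟨b, by rw [dag_apply, ← star_rankOne u₀ b]; exact congrArg star hb⟩)
    exact ⟨U, V, Or.inr hUV⟩

end D
end IsoRefl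

namespace IsoRefl
open InnerProductSpace
section E
set_option linter.unusedSectionVars false
set_option linter.unusedSimpArgs false
variable {H : Type*} [NormedAddCommGroup H] [InnerProductSpace ℂ H] [CompleteSpace H]
variable {Ψ : (H →L[ℂ] H) →ₗ[ℝ] (H →L[ℂ] H)}

lemma re_inner_isom (U : H →ₗᵢ[ℝ] H) (x z : H) :
    (inner ℂ (U x) (U z)).re = (inner ℂ x z).re := by
  have h1 := norm_add_sq (𝕜 := ℂ) x z
  have h2 := norm_add_sq (𝕜 := ℂ) (U x) (U z)
  rw [← map_add, U.norm_map, U.norm_map, U.norm_map] at h2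
  simp only [RCLike.re_eq_complex_re] at h1 h2
  linarith

lemma eq_of_re_inner (U : H →ₗᵢ[ℝ] H) (hU : Function.Surjective U) (w : H)
    (h : ∀ x, ‖x‖ = 1 → (inner ℂ (U x) w).re = 0) : w = 0 := by
  by_contra hw
  have hn : ‖w‖ ≠ 0 := norm_ne_zero_iff.2 hw
  obtain ⟨x, hx⟩ := hU ((‖w‖⁻¹ : ℝ) • w)
  have h1 := h x (by
    rw [← U.norm_map, hx, norm_smul, norm_inv, norm_norm, inv_mul_cancel₀ hn])
  have h2 : ((‖w‖⁻¹ : ℝ) • w) = ((‖w‖⁻¹ : ℝ) : ℂ) • w := rfl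
  rw [hx, h2, inner_smul_left, inner_self_eq_norm_sq_to_K, Complex.conj_ofReal] at h1
  have h3 : ((‖w‖⁻¹ : ℝ) : ℂ) * (‖w‖ : ℂ) ^ 2 = ((‖w‖⁻¹ * ‖w‖ ^ 2 : ℝ) : ℂ) := by push_cast; rfl
  have h4 : ((‖w‖⁻¹ * ‖w‖ ^ 2 : ℝ) : ℂ).re = 0 := by rw [← h3]; exact h1
  rw [Complex.ofReal_re] at h4
  replace h1 := h4
  field_simp at h1
  exact hn h1

lemma l8 (hn : ∀ A, ‖Ψ A‖ ≤ ‖A‖) (U V : H →ₗᵢ[ℝ] H)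
    (hUV : ∀ x y, Ψ (rankOne ℂ x y) = rankOne ℂ (U x) (V y)) (hU : Function.Surjective U)
    (A : H →L[ℂ] H) (y : H) : Ψ A (V y) = U (A y) := by
  have h1 : ∀ (B : H →L[ℂ] H) (x y : H), ‖x‖ = 1 → ‖y‖ = 1 →
      (inner ℂ (U x) (Ψ B (V y))).re ≤ (inner ℂ x (B y)).re := by
    intro B x y hx hy
    refine coeff_le (by rw [U.norm_map, hx]) (by rw [V.norm_map, hy]) hx hy fun N hN => ?_
    have := hn ((N : ℂ) • rankOne ℂ x y + B)
    have e : Ψ ((N : ℂ) • rankOne ℂ x y + B) = (N : ℂ) • rankOne ℂ (U x) (V y) + Ψ B := by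
      rw [map_add, ← hUV]
      congr 1
      exact Ψ.map_smul N _
    rwa [e] at this
  have h2 : ∀ x y, ‖x‖ = 1 → ‖y‖ = 1 →
      (inner ℂ (U x) (Ψ A (V y))).re = (inner ℂ x (A y)).re := by
    intro x y hx hy
    refine le_antisymm (h1 A x y hx hy) ?_
    have := h1 (-A) x y hx hy
    rw [map_neg] at this
    simp only [neg_apply, inner_neg_right, Complex.neg_re] at this
    linarith
  have h3 : ∀ y, ‖y‖ = 1 → Ψ A (V y) = U (A y) := by
    intro y hy
    rw [← sub_eq_zero]
    refine eq_of_re_inner U hU _ fun x hx => ?_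
    rw [inner_sub_right, Complex.sub_re, re_inner_isom, h2 x y hx hy, sub_self]
  by_cases hy : y = 0
  · subst hy; simp
  have hn : ‖y‖ ≠ 0 := norm_ne_zero_iff.2 hy
  have h4 := h3 ((‖y‖⁻¹ : ℝ) • y) (by
    rw [norm_smul, norm_inv, norm_norm, inv_mul_cancel₀ hn])
  rw [map_smul, ContinuousLinearMap.map_smul_of_tower, ContinuousLinearMap.map_smul_of_tower,
    map_smul] at h4
  exact smul_right_injective H (inv_ne_zero hn) h4

/-- standard form of a map on `B(H)` -/
def Std (S : (H →L[ℂ] H) → (H →L[ℂ] H)) : Prop :=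
  ∃ U V : H ≃ₗᵢ[ℝ] H, (∀ A z, S A (V z) = U (A z)) ∨ (∀ A z, S A (V z) = U (star A z))

lemma re_inner_star (A : H →L[ℂ] H) (x y : H) : inner ℂ (star A x) y = inner ℂ x (A y) := by
  rw [ContinuousLinearMap.star_eq_adjoint, ContinuousLinearMap.adjoint_inner_left]

lemma std_of (h : RP Ψ) {U V : H →ₗᵢ[ℝ] H} (hU : Function.Surjective U)
    (hV : Function.Surjective V)
    (hUV : (∀ x y, Ψ (rankOne ℂ x y) = rankOne ℂ (U x) (V y)) ∨
      (∀ x y, dag Ψ (rankOne ℂ x y) = rankOne ℂ (U x) (V y))) : Std Ψ := by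
  rcases hUV with hUV | hUV
  · exact ⟨LinearIsometryEquiv.ofSurjective U hU, LinearIsometryEquiv.ofSurjective V hV,
      Or.inl fun A z => l8 h.norm_le U V hUV hU A z⟩
  · refine ⟨LinearIsometryEquiv.ofSurjective V hV, LinearIsometryEquiv.ofSurjective U hU,
      Or.inr fun A z => ?_⟩
    have h1 := l8 h.dag.norm_le U V hUV hU A
    change Ψ A (U z) = V (star A z)
    rw [← sub_eq_zero]
    refine eq_of_re_inner V hV _ fun x hx => ?_
    rw [inner_sub_right, Complex.sub_re, re_inner_isom, ← re_inner_star]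
    have h2 : star (Ψ A) (V x) = U (A x) := h1 x
    rw [h2, re_inner_isom]
    have h3 := re_inner_star (star A) x z
    rw [star_star] at h3
    rw [h3, sub_self]

lemma surj_of_rank (h : RP Ψ) {U V : H →ₗᵢ[ℝ] H}
    (hUV : ∀ x y, Ψ (rankOne ℂ x y) = rankOne ℂ (U x) (V y)) (x₀ : H) (hx₀ : ‖x₀‖ = 1) :
    (∀ (k : ℂ) p, ∃ p', k • U p = U p') ∧ (∀ (k : ℂ) p, ∃ p', k • V p = V p') := by
  constructor
  · intro k p
    obtain ⟨k', hk⟩ := h.sig1 k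
    refine ⟨k' • p, ?_⟩
    have h1 := hk (rankOne ℂ p x₀)
    rw [← rankOne_smul_left, hUV, hUV, ← rankOne_smul_left] at h1
    have h2 := congrArg (fun T : H →L[ℂ] H => T (V x₀)) h1
    have hV0 : ‖V x₀‖ = 1 := by rw [V.norm_map, hx₀]
    simp only [rankOne_self hV0] at h2
    exact h2.symm
  · intro k p
    obtain ⟨k', hk⟩ := h.sig1 ((starRingEnd ℂ) k)
    refine ⟨(starRingEnd ℂ) k' • p, ?_⟩
    have h1 := hk (rankOne ℂ x₀ p)
    have e : k' • rankOne ℂ x₀ p = rankOne ℂ x₀ ((starRingEnd ℂ) k' • p) := by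
      rw [rankOne_smul_right, Complex.conj_conj]
    rw [e, hUV, hUV, ← rankOne_smul_right] at h1
    have h2 := congrArg (fun T : H →L[ℂ] H => star T (U x₀)) h1
    have hU0 : ‖U x₀‖ = 1 := by rw [U.norm_map, hx₀]
    simp only [star_rankOne, rankOne_self hU0] at h2
    exact h2.symm

/-- dense range and injectivity of the image of one operator force surjectivity. -/
lemma surj_of_K (h : RP Ψ) {U V : H →ₗᵢ[ℝ] H}
    (hUV : ∀ x y, Ψ (rankOne ℂ x y) = rankOne ℂ (U x) (V y)) (x₀ : H) (hx₀ : ‖x₀‖ = 1)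
    (K : H →L[ℂ] H)
    (hK : K ∈ (Submodule.span ℝ {A : H →L[ℂ] H | ∃ x y, A = rankOne ℂ x y}).topologicalClosure)
    (hd : DenseRange (Ψ K)) (hd' : DenseRange (star (Ψ K) : H →L[ℂ] H)) :
    Function.Surjective U ∧ Function.Surjective V := by
  obtain ⟨h1, h2⟩ := surj_of_rank h hUV x₀ hx₀
  have hΨc : Continuous Ψ := AddMonoidHomClass.continuous_of_bound Ψ 1 (fun A => by
    rw [one_mul]; exact h.norm_le A)
  have key : ∀ (W : H →ₗᵢ[ℝ] H) (G : (H →L[ℂ] H) →ₗ[ℝ] (H →L[ℂ] H)), Continuous G →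
      (∀ x y z, ∃ p, G (rankOne ℂ x y) z = W p) → DenseRange (G K) → Function.Surjective W := by
    intro W G hG hr hdense
    have hWc : IsClosed (Set.range W) := W.isometry.isClosedEmbedding.isClosed_range
    let M : Submodule ℝ (H →L[ℂ] H) :=
      { carrier := {B | ∀ z, G B z ∈ LinearMap.range W.toLinearMap}
        add_mem' := fun {a b} ha hb z => by
          rw [map_add]; exact Submodule.add_mem _ (ha z) (hb z)
        zero_mem' := fun z => by rw [map_zero]; exact Submodule.zero_mem _
        smul_mem' := fun c a ha z => by
          rw [map_smul]; exact Submodule.smul_mem _ c (ha z) }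
    have hMc : IsClosed (M : Set (H →L[ℂ] H)) := by
      have : (M : Set (H →L[ℂ] H)) = ⋂ z, {B | G B z ∈ Set.range W} := by
        ext B; simp [M]
      rw [this]
      refine isClosed_iInter fun z => hWc.preimage ?_
      exact (ContinuousLinearMap.apply ℂ H z).continuous.comp hG
    have hle : Submodule.span ℝ {A : H →L[ℂ] H | ∃ x y, A = rankOne ℂ x y} ≤ M := by
      rw [Submodule.span_le]
      rintro A ⟨x, y, rfl⟩ z
      obtain ⟨p, hp⟩ := hr x y z
      exact ⟨p, hp.symm⟩
    have hKM : K ∈ M := Submodule.topologicalClosure_minimal _ hle hMc hK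
    have hsub : Set.range (G K) ⊆ Set.range W := by
      rintro _ ⟨z, rfl⟩
      obtain ⟨p, hp⟩ := hKM z
      exact ⟨p, hp⟩
    have : Dense (Set.range W) := hdense.mono hsub
    rw [← Set.range_eq_univ, ← hWc.closure_eq, this.closure_eq]
  constructor
  · refine key U Ψ hΨc (fun x y z => ?_) hd
    obtain ⟨p, hp⟩ := h1 (inner ℂ (V y) z) x
    exact ⟨p, by rw [hUV, ← hp]; simp⟩
  · refine key V (dag Ψ) ?_ (fun x y z => ?_) hd'
    · exact continuous_star.comp hΨc
    · obtain ⟨p, hp⟩ := h2 (inner ℂ (U x) z) y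
      exact ⟨p, by rw [dag_apply, hUV, star_rankOne, ← hp]; simp⟩

lemma dense_star_of_inj (A : H →L[ℂ] H) (hA : ∀ z, A z = 0 → z = 0) : DenseRange (star A : H →L[ℂ] H) := by
  have h1 : (LinearMap.range (star A).toLinearMap)ᗮ = ⊥ := by
    rw [Submodule.eq_bot_iff]
    intro z hz
    apply hA
    rw [← inner_self_eq_zero (𝕜 := ℂ)]
    have h2 := hz (star A (A z)) ⟨A z, rfl⟩
    rw [re_inner_star] at h2
    exact h2
  have := Submodule.topologicalClosure_eq_top_iff.2 h1
  rw [DenseRange, dense_iff_closure_eq]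
  have h3 := congrArg (fun M : Submodule ℂ H => (M : Set H)) this
  simp only [Submodule.topologicalClosure_coe, Submodule.top_coe] at h3
  have h4 : ((LinearMap.range (star A).toLinearMap : Submodule ℂ H) : Set H)
      = Set.range (star A : H →L[ℂ] H) := by ext; simp
  rw [← h4]; exact h3

lemma inj_of_dense_star (A : H →L[ℂ] H) (hA : DenseRange (star A : H →L[ℂ] H)) (z : H) (hz : A z = 0) :
    z = 0 := by
  refine hA.induction_on (p := fun w => inner ℂ w z = 0) z ?_ ?_ |> inner_self_eq_zero.1
  · exact isClosed_eq (by fun_prop) continuous_const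
  · intro a
    rw [re_inner_star, hz, inner_zero_right]

lemma Std.surj_inj {S : (H →L[ℂ] H) → (H →L[ℂ] H)} (hS : Std S) {K : H →L[ℂ] H} (hsa : star K = K)
    (hK : ∀ z, K z = 0 → z = 0) :
    (∀ z, S K z = 0 → z = 0) ∧ DenseRange (S K) := by
  obtain ⟨U, V, hUV⟩ := hS
  have h : ∀ z, S K (V z) = U (K z) := by
    rcases hUV with h | h
    · exact h K
    · intro z; rw [h, hsa]
  constructor
  · intro z hz
    obtain ⟨w, rfl⟩ := V.surjective z
    rw [h, map_eq_zero_iff _ U.injective] at hz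
    rw [hK w hz, map_zero]
  · have h1 : DenseRange K := by have := dense_star_of_inj K hK; rwa [hsa] at this
    have h2 : DenseRange (U ∘ K) := U.surjective.denseRange.comp h1 U.continuous
    refine h2.mono ?_
    rintro _ ⟨z, rfl⟩
    exact ⟨V z, h z⟩

lemma Std.norm_eq {S : (H →L[ℂ] H) → (H →L[ℂ] H)} (hS : Std S) (A : H →L[ℂ] H) :
    ‖S A‖ = ‖A‖ := by
  obtain ⟨U, V, hUV⟩ := hS
  have key : ∀ A B : H →L[ℂ] H, (∀ z, A (V z) = U (B z)) → ‖A‖ = ‖B‖ := by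
    intro A B h
    refine le_antisymm (A.opNorm_le_bound (norm_nonneg _) fun z => ?_)
      (B.opNorm_le_bound (norm_nonneg _) fun z => ?_)
    · obtain ⟨w, rfl⟩ := V.surjective z
      rw [h, U.norm_map, V.norm_map]; exact B.le_opNorm w
    · rw [← U.norm_map, ← h, ← V.norm_map z]; exact A.le_opNorm _
  rcases hUV with h | h
  · exact key _ _ (h A)
  · rw [key _ _ (h A), norm_star]

lemma Std.surjective (hS : Std Ψ)
    (hsig : (∀ (c : ℂ) A, Ψ (c • A) = c • Ψ A)) : Function.Surjective Ψ := by
  obtain ⟨U, V, hUV⟩ := hS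
  have e1 : Ψ 1 ∘ V = U := by
    funext z
    rcases hUV with h | h <;> simp [h]
  have hinj : Function.Injective (Ψ 1) := by
    intro a b hab
    obtain ⟨a, rfl⟩ := V.surjective a
    obtain ⟨b, rfl⟩ := V.surjective b
    have h1 : U a = U b := by rw [← e1]; exact hab
    rw [U.injective h1]
  have hsc : ∀ c : ℂ, ∃ c' : ℂ, (∀ z, U (c • z) = c' • U z) ∧ (∀ z, V (c • z) = c' • V z) := by
    intro c
    rcases hUV with h | h
    · refine ⟨c, ?_⟩
      have h1 : ∀ z, U (c • z) = c • U z := by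
        intro z
        have h2 := h (c • 1) z
        have h3 := h 1 z
        rw [hsig] at h2
        simp only [smul_apply, one_apply_eq_self] at h2 h3
        rw [← h2, h3]
      refine ⟨h1, fun z => hinj ?_⟩
      have h2 := h 1 (c • z)
      have h3 := h 1 z
      simp only [one_apply_eq_self] at h2 h3
      rw [h2, (Ψ 1).map_smul, h3, h1]
    · refine ⟨(starRingEnd ℂ) c, ?_⟩
      have h1 : ∀ z, U (c • z) = (starRingEnd ℂ) c • U z := by
        intro z
        have h2 := h ((starRingEnd ℂ) c • 1) z
        have h3 := h 1 z
        rw [hsig] at h2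
        simp only [smul_apply, one_apply_eq_self, star_smul, star_one] at h2 h3
        rw [h3] at h2
        rw [h2]; simp
      refine ⟨h1, fun z => hinj ?_⟩
      have h2 := h 1 (c • z)
      have h3 := h 1 z
      simp only [one_apply_eq_self, star_one] at h2 h3
      rw [h2, (Ψ 1).map_smul, h3, h1]
  intro B
  let A₀ : H →ₗ[ℂ] H :=
    { toFun := fun z => U.symm (B (V z))
      map_add' := fun a b => by simp
      map_smul' := fun c a => by
        obtain ⟨c', h1, h2⟩ := hsc c
        simp only [RingHom.id_apply]
        apply U.injective
        rw [h1, h2]; simp }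
  let A : H →L[ℂ] H := A₀.mkContinuous ‖B‖ (fun z => by
    change ‖U.symm (B (V z))‖ ≤ _
    rw [U.symm.norm_map, ← V.norm_map z]; exact B.le_opNorm _)
  have hA : ∀ z, U (A z) = B (V z) := fun z => by
    change U (U.symm (B (V z))) = _
    simp
  rcases hUV with h | h
  · refine ⟨A, ?_⟩
    ext z
    obtain ⟨z, rfl⟩ := V.surjective z
    rw [h, hA]
  · refine ⟨star A, ?_⟩
    ext z
    obtain ⟨z, rfl⟩ := V.surjective z
    rw [h, star_star, hA]

lemma RP.std_of_K (h : RP Ψ) (hH : ¬ FiniteDimensional ℂ H) (K : H →L[ℂ] H)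
    (hK : K ∈ (Submodule.span ℝ {A : H →L[ℂ] H | ∃ x y, A = rankOne ℂ x y}).topologicalClosure)
    (hi : ∀ z, Ψ K z = 0 → z = 0) (hd : DenseRange (Ψ K)) : Std Ψ := by
  obtain ⟨x₀, hx₀, -, -⟩ := exists_unit_orth hH 0 0
  obtain ⟨U, V, hUV⟩ := h.forms hH
  have hd' := dense_star_of_inj _ hi
  rcases id hUV with h1 | h1
  · obtain ⟨hU, hV⟩ := surj_of_K h h1 x₀ hx₀ K hK hd hd'
    exact std_of h hU hV hUV
  · obtain ⟨hU, hV⟩ := surj_of_K h.dag h1 x₀ hx₀ K hK hd' (by rwa [dag_apply, star_star])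
    exact std_of h hU hV hUV

lemma rp_of_unit (hs : ∀ (c : ℂ) A, Ψ (c • A) = c • Ψ A) (hn : ∀ A, ‖Ψ A‖ ≤ ‖A‖)
    (hi : ∀ A, Ψ A = 0 → A = 0)
    (hr : ∀ x y : H, ‖x‖ = 1 → ‖y‖ = 1 → ∃ u v : H, ‖u‖ = 1 ∧ ‖v‖ = 1 ∧
      Ψ (rankOne ℂ x y) = rankOne ℂ u v) : RP Ψ := by
  have key : ∀ x y, ∃ u v, Ψ (rankOne ℂ x y) = rankOne ℂ u v ∧
      ‖rankOne ℂ u v‖ = ‖x‖ * ‖y‖ := by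
    intro x y
    by_cases hx : x = 0
    · exact ⟨0, 0, by simp [hx], by simp [hx]⟩
    by_cases hy : y = 0
    · exact ⟨0, 0, by simp [hy], by simp [hy]⟩
    have hx' : ‖x‖ ≠ 0 := norm_ne_zero_iff.2 hx
    have hy' : ‖y‖ ≠ 0 := norm_ne_zero_iff.2 hy
    obtain ⟨u, v, hu, hv, huv⟩ := hr ((‖x‖⁻¹ : ℝ) • x) ((‖y‖⁻¹ : ℝ) • y)
      (by rw [norm_smul, norm_inv, norm_norm, inv_mul_cancel₀ hx'])
      (by rw [norm_smul, norm_inv, norm_norm, inv_mul_cancel₀ hy'])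
    refine ⟨‖x‖ • u, ‖y‖ • v, ?_, ?_⟩
    · rw [rankOne_real_left, rankOne_real_right, ← huv, rankOne_real_left, rankOne_real_right,
        map_smul, map_smul, smul_smul, smul_smul, smul_smul]
      have : ‖x‖ * ‖y‖ * ‖x‖⁻¹ * ‖y‖⁻¹ = 1 := by field_simp
      simp only [← mul_assoc, this, one_smul]
    · rw [norm_rankOne, norm_smul, norm_smul, hu, hv]; simp
  exact ⟨Or.inl hs, hn, hi, fun x y => by
    obtain ⟨u, v, h1, -⟩ := key x y; exact ⟨u, v, h1⟩, fun x y => by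
    obtain ⟨u, v, h1, h2⟩ := key x y; rw [h1, h2]⟩

/-- every surjective isometry of `B(H)` has the standard form -/
lemma std_isom (hH : ¬ FiniteDimensional ℂ H) (R : (H →L[ℂ] H) ≃ₗᵢ[ℂ] (H →L[ℂ] H)) : Std R := by
  let Ψ : (H →L[ℂ] H) →ₗ[ℝ] (H →L[ℂ] H) := R.toLinearEquiv.toLinearMap.restrictScalars ℝ
  have h : RP Ψ := rp_of_unit (fun c A => R.map_smul c A) (fun A => (R.norm_map A).le)
    (fun A hA => (map_eq_zero_iff _ R.injective).1 hA) (fun x y hx hy => isom_rankOne R hx hy)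
  have hs : ∀ u v : H, ∃ p q, Ψ (rankOne ℂ p q) = rankOne ℂ u v := by
    have h' : RP (R.symm.toLinearEquiv.toLinearMap.restrictScalars ℝ) :=
      rp_of_unit (fun c A => R.symm.map_smul c A) (fun A => (R.symm.norm_map A).le)
        (fun A hA => (map_eq_zero_iff _ R.symm.injective).1 hA)
        (fun x y hx hy => isom_rankOne R.symm hx hy)
    intro u v
    obtain ⟨p, q, hpq⟩ := h'.rk u v
    refine ⟨p, q, ?_⟩
    rw [← hpq]
    exact R.apply_symm_apply _
  obtain ⟨x₀, hx₀, -, -⟩ := exists_unit_orth hH 0 0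
  obtain ⟨U, V, hUV⟩ := h.forms hH
  have key : ∀ {G : (H →L[ℂ] H) →ₗ[ℝ] (H →L[ℂ] H)}, RP G →
      (∀ u v : H, ∃ p q, G (rankOne ℂ p q) = rankOne ℂ u v) →
      (∀ x y, G (rankOne ℂ x y) = rankOne ℂ (U x) (V y)) →
      Function.Surjective U ∧ Function.Surjective V := by
    intro G hG hs hUV
    obtain ⟨h1, h2⟩ := surj_of_rank hG hUV x₀ hx₀
    have hU0 : ‖U x₀‖ = 1 := by rw [U.norm_map, hx₀]
    have hV0 : ‖V x₀‖ = 1 := by rw [V.norm_map, hx₀]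
    constructor
    · intro u
      obtain ⟨p, q, hpq⟩ := hs u (V x₀)
      rw [hUV] at hpq
      have h3 := congrArg (fun T : H →L[ℂ] H => T (V x₀)) hpq
      simp only [rankOne_self hV0, rankOne_apply] at h3
      obtain ⟨p', hp'⟩ := h1 (inner ℂ (V q) (V x₀)) p
      exact ⟨p', by rw [← hp', h3]; try simp [hx₀]⟩
    · intro v
      obtain ⟨p, q, hpq⟩ := hs (U x₀) v
      rw [hUV] at hpq
      have h3 := congrArg (fun T : H →L[ℂ] H => star T (U x₀)) hpq
      simp only [star_rankOne, rankOne_apply] at h3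
      obtain ⟨p', hp'⟩ := h2 (inner ℂ (U p) (U x₀)) q
      exact ⟨p', by rw [← hp', h3]; try simp [hx₀]⟩
  have : Std Ψ := by
    rcases id hUV with h1 | h1
    · obtain ⟨hU, hV⟩ := key h hs h1
      exact std_of h hU hV hUV
    · obtain ⟨hU, hV⟩ := key h.dag (fun u v => by
        obtain ⟨p, q, hpq⟩ := hs v u
        exact ⟨p, q, by rw [dag_apply, hpq, star_rankOne]⟩) h1
      exact std_of h hU hV hUV
  exact this

end E
end IsoRefl

namespace IsoRefl
open InnerProductSpace
section F
set_option linter.unusedSectionVars false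
set_option linter.unusedSimpArgs false
variable {H : Type*} [NormedAddCommGroup H] [InnerProductSpace ℂ H] [CompleteSpace H]

lemma Std.one {S : (H →L[ℂ] H) → (H →L[ℂ] H)} (hS : Std S) :
    (∀ z, ‖S 1 z‖ = ‖z‖) ∧ Function.Surjective (S 1) := by
  obtain ⟨U, V, hUV⟩ := hS
  have e1 : ∀ z, S 1 (V z) = U z := by
    intro z
    rcases hUV with h | h <;> simp [h]
  constructor
  · intro z
    obtain ⟨w, rfl⟩ := V.surjective z
    rw [e1, U.norm_map, V.norm_map]
  · intro z
    obtain ⟨w, rfl⟩ := U.surjective z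
    exact ⟨V w, e1 w⟩

lemma Std.inj_of_bij {S : (H →L[ℂ] H) → (H →L[ℂ] H)} (hS : Std S) {A : H →L[ℂ] H}
    (hi : ∀ z, S A z = 0 → z = 0) (hs : Function.Surjective (S A)) (z : H) (hz : A z = 0) :
    z = 0 := by
  obtain ⟨U, V, hUV⟩ := hS
  rcases hUV with h | h
  · have := hi (V z) (by rw [h, hz, map_zero])
    simpa using this
  · have h1 : Function.Surjective (star A : H →L[ℂ] H) := by
      intro w
      obtain ⟨t, ht⟩ := hs (U w)
      obtain ⟨t, rfl⟩ := V.surjective t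
      rw [h] at ht
      exact ⟨t, U.injective ht⟩
    exact inj_of_dense_star A h1.denseRange z hz

lemma exists_K (H : Type*) [NormedAddCommGroup H] [InnerProductSpace ℂ H] [CompleteSpace H]
    [TopologicalSpace.SeparableSpace H] : ∃ K : H →L[ℂ] H, star K = K ∧ (∀ z, K z = 0 → z = 0) ∧
    K ∈ (Submodule.span ℝ {A : H →L[ℂ] H | ∃ x y, A = rankOne ℂ x y}).topologicalClosure := by
  let d : ℕ → H := TopologicalSpace.denseSeq H
  have hd : DenseRange d := TopologicalSpace.denseRange_denseSeq H
  let c : ℕ → ℝ := fun n => (1 / 2) ^ n / (1 + ‖d n‖ ^ 2)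
  have hc : ∀ n, 0 < c n := fun n => by positivity
  let F : ℕ → (H →L[ℂ] H) := fun n => c n • rankOne ℂ (d n) (d n)
  have hF : Summable F := by
    refine Summable.of_norm_bounded summable_geometric_two fun n => ?_
    simp only [F, norm_smul, norm_rankOne, Real.norm_eq_abs, abs_of_pos (hc n)]
    simp only [c]
    rw [div_mul_eq_mul_div, div_le_iff₀ (by positivity)]
    have : 0 ≤ (1 / 2 : ℝ) ^ n := by positivity
    nlinarith
  have hs := hF.hasSum
  refine ⟨∑' n, F n, ?_, ?_, ?_⟩
  · have h1 := hs.star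
    have h2 : (fun n => star (F n)) = F := by
      funext n
      simp only [F, star_smul, star_rankOne, star_trivial]
    rw [h2] at h1
    exact h1.unique hs
  · intro z hz
    have h1 : HasSum (fun n => c n * ‖inner ℂ (d n) z‖ ^ 2) 0 := by
      have h2 := hs.mapL (ContinuousLinearMap.apply ℂ H z)
      have h3 := h2.mapL (innerSL ℂ z)
      have h4 := h3.mapL Complex.reCLM
      simp only [ContinuousLinearMap.apply_apply, hz, map_zero] at h4
      convert h4 using 2 with n
      simp only [F, smul_apply, rankOne_apply, innerSL_apply_apply, Complex.reCLM_apply]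
      rw [← Complex.coe_smul, inner_smul_right, inner_smul_right, Complex.re_ofReal_mul,
        ← inner_conj_symm z (d n), Complex.mul_conj, Complex.ofReal_re, Complex.normSq_eq_norm_sq]
    have h2 : ∀ n, inner ℂ (d n) z = 0 := by
      intro n
      have h3 := (hasSum_zero_iff_of_nonneg (fun n => by positivity)).1 h1
      have h4 := congrFun h3 n
      simp only [Pi.zero_apply, mul_eq_zero, (hc n).ne', false_or] at h4
      simpa using h4
    refine hd.induction_on (p := fun w => inner ℂ w z = 0) z ?_ h2 |> inner_self_eq_zero.1
    exact isClosed_eq (by fun_prop) continuous_const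
  · refine (Submodule.isClosed_topologicalClosure _).mem_of_tendsto hs
      (Filter.Eventually.of_forall fun s => ?_)
    refine Submodule.le_topologicalClosure _ ?_
    refine Submodule.sum_mem _ fun n _ => Submodule.smul_mem _ _ (Submodule.subset_span ?_)
    exact ⟨_, _, rfl⟩

/-- scaled isometry lemma -/
lemma scaled_isometry {U₀ B : H →L[ℂ] H} (hU : ∀ z, ‖U₀ z‖ = ‖z‖) (hs : Function.Surjective U₀)
    (s : ℝ) (hs0 : 0 < s)
    (h : ∀ c : ℂ, ‖c‖ = s → ∃ r : ℝ, ∀ z, ‖(B + c • U₀) z‖ = r * ‖z‖) : ∃ d : ℂ, B = d • U₀ := by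
  have key : ∀ c : ℂ, ‖c‖ = s → ∃ α : ℝ, ∀ z, (c * inner ℂ (B z) (U₀ z)).re = α * ‖z‖ ^ 2 := by
    intro c hc
    obtain ⟨r, hr⟩ := h c hc
    obtain ⟨r', hr'⟩ := h (-c) (by rw [norm_neg, hc])
    refine ⟨(r ^ 2 - r' ^ 2) / 4, fun z => ?_⟩
    have h1 := hr z
    have h2 := hr' z
    have h3 := norm_add_sq (𝕜 := ℂ) (B z) (c • U₀ z)
    have h4 := norm_sub_sq (𝕜 := ℂ) (B z) (c • U₀ z)
    simp only [add_apply, smul_apply] at h1 h2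
    rw [neg_smul, ← sub_eq_add_neg] at h2
    rw [h1, inner_smul_right] at h3
    rw [h2, inner_smul_right] at h4
    simp only [RCLike.re_eq_complex_re] at h3 h4
    linarith
  obtain ⟨α, hα⟩ := key s (by simp [abs_of_pos hs0])
  obtain ⟨β, hβ⟩ := key (s * Complex.I) (by simp [abs_of_pos hs0])
  set d : ℂ := ((α / s : ℝ) : ℂ) + ((β / s : ℝ) : ℂ) * Complex.I with hd
  have h1 : ∀ z, inner ℂ (U₀ z) (B z) = d * (‖z‖ : ℂ) ^ 2 := by
    intro z
    have e1 := hα z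
    have e2 := hβ z
    rw [← inner_conj_symm]
    set w := inner ℂ (B z) (U₀ z)
    simp only [Complex.mul_re, Complex.ofReal_re, Complex.ofReal_im, Complex.mul_im, Complex.I_re,
      Complex.I_im] at e1 e2
    rw [← Complex.ofReal_pow]
    generalize ‖z‖ ^ 2 = n at e1 e2 ⊢
    apply Complex.ext
    · simp [hd]
      field_simp
      linarith
    · simp [hd]
      field_simp
      linarith
  refine ⟨d, ?_⟩
  have hUU : ∀ z w, inner ℂ (U₀ z) (U₀ w) = inner ℂ z w := by
    let L : H →ₗᵢ[ℂ] H := ⟨U₀.toLinearMap, hU⟩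
    exact fun z w => L.inner_map_map z w
  have h2 : ((star U₀ * (B - d • U₀) : H →L[ℂ] H) : H →ₗ[ℂ] H) = 0 := by
    rw [← inner_map_self_eq_zero]
    intro z
    rw [← inner_conj_symm]
    have h3 := re_inner_star (star U₀) z ((B - d • U₀) z)
    rw [star_star] at h3
    change (starRingEnd ℂ) (inner ℂ z (star U₀ ((B - d • U₀) z))) = 0
    rw [← h3]
    simp only [sub_apply, smul_apply, inner_sub_right, inner_smul_right, h1, hUU,
      inner_self_eq_norm_sq_to_K]
    simp
  ext z
  rw [← sub_eq_zero]
  have h4 : ∀ w, inner ℂ (U₀ w) ((B - d • U₀) z) = 0 := by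
    intro w
    have h3 := re_inner_star (star U₀) w ((B - d • U₀) z)
    rw [star_star] at h3
    rw [h3]
    have h5 := LinearMap.congr_fun h2 z
    change star U₀ ((B - d • U₀) z) = 0 at h5
    rw [h5, inner_zero_right]
  obtain ⟨w, hw⟩ := hs ((B - d • U₀) z)
  have h5 := h4 w
  rw [hw, inner_self_eq_zero] at h5
  exact h5

/-- diagonal operators -/
noncomputable def diag (e : Fin 3 → H) (p : Fin 3 → ℝ) : H →L[ℂ] H :=
  ∑ i, (p i : ℂ) • rankOne ℂ (e i) (e i)

lemma diag_star (e : Fin 3 → H) (p : Fin 3 → ℝ) : star (diag e p) = diag e p := by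
  simp [diag, star_sum, star_smul, star_rankOne]

lemma diag_inner {e : Fin 3 → H} (he : Orthonormal ℂ e) (p : Fin 3 → ℝ) (j : Fin 3) (z : H) :
    inner ℂ (e j) (diag e p z) = p j * inner ℂ (e j) z := by
  rw [diag, sum_apply, inner_sum, Finset.sum_eq_single j]
  · simp only [smul_apply, rankOne_apply, inner_smul_right]
    rw [inner_self_eq_norm_sq_to_K, he.1]; simp
  · intro i _ hij
    simp only [smul_apply, rankOne_apply, inner_smul_right, he.2 hij.symm, mul_zero]
  · simp

lemma diag_apply {e : Fin 3 → H} (he : Orthonormal ℂ e) (p : Fin 3 → ℝ) (i : Fin 3) :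
    diag e p (e i) = (p i : ℂ) • e i := by
  rw [diag, sum_apply, Finset.sum_eq_single i]
  · simp [he.1]
  · intro j _ hij
    simp [he.2 hij]
  · simp

lemma diag_eq {S : (H →L[ℂ] H) → (H →L[ℂ] H)} (hS : Std S) {e : Fin 3 → H} (he : Orthonormal ℂ e)
    (p p' : Fin 3 → ℝ) (hp : 0 < p 2 ∧ p 2 < p 1 ∧ p 1 < p 0)
    (hp' : 0 < p' 2 ∧ p' 2 < p' 1 ∧ p' 1 < p' 0) (h : S (diag e p) = diag e p') : p = p' := by
  obtain ⟨U, V, hUV⟩ := hS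
  set D := diag e p with hD
  set D' := diag e p' with hD'
  have h1 : ∀ z, D' (V z) = U (D z) := by
    intro z
    rw [← h]
    rcases hUV with h | h
    · exact h D z
    · rw [h, hD, diag_star]
  have hsa : ∀ x y, inner ℂ (D x) y = inner ℂ x (D y) := fun x y => by
    have := re_inner_star D x y
    rwa [hD, diag_star, ← hD] at this
  have hsa' : ∀ x y, inner ℂ (D' x) y = inner ℂ x (D' y) := fun x y => by
    have := re_inner_star D' x y
    rwa [hD', diag_star, ← hD'] at this
  have h2 : ∀ z, D' (U z) = V (D z) := by
    intro z
    rw [← sub_eq_zero]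
    refine eq_of_re_inner V.toLinearIsometry V.surjective _ fun w hw => ?_
    change (inner ℂ (V w) (D' (U z) - V (D z))).re = 0
    rw [inner_sub_right, Complex.sub_re, ← hsa', h1]
    have e1 := re_inner_isom U.toLinearIsometry (D w) z
    have e2 := re_inner_isom V.toLinearIsometry w (D z)
    simp only [LinearIsometryEquiv.coe_toLinearIsometry] at e1 e2
    rw [e1, e2, hsa, sub_self]
  have h3 : ∀ i, ∃ j, p i ^ 2 = p' j ^ 2 := by
    intro i
    by_contra hcon
    push Not at hcon
    have e1 : D' (D' (V (e i))) = ((p i ^ 2 : ℝ) : ℂ) • V (e i) := by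
      rw [h1, h2, hD, diag_apply he, Complex.coe_smul, ContinuousLinearMap.map_smul_of_tower,
        diag_apply he, Complex.coe_smul, smul_smul, map_smul, ← sq, Complex.coe_smul]
    have e2 : ∀ j, inner ℂ (e j) (V (e i)) = 0 := by
      intro j
      have e3 := congrArg (inner ℂ (e j)) e1
      rw [hD', diag_inner he, diag_inner he, inner_smul_right] at e3
      have e4 : (((p' j ^ 2 - p i ^ 2 : ℝ)) : ℂ) * inner ℂ (e j) (V (e i)) = 0 := by
        push_cast at e3 ⊢
        linear_combination e3
      rcases mul_eq_zero.1 e4 with e5 | e5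
      · exact absurd (sub_eq_zero.1 (Complex.ofReal_eq_zero.1 e5)).symm (hcon j)
      · exact e5
    have e3 : D' (V (e i)) = 0 := by
      rw [hD', diag, sum_apply]
      exact Finset.sum_eq_zero fun j _ => by simp [e2 j]
    rw [e3, map_zero] at e1
    have e4 : V (e i) ≠ 0 := by
      rw [← norm_ne_zero_iff, V.norm_map, he.1]; exact one_ne_zero
    rcases smul_eq_zero.1 e1.symm with e5 | e5
    · have : p i = 0 := by simpa using e5
      fin_cases i <;> simp at this <;> linarith [hp.1, hp.2.1, hp.2.2]
    · exact e4 e5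
  have h4 : ∀ i, ∃ j, p i = p' j := by
    intro i
    obtain ⟨j, hj⟩ := h3 i
    refine ⟨j, (pow_left_inj₀ ?_ ?_ two_ne_zero).1 hj⟩
    · fin_cases i <;> simp <;> linarith [hp.1, hp.2.1, hp.2.2]
    · fin_cases j <;> simp <;> linarith [hp'.1, hp'.2.1, hp'.2.2]
  obtain ⟨a, ha⟩ := h4 0
  obtain ⟨b, hb⟩ := h4 1
  obtain ⟨c, hc⟩ := h4 2
  obtain ⟨h5, h6, h7⟩ := hp
  obtain ⟨h5', h6', h7'⟩ := hp'
  have : p 0 = p' 0 ∧ p 1 = p' 1 ∧ p 2 = p' 2 := by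
    fin_cases a <;> fin_cases b <;> fin_cases c <;>
      simp only [Fin.zero_eta, Fin.mk_one, Fin.reduceFinMk, Fin.isValue] at ha hb hc <;>
      first | exact ⟨ha, hb, hc⟩ | (exfalso; linarith)
  funext i
  fin_cases i
  · exact this.1
  · exact this.2.1
  · exact this.2.2

lemma exists_orthonormal3 (hH : ¬ FiniteDimensional ℂ H) : ∃ e : Fin 3 → H, Orthonormal ℂ e := by
  obtain ⟨a, ha, -, -⟩ := exists_unit_orth hH 0 0
  obtain ⟨b, hb, hab, -⟩ := exists_unit_orth hH a a
  obtain ⟨c, hc, hac, hbc⟩ := exists_unit_orth hH a b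
  have hba : inner ℂ b a = 0 := by rw [← inner_conj_symm, hab, map_zero]
  have hca : inner ℂ c a = 0 := by rw [← inner_conj_symm, hac, map_zero]
  have hcb : inner ℂ c b = 0 := by rw [← inner_conj_symm, hbc, map_zero]
  refine ⟨![a, b, c], ?_, ?_⟩
  · intro i; fin_cases i <;> simp [ha, hb, hc]
  · intro i j hij; fin_cases i <;> fin_cases j <;> simp_all

/-- no rank-two sum is rank one -/
lemma rank_two {x x' y y' p q : H} (hx : ‖x‖ = 1) (hx' : ‖x'‖ = 1) (hy : ‖y‖ = 1) (hy' : ‖y'‖ = 1)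
    (hxx : inner ℂ x x' = 0) (hyy : inner ℂ y y' = 0) {t w : ℂ} (ht : t ≠ 0)
    (h : t • rankOne ℂ x y + w • rankOne ℂ x' y' = rankOne ℂ p q) : w = 0 := by
  by_contra hw
  have hx0 : x' ≠ 0 := by rintro rfl; simp at hx'
  have hy0 : y' ≠ 0 := by rintro rfl; simp at hy'
  rw [← rankOne_smul_left, ← rankOne_smul_left] at h
  rcases adj_lemma (smul_ne_zero hw hx0) hy0 h with ⟨k, hk⟩ | ⟨k, hk⟩
  · have := congrArg (inner ℂ x) hk
    rw [inner_smul_right, inner_smul_right, inner_smul_right, hxx,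
      inner_self_eq_norm_sq_to_K, hx] at this
    simp at this
    exact ht this
  · have := congrArg (inner ℂ y) hk
    rw [inner_smul_right, hyy, inner_self_eq_norm_sq_to_K, hy] at this
    simp at this

end F
end IsoRefl

namespace IsoRefl
open InnerProductSpace
section G
set_option linter.unusedSectionVars false
set_option linter.unusedSimpArgs false
open BoundedContinuousFunction Filter Topology
variable {X : Type*} [TopologicalSpace X]
variable {E : Type*} [NormedAddCommGroup E] [NormedSpace ℂ E]
variable {E' : Type*} [NormedAddCommGroup E']

/-- Build an element of `C₀` from a continuous function dominated by another element. -/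
def mk0 (f : X → E) (hc : Continuous f) (g : C₀(X, E')) (C : ℝ)
    (h : ∀ x, ‖f x‖ ≤ C * ‖g x‖) : C₀(X, E) where
  toFun := f
  continuous_toFun := hc
  zero_at_infty' := by
    have h1 : Tendsto (fun x => C * ‖g x‖) (cocompact X) (𝓝 0) := by
      have := (zero_at_infty g).norm.const_mul C
      simpa using this
    exact squeeze_zero_norm h h1

@[simp] lemma mk0_apply (f : X → E) (hc : Continuous f) (g : C₀(X, E')) (C : ℝ)
    (h : ∀ x, ‖f x‖ ≤ C * ‖g x‖) (x : X) : mk0 f hc g C h x = f x := rfl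

lemma n_le (f : C₀(X, E')) (x : X) : ‖f x‖ ≤ ‖f‖ := by
  rw [← ZeroAtInftyContinuousMap.norm_toBCF_eq_norm]
  exact f.toBCF.norm_coe_le_norm x

lemma n_bd (f : C₀(X, E')) {C : ℝ} (hC : 0 ≤ C) (h : ∀ x, ‖f x‖ ≤ C) : ‖f‖ ≤ C := by
  rw [← ZeroAtInftyContinuousMap.norm_toBCF_eq_norm]
  exact (BoundedContinuousFunction.norm_le hC).2 h

/-- Multiplication by a bounded continuous function. -/
noncomputable def bmul (b : X →ᵇ ℂ) (f : C₀(X, E)) : C₀(X, E) :=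
  mk0 (fun x => b x • f x) (b.continuous.smul f.continuous) f ‖b‖ (fun x => by
    rw [norm_smul]; gcongr; exact b.norm_coe_le_norm x)

@[simp] lemma bmul_apply (b : X →ᵇ ℂ) (f : C₀(X, E)) (x : X) : bmul b f x = b x • f x := rfl

/-- Multiplication by a function in `C₀`. -/
noncomputable def hmul (h : C₀(X, ℂ)) (f : C₀(X, E)) : C₀(X, E) := bmul h.toBCF f

@[simp] lemma hmul_apply (b : C₀(X, ℂ)) (f : C₀(X, E)) (x : X) : hmul b f x = b x • f x := rfl

/-- Elementary tensor. -/
noncomputable def tens (k : C₀(X, ℂ)) (A : E) : C₀(X, E) :=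
  mk0 (fun x => k x • A) (k.continuous.smul continuous_const) k ‖A‖ (fun x => by
    rw [norm_smul, mul_comm])

@[simp] lemma tens_apply (k : C₀(X, ℂ)) (A : E) (x : X) : tens k A x = k x • A := rfl

/-- Complexification of real functions. -/
noncomputable def ofR (k : C₀(X, ℝ)) : C₀(X, ℂ) :=
  mk0 (fun x => (k x : ℂ)) (Complex.continuous_ofReal.comp k.continuous) k 1 (fun x => by simp)

@[simp] lemma ofR_apply (k : C₀(X, ℝ)) (x : X) : ofR k x = (k x : ℂ) := rfl

/-- Postcomposition. -/
noncomputable def pcomp (L : E →L[ℂ] E) (f : C₀(X, E)) : C₀(X, E) :=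
  mk0 (fun x => L (f x)) (L.continuous.comp f.continuous) f ‖L‖ (fun x => L.le_opNorm _)

@[simp] lemma pcomp_apply (L : E →L[ℂ] E) (f : C₀(X, E)) (x : X) : pcomp L f x = L (f x) := rfl

/-- superlevel sets are compact -/
lemma compact_super (f : C₀(X, E')) {ε : ℝ} (hε : 0 < ε) : IsCompact {x | ε ≤ ‖f x‖} := by
  have h1 : ∀ᶠ x in cocompact X, ‖f x‖ < ε := by
    have := (zero_at_infty f).norm
    rw [norm_zero] at this
    exact this.eventually (gt_mem_nhds hε)
  obtain ⟨K, hK, hK'⟩ := mem_cocompact.1 h1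
  refine hK.of_isClosed_subset (isClosed_le continuous_const f.continuous.norm) ?_
  intro x hx
  by_contra hxK
  have := hK' hxK
  simp only [Set.mem_setOf_eq] at this hx
  linarith

/-- approximation through a nowhere zero function -/
lemma approx_h (h : C₀(X, ℂ)) (hh : ∀ x, h x ≠ 0) (f : C₀(X, E)) {ε : ℝ} (hε : 0 < ε) :
    ∃ b : X →ᵇ ℂ, ‖f - hmul h (bmul b f)‖ ≤ ε := by
  obtain ⟨m, hm, hm'⟩ := (compact_super f hε).exists_forall_le' (f := fun x => ‖h x‖) (a := 0)
    h.continuous.norm.continuousOn (fun x _ => norm_pos_iff.2 (hh x))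
  have hpos : ∀ x, 0 < max ‖h x‖ m := fun x => lt_max_of_lt_right hm
  have hcont : Continuous (fun x => (starRingEnd ℂ) (h x) / ((max ‖h x‖ m : ℝ) : ℂ) ^ 2) := by
    refine Continuous.div (Complex.continuous_conj.comp h.continuous) ?_ ?_
    · exact (Complex.continuous_ofReal.comp (h.continuous.norm.max continuous_const)).pow 2
    · intro x
      have := (hpos x).ne'
      exact pow_ne_zero 2 (by exact_mod_cast this)
  refine ⟨BoundedContinuousFunction.ofNormedAddCommGroup _ hcont (1 / m) ?_, ?_⟩
  · intro x
    rw [norm_div, norm_pow, Complex.norm_real, RCLike.norm_conj, Real.norm_of_nonneg (hpos x).le,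
      div_le_div_iff₀ (pow_pos (hpos x) 2) hm]
    have h1 : ‖h x‖ ≤ max ‖h x‖ m := le_max_left _ _
    have h2 : m ≤ max ‖h x‖ m := le_max_right _ _
    nlinarith [norm_nonneg (h x)]
  · refine n_bd _ hε.le fun x => ?_
    simp only [ZeroAtInftyContinuousMap.sub_apply, hmul_apply, bmul_apply,
      BoundedContinuousFunction.coe_ofNormedAddCommGroup]
    have e : f x - h x • ((starRingEnd ℂ) (h x) / ((max ‖h x‖ m : ℝ) : ℂ) ^ 2) • f x
        = ((1 - ‖h x‖ ^ 2 / (max ‖h x‖ m) ^ 2 : ℝ) : ℂ) • f x := by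
      rw [smul_smul, mul_div_assoc', Complex.mul_conj, Complex.normSq_eq_norm_sq]
      push_cast
      rw [sub_smul, one_smul]
    rw [e, norm_smul, Complex.norm_real]
    by_cases hx : ε ≤ ‖f x‖
    · have := hm' x hx
      rw [max_eq_left this, div_self (by have := norm_pos_iff.2 (hh x); positivity)]
      simp [hε.le]
    · have h1 : ‖(1 - ‖h x‖ ^ 2 / (max ‖h x‖ m) ^ 2 : ℝ)‖ ≤ 1 := by
        have h2 : ‖h x‖ ^ 2 / (max ‖h x‖ m) ^ 2 ≤ 1 := by
          rw [div_le_one (pow_pos (hpos x) 2)]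
          gcongr
          exact le_max_left _ _
        have h3 : 0 ≤ ‖h x‖ ^ 2 / (max ‖h x‖ m) ^ 2 := by positivity
        rw [Real.norm_of_nonneg (by linarith)]
        linarith
      push Not at hx
      nlinarith [norm_nonneg (f x)]

/-- approximation by functions vanishing near a zero -/
lemma approx_van (f : C₀(X, E)) (y : X) (hy : f y = 0) {ε : ℝ} (hε : 0 < ε) :
    ∃ f' : C₀(X, E), ‖f - f'‖ ≤ ε ∧ ∀ᶠ z in 𝓝 y, f' z = 0 := by
  have hp : ∀ x, 0 < max ‖f x‖ ε := fun x => lt_max_of_lt_right hε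
  have hb : ∀ x, 0 ≤ 1 - ε / max ‖f x‖ ε ∧ 1 - ε / max ‖f x‖ ε ≤ 1 := by
    intro x
    have h1 : ε / max ‖f x‖ ε ≤ 1 := by rw [div_le_one (hp x)]; exact le_max_right _ _
    have h2 : 0 ≤ ε / max ‖f x‖ ε := by have := hp x; positivity
    constructor <;> linarith
  refine ⟨mk0 (fun x => ((1 - ε / max ‖f x‖ ε : ℝ) : ℂ) • f x) ?_ f 1 ?_, ?_, ?_⟩
  · refine Continuous.smul (Complex.continuous_ofReal.comp ?_) f.continuous
    exact continuous_const.sub (continuous_const.div (f.continuous.norm.max continuous_const)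
      (fun x => (hp x).ne'))
  · intro x
    rw [norm_smul, Complex.norm_real, Real.norm_of_nonneg (hb x).1]
    have := (hb x).2
    gcongr
  · refine n_bd _ hε.le fun x => ?_
    simp only [ZeroAtInftyContinuousMap.sub_apply, mk0_apply]
    have e : f x - ((1 - ε / max ‖f x‖ ε : ℝ) : ℂ) • f x = ((ε / max ‖f x‖ ε : ℝ) : ℂ) • f x := by
      push_cast
      rw [sub_smul, one_smul]; abel
    rw [e, norm_smul, Complex.norm_real, Real.norm_of_nonneg (by have := hp x; positivity),
      div_mul_eq_mul_div, div_le_iff₀ (hp x)]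
    gcongr
    exact le_max_left _ _
  · have : ∀ᶠ z in 𝓝 y, ‖f z‖ < ε := by
      have h1 : Tendsto (fun z => ‖f z‖) (𝓝 y) (𝓝 ‖f y‖) := f.continuous.norm.tendsto y
      rw [hy, norm_zero] at h1
      exact h1.eventually (gt_mem_nhds hε)
    filter_upwards [this] with z hz
    rw [mk0_apply, max_eq_right hz.le, div_self hε.ne']
    simp

/-- approximation by multiples vanishing at the same point -/
lemma approx_mul (f : C₀(X, E)) (y : X) (hy : f y = 0) {ε : ℝ} (hε : 0 < ε) :
    ∃ h : C₀(X, ℂ), h y = 0 ∧ ‖f - hmul h f‖ ≤ ε := by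
  have hp : ∀ x, 0 < ‖f x‖ + ε := fun x => by positivity
  refine ⟨mk0 (fun x => ((‖f x‖ / (‖f x‖ + ε) : ℝ) : ℂ)) ?_ f (1 / ε) ?_, ?_, ?_⟩
  · exact Complex.continuous_ofReal.comp (f.continuous.norm.div
      (f.continuous.norm.add continuous_const) (fun x => (hp x).ne'))
  · intro x
    rw [Complex.norm_real, Real.norm_of_nonneg (by positivity), one_div, inv_mul_eq_div]
    gcongr
    linarith [norm_nonneg (f x)]
  · simp [hy]
  · refine n_bd _ hε.le fun x => ?_
    simp only [ZeroAtInftyContinuousMap.sub_apply, mk0_apply, hmul_apply]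
    have e : f x - ((‖f x‖ / (‖f x‖ + ε) : ℝ) : ℂ) • f x = ((ε / (‖f x‖ + ε) : ℝ) : ℂ) • f x := by
      nth_rewrite 1 [← one_smul ℂ (f x)]
      rw [← sub_smul, ← Complex.ofReal_one, ← Complex.ofReal_sub]
      congr 2
      have := (hp x).ne'
      field_simp
      ring
    rw [e, norm_smul, Complex.norm_real, Real.norm_of_nonneg (by have := hp x; positivity),
      div_mul_eq_mul_div, div_le_iff₀ (hp x)]
    nlinarith [norm_nonneg (f x)]

variable [T2Space X] [LocallyCompactSpace X]

lemma bump {K U : Set X} (hK : IsCompact K) (hU : IsOpen U) (hKU : K ⊆ U) :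
    ∃ r : C₀(X, ℝ), (∀ x, 0 ≤ r x ∧ r x ≤ 1) ∧ (∀ x ∈ K, r x = 1) ∧ ∀ x ∉ U, r x = 0 := by
  obtain ⟨f, h1, h2, h3, h4⟩ := exists_continuous_one_zero_of_isCompact hK hU.isClosed_compl
    (Set.disjoint_compl_right_iff_subset.2 hKU)
  refine ⟨⟨f, h3.is_zero_at_infty⟩, fun x => h4 x, fun x hx => h1 hx, fun x hx => h2 hx⟩

lemma bump_pt (y : X) {U : Set X} (hU : U ∈ 𝓝 y) :
    ∃ r : C₀(X, ℝ), (∀ x, 0 ≤ r x ∧ r x ≤ 1) ∧ r y = 1 ∧ ∀ x ∉ U, r x = 0 := by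
  obtain ⟨r, h1, h2, h3⟩ := bump (isCompact_singleton (x := y)) (isOpen_interior (s := U))
    (by simpa using mem_interior_iff_mem_nhds.2 hU)
  exact ⟨r, h1, h2 y rfl, fun x hx => h3 x (fun h => hx (interior_subset h))⟩

/-- bump equal to one near a point -/
lemma bump_near (y : X) {U : Set X} (hU : U ∈ 𝓝 y) :
    ∃ r : C₀(X, ℝ), (∀ x, 0 ≤ r x ∧ r x ≤ 1) ∧ (∀ᶠ z in 𝓝 y, r z = 1) ∧ ∀ x ∉ U, r x = 0 := by
  obtain ⟨K, hK, hKU, hKc⟩ := local_compact_nhds (mem_interior_iff_mem_nhds.2 hU |> isOpen_interior.mem_nhds)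
  obtain ⟨r, h1, h2, h3⟩ := bump hKc isOpen_interior hKU
  exact ⟨r, h1, Filter.mem_of_superset hK h2, fun x hx => h3 x (fun h => hx (interior_subset h))⟩

lemma exists_pos [SigmaCompactSpace X] : ∃ G : C₀(X, ℝ), ∀ x, 0 < G x := by
  have hb := fun n : ℕ => bump (isCompact_compactCovering X n) isOpen_univ (Set.subset_univ _)
  choose r h1 h2 h3 using hb
  have hn : ∀ n, ‖r n‖ ≤ 1 := fun n => n_bd _ zero_le_one (fun x => by
    rw [Real.norm_of_nonneg (h1 n x).1]; exact (h1 n x).2)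
  have hs : Summable (fun n => ((1/2 : ℝ) ^ n) • r n) := by
    refine Summable.of_norm_bounded (g := fun n => (1/2 : ℝ) ^ n) summable_geometric_two ?_
    intro n
    rw [norm_smul, Real.norm_of_nonneg (by positivity)]
    have : (0:ℝ) < (1/2) ^ n := by positivity
    nlinarith [hn n]
  refine ⟨∑' n, ((1/2 : ℝ) ^ n) • r n, fun x => ?_⟩
  have hsum : HasSum (fun n => (1/2 : ℝ) ^ n * r n x) ((∑' n, ((1/2 : ℝ) ^ n) • r n) x) := by
    let ev : C₀(X, ℝ) →+ ℝ := { toFun := fun f => f x, map_zero' := rfl, map_add' := fun _ _ => rfl }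
    have hev : Continuous ev := by
      refine (LipschitzWith.of_dist_le_mul (K := 1) (fun f g => ?_)).continuous
      rw [dist_eq_norm, dist_eq_norm, NNReal.coe_one, one_mul]
      exact n_le (f - g) x
    exact hs.hasSum.map ev hev
  obtain ⟨n, hn⟩ := exists_mem_compactCovering x
  rw [← hsum.tsum_eq]
  refine hsum.summable.tsum_pos (fun m => ?_) n ?_
  · have := (h1 m x).1; positivity
  · rw [h2 n x hn]; positivity

end G
end IsoRefl

namespace IsoRefl
open InnerProductSpace
section H4
set_option linter.unusedSectionVars false
set_option linter.unusedSimpArgs false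
open BoundedContinuousFunction Filter Topology
variable {X : Type*} [TopologicalSpace X]

lemma char_point (m : (X →ᵇ ℝ) →ₗ[ℝ] ℝ) (G : C₀(X, ℝ)) (hG : ∀ x, 0 < G x)
    (h : ∀ a, ∃ y, m a = a y ∧ m (a * a) = a y * a y) (h1 : m 1 = 1) :
    ∃ y0, ∀ a, m a = a y0 := by
  set c := m G.toBCF with hc
  have hcpos : 0 < c := by
    obtain ⟨y, hy, -⟩ := h G.toBCF
    rw [hc, hy]; exact hG y
  have hK : IsCompact {y | G y = c} := by
    refine (compact_super G hcpos).of_isClosed_subset (isClosed_eq G.continuous continuous_const) ?_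
    intro y hy
    have hy' : G y = c := hy
    show c ≤ ‖G y‖
    rw [hy', Real.norm_of_nonneg hcpos.le]
  have sqz : ∀ a, m a = 0 → m (a * a) = 0 := by
    intro a ha
    obtain ⟨y, e1, e2⟩ := h a
    rw [e2, ← e1, ha, zero_mul]
  have key : ({y | G y = c} ∩ ⋂ a : {a : X →ᵇ ℝ // m a = 0}, {y | a.1 y = 0}).Nonempty := by
    refine hK.inter_iInter_nonempty _ (fun a => isClosed_eq a.1.continuous continuous_const) ?_
    intro u
    set d : X →ᵇ ℝ := G.toBCF - c • 1 with hd
    have hmd : m d = 0 := by rw [hd, map_sub, map_smul, h1, ← hc]; simp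
    have hms : m (∑ a ∈ u, a.1 * a.1 + d * d) = 0 := by
      rw [map_add, map_sum, sqz d hmd, add_zero]
      exact Finset.sum_eq_zero fun a _ => sqz a.1 a.2
    obtain ⟨y, e1, -⟩ := h (∑ a ∈ u, a.1 * a.1 + d * d)
    rw [hms] at e1
    have e2 : (0 : ℝ) = ∑ a ∈ u, a.1 y * a.1 y + d y * d y := by
      simpa [BoundedContinuousFunction.coe_sum] using e1
    have nn : 0 ≤ ∑ a ∈ u, a.1 y * a.1 y := Finset.sum_nonneg fun a _ => mul_self_nonneg _
    have hd0 : d y * d y = 0 := by nlinarith [mul_self_nonneg (d y)]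
    have hs0 : ∑ a ∈ u, a.1 y * a.1 y = 0 := by linarith
    refine ⟨y, ?_, ?_⟩
    · have := mul_self_eq_zero.1 hd0
      rw [hd] at this
      have h3 : G y - c * 1 = 0 := this
      show G y = c
      linarith
    · simp only [Set.mem_iInter]
      intro a ha
      have := (Finset.sum_eq_zero_iff_of_nonneg (fun a _ => mul_self_nonneg _)).1 hs0 a ha
      exact mul_self_eq_zero.1 this
  obtain ⟨y0, -, hy0⟩ := key
  refine ⟨y0, fun a => ?_⟩
  have hz : m (a - m a • 1) = 0 := by rw [map_sub, map_smul, h1]; simp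
  have := Set.mem_iInter.1 hy0 ⟨a - m a • 1, hz⟩
  have h3 : a y0 - m a * 1 = 0 := this
  linarith

/-- real to complex bounded functions -/
noncomputable def jr (a : X →ᵇ ℝ) : X →ᵇ ℂ :=
  BoundedContinuousFunction.ofNormedAddCommGroup (fun x => (a x : ℂ))
    (Complex.continuous_ofReal.comp a.continuous) ‖a‖ (fun x => by
      rw [Complex.norm_real]; exact a.norm_coe_le_norm x)

@[simp] lemma jr_apply (a : X →ᵇ ℝ) (x : X) : jr a x = (a x : ℂ) := rfl

noncomputable def reB (a : X →ᵇ ℂ) : X →ᵇ ℝ :=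
  BoundedContinuousFunction.ofNormedAddCommGroup (fun x => (a x).re)
    (Complex.continuous_re.comp a.continuous) ‖a‖ (fun x =>
      (Complex.abs_re_le_norm _).trans (a.norm_coe_le_norm x))

noncomputable def imB (a : X →ᵇ ℂ) : X →ᵇ ℝ :=
  BoundedContinuousFunction.ofNormedAddCommGroup (fun x => (a x).im)
    (Complex.continuous_im.comp a.continuous) ‖a‖ (fun x =>
      (Complex.abs_im_le_norm _).trans (a.norm_coe_le_norm x))

@[simp] lemma reB_apply (a : X →ᵇ ℂ) (x : X) : reB a x = (a x).re := rfl
@[simp] lemma imB_apply (a : X →ᵇ ℂ) (x : X) : imB a x = (a x).im := rfl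

variable [T2Space X] [LocallyCompactSpace X] [SigmaCompactSpace X]

theorem l4 (ℓ : C₀(X, ℂ) →L[ℂ] ℂ) (hℓ : ∀ g, (∀ x, g x ≠ 0) → ℓ g ≠ 0) :
    ∃ y0, ∀ g, g y0 = 0 → ℓ g = 0 := by
  obtain ⟨G, hG⟩ := exists_pos (X := X)
  have hGne : ∀ x, ofR G x ≠ 0 := fun x => by simpa using (hG x).ne'
  set t := ℓ (ofR G) with ht
  have ht0 : t ≠ 0 := hℓ _ hGne
  let M : (X →ᵇ ℂ) →ₗ[ℂ] ℂ :=
    { toFun := fun a => ℓ (bmul a (ofR G)) / t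
      map_add' := fun a b => by
        rw [← add_div, ← map_add]; congr 2; ext x; simp [add_mul]
      map_smul' := fun c a => by
        rw [RingHom.id_apply, smul_eq_mul, mul_div_assoc', ← smul_eq_mul, ← map_smul]
        congr 2; ext x; simp [mul_assoc] }
  have hM : ∀ a, M a = ℓ (bmul a (ofR G)) / t := fun a => rfl
  have hM1 : M 1 = 1 := by
    rw [hM]
    have : bmul 1 (ofR G) = ofR G := by ext x; simp
    rw [this, ← ht, div_self ht0]
  have hrange : ∀ a, ∃ y, M a = a y := by
    intro a
    by_contra hne
    push Not at hne
    have h0 : M (a - M a • 1) = 0 := by rw [map_sub, map_smul, hM1]; simp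
    rw [hM, div_eq_zero_iff] at h0
    rcases h0 with h0 | h0
    · refine hℓ _ ?_ h0
      intro x
      rw [bmul_apply]
      refine smul_ne_zero ?_ (hGne x)
      have : (a - M a • 1) x = a x - M a := by simp
      rw [this]
      exact sub_ne_zero.2 (hne x).symm
    · exact ht0 h0
  have hreal : ∀ a, (M (jr a)).im = 0 := by
    intro a
    obtain ⟨y, hy⟩ := hrange (jr a)
    rw [hy]; simp
  let m : (X →ᵇ ℝ) →ₗ[ℝ] ℝ :=
    { toFun := fun a => (M (jr a)).re
      map_add' := fun a b => by
        rw [← Complex.add_re, ← map_add]; congr 2; ext x; simp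
      map_smul' := fun c a => by
        have : jr (c • a) = (c : ℂ) • jr a := by ext x; simp
        rw [this, map_smul]; simp }
  have hm : ∀ a, M (jr a) = (m a : ℂ) := by
    intro a
    apply Complex.ext
    · simp [m]
    · simp [hreal]
  obtain ⟨y0, hy0⟩ := char_point m G hG (by
    intro a
    obtain ⟨y, hy⟩ := hrange (jr a + Complex.I • jr (a * a))
    rw [map_add, map_smul, hm, hm] at hy
    refine ⟨y, ?_, ?_⟩
    · have := congrArg Complex.re hy
      simpa using this
    · have := congrArg Complex.im hy
      simpa using this) (by
    have : jr (1 : X →ᵇ ℝ) = 1 := by ext x; simp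
    show (M (jr 1)).re = 1
    rw [this, hM1]; simp)
  have hall : ∀ a, M a = a y0 := by
    intro a
    have : a = jr (reB a) + Complex.I • jr (imB a) := by
      ext x
      simp only [BoundedContinuousFunction.add_apply, jr_apply, reB_apply, imB_apply,
        BoundedContinuousFunction.smul_apply, smul_eq_mul]
      rw [mul_comm]
      exact (Complex.re_add_im _).symm
    conv_lhs => rw [this]
    rw [map_add, map_smul, hm, hm, hy0, hy0, reB_apply, imB_apply, smul_eq_mul, mul_comm]
    exact Complex.re_add_im _
  refine ⟨y0, fun g hg => ?_⟩
  have hsm : ∀ ε > 0, ‖ℓ g‖ ≤ ‖ℓ‖ * ε := by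
    intro ε hε
    obtain ⟨b, hb⟩ := approx_h (ofR G) hGne g hε
    have e : ℓ (hmul (ofR G) (bmul b g)) = 0 := by
      have h1 := hall (bmul b g).toBCF
      have h2 : (bmul b g).toBCF y0 = 0 := by
        show bmul b g y0 = 0
        simp [hg]
      rw [h2, hM, div_eq_zero_iff] at h1
      have h3 := h1.resolve_right ht0
      rw [← h3]
      congr 1
      ext x
      show _ = (bmul b g x) * ofR G x
      simp [mul_comm]
    calc ‖ℓ g‖ = ‖ℓ (g - hmul (ofR G) (bmul b g))‖ := by rw [map_sub, e, sub_zero]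
      _ ≤ ‖ℓ‖ * ‖g - hmul (ofR G) (bmul b g)‖ := ℓ.le_opNorm _
      _ ≤ ‖ℓ‖ * ε := by gcongr
  have hlim : Tendsto (fun ε : ℝ => ‖ℓ‖ * ε) (𝓝[>] 0) (𝓝 0) := by
    have : Tendsto (fun ε : ℝ => ‖ℓ‖ * ε) (𝓝 0) (𝓝 (‖ℓ‖ * 0)) :=
      (continuous_const.mul continuous_id).tendsto 0
    rw [mul_zero] at this
    exact this.mono_left nhdsWithin_le_nhds
  have : ‖ℓ g‖ ≤ 0 := ge_of_tendsto hlim (by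
    filter_upwards [self_mem_nhdsWithin] with ε hε
    exact hsm ε hε)
  exact norm_le_zero_iff.1 this

end H4
end IsoRefl

namespace IsoRefl
open InnerProductSpace
section I5
set_option linter.unusedSectionVars false
set_option linter.unusedSimpArgs false
open scoped BoundedContinuousFunction
open Filter Topology
variable {X : Type*} [TopologicalSpace X] [T2Space X] [LocallyCompactSpace X]
variable {H : Type*} [NormedAddCommGroup H] [InnerProductSpace ℂ H] [CompleteSpace H]

lemma l2_arith {q m D : ℝ} (h : ∀ N : ℝ, 1 ≤ N → N + q ≤ √(N ^ 2 + 2 * N * m + D))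
    (hm : 0 ≤ m) (hD : 0 ≤ D) : q ≤ m := by
  by_contra hlt
  push Not at hlt
  have hq : 0 < q := hm.trans_lt hlt
  set N := 1 + D / (q - m) with hN
  have hqm : 0 < q - m := by linarith
  have hN1 : 1 ≤ N := by have : 0 ≤ D / (q - m) := by positivity
                         linarith
  have h1 := h N hN1
  have h2 : (N + q) ^ 2 ≤ N ^ 2 + 2 * N * m + D := by
    have := Real.le_sqrt' (x := N + q) (y := N ^ 2 + 2 * N * m + D) (by linarith)
    exact this.1 h1
  have h3 : N * (q - m) = (q - m) + D := by rw [hN, add_mul, one_mul, div_mul_cancel₀ _ hqm.ne']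
  nlinarith

lemma l2_unit (f f2 : C₀(X, H →L[ℂ] H)) (c : ℝ) (hc : 0 ≤ c)
    (h : ∀ (g : C₀(X, H →L[ℂ] H)) (r : ℝ), (∀ w : ℂ, ‖w‖ ≤ c → ‖g + w • f‖ ≤ r) → ‖g + f2‖ ≤ r)
    (x : X) (η ξ : H) (hη : ‖η‖ = 1) (hξ : ‖ξ‖ = 1) :
    (inner ℂ η (f2 x ξ)).re ≤ c * ‖inner ℂ η (f x ξ)‖ := by
  have main : ∀ ε > 0, (inner ℂ η (f2 x ξ)).re ≤ c * (‖inner ℂ η (f x ξ)‖ + ε) := by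
    intro ε hε
    have hU : {y | ‖f y - f x‖ < ε} ∈ 𝓝 x := by
      refine (isOpen_lt ((f.continuous.sub continuous_const).norm) continuous_const).mem_nhds ?_
      simpa using hε
    obtain ⟨k, k1, k2, k3⟩ := bump_pt x hU
    set m := c * (‖inner ℂ η (f x ξ)‖ + ε) with hm
    have hm0 : 0 ≤ m := by positivity
    refine l2_arith (D := 8 * (c * ‖f‖) ^ 2) ?_ hm0 (by positivity)
    intro N hN
    have h1 := h (tens (ofR k) ((N : ℂ) • rankOne ℂ η ξ))
      (√(N ^ 2 + 2 * N * m + 8 * (c * ‖f‖) ^ 2)) (by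
      intro w hw
      refine n_bd _ (Real.sqrt_nonneg _) fun y => ?_
      apply Real.le_sqrt_of_sq_le
      have e : (tens (ofR k) ((N : ℂ) • rankOne ℂ η ξ) + w • f) y
          = ((k y * N : ℝ) : ℂ) • rankOne ℂ η ξ + w • f y := by
        rw [ZeroAtInftyContinuousMap.add_apply, tens_apply, ZeroAtInftyContinuousMap.smul_apply,
          smul_smul, ofR_apply, Complex.ofReal_mul]
      rw [e]
      have hkN : 0 ≤ k y * N := mul_nonneg (k1 y).1 (by linarith)
      refine (rk_upper η ξ hη hξ (w • f y) (k y * N) hkN).trans ?_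
      have hkN1 : k y * N ≤ N := by nlinarith [(k1 y).2]
      have hb : ‖w • f y‖ ≤ c * ‖f‖ := by
        rw [norm_smul]
        exact mul_le_mul hw (n_le f y) (norm_nonneg _) hc
      have hb2 : ‖w • f y‖ ^ 2 ≤ (c * ‖f‖) ^ 2 := pow_le_pow_left₀ (norm_nonneg _) hb 2
      have hsq : (k y * N) ^ 2 ≤ N ^ 2 := pow_le_pow_left₀ hkN hkN1 2
      have hmid : (k y * N) * (inner ℂ η ((w • f y) ξ)).re ≤ N * m := by
        by_cases hy : y ∈ {y | ‖f y - f x‖ < ε}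
        · have hy' : ‖f y - f x‖ < ε := hy
          have e1 : (inner ℂ η ((w • f y) ξ)).re ≤ m := by
            refine (Complex.re_le_norm _).trans ?_
            rw [smul_apply, inner_smul_right, norm_mul, hm]
            refine mul_le_mul hw ?_ (norm_nonneg _) hc
            have e2 : f y ξ = f x ξ + (f y - f x) ξ := by simp
            rw [e2, inner_add_right]
            refine (norm_add_le _ _).trans ?_
            gcongr
            refine (norm_inner_le_norm _ _).trans ?_
            rw [hη, one_mul]
            refine ((f y - f x).le_opNorm ξ).trans ?_
            rw [hξ, mul_one]
            exact hy'.le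
          calc (k y * N) * (inner ℂ η ((w • f y) ξ)).re ≤ (k y * N) * m := by gcongr
            _ ≤ N * m := by gcongr
        · rw [k3 y hy, zero_mul, zero_mul]
          positivity
      nlinarith)
    have h2 := n_le (tens (ofR k) ((N : ℂ) • rankOne ℂ η ξ) + f2) x
    have e : (tens (ofR k) ((N : ℂ) • rankOne ℂ η ξ) + f2) x
          = (N : ℂ) • rankOne ℂ η ξ + f2 x := by
      simp [k2]
    rw [e] at h2
    exact (rk_lower η ξ hη hξ (f2 x) N).trans (h2.trans h1)
  refine le_of_forall_pos_le_add fun δ hδ => ?_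
  have := main (δ / (c + 1)) (by positivity)
  refine this.trans ?_
  rw [mul_add]
  gcongr
  rw [mul_div_assoc', div_le_iff₀ (by positivity)]
  nlinarith

lemma l2_zero (f f2 : C₀(X, H →L[ℂ] H)) (c : ℝ) (hc : 0 ≤ c)
    (h : ∀ (g : C₀(X, H →L[ℂ] H)) (r : ℝ), (∀ w : ℂ, ‖w‖ ≤ c → ‖g + w • f‖ ≤ r) → ‖g + f2‖ ≤ r)
    (x : X) (η ξ : H) (h0 : inner ℂ η (f x ξ) = 0) : inner ℂ η (f2 x ξ) = 0 := by
  by_cases hη : η = 0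
  · simp [hη]
  by_cases hξ : ξ = 0
  · simp [hξ]
  have hη' : ‖η‖ ≠ 0 := norm_ne_zero_iff.2 hη
  have hξ' : ‖ξ‖ ≠ 0 := norm_ne_zero_iff.2 hξ
  by_contra hne
  set z := inner ℂ η (f2 x ξ) with hz
  have hz' : ‖z‖ ≠ 0 := norm_ne_zero_iff.2 hne
  set w : ℂ := z / (‖z‖ : ℂ) with hw
  have hwn : ‖w‖ = 1 := by rw [hw, norm_div, Complex.norm_real, norm_norm, div_self hz']
  have := l2_unit f f2 c hc h x ((w * ((‖η‖⁻¹ : ℝ) : ℂ)) • η) ((((‖ξ‖⁻¹ : ℝ) : ℂ)) • ξ)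
    (by rw [norm_smul, norm_mul, hwn, Complex.norm_real]; simp [hη'])
    (by rw [norm_smul, Complex.norm_real]; simp [hξ'])
  rw [map_smul, map_smul, inner_smul_left, inner_smul_right, inner_smul_left, inner_smul_right, h0,
    ← hz] at this
  simp only [mul_zero, norm_zero] at this
  have e : (starRingEnd ℂ) (w * ((‖η‖⁻¹ : ℝ) : ℂ)) * (((‖ξ‖⁻¹ : ℝ) : ℂ) * z)
      = ((‖η‖⁻¹ * ‖ξ‖⁻¹ * ‖z‖ : ℝ) : ℂ) := by
    have e3 : (starRingEnd ℂ) w * z = (‖z‖ : ℂ) := by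
      have hzc : (‖z‖ : ℂ) ≠ 0 := by exact_mod_cast hz'
      rw [hw, map_div₀, Complex.conj_ofReal, div_mul_eq_mul_div, mul_comm, Complex.mul_conj,
        Complex.normSq_eq_norm_sq]
      push_cast
      field_simp
    rw [map_mul, Complex.conj_ofReal]
    calc _ = ((‖η‖⁻¹ : ℝ) : ℂ) * ((‖ξ‖⁻¹ : ℝ) : ℂ) * ((starRingEnd ℂ) w * z) := by ring
      _ = _ := by rw [e3]; push_cast; ring
  rw [e, Complex.ofReal_re] at this
  have : 0 < ‖η‖⁻¹ * ‖ξ‖⁻¹ * ‖z‖ := by positivity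
  linarith

lemma span_of_perp (u w : H) (h : ∀ η : H, inner ℂ η u = 0 → inner ℂ η w = 0) :
    ∃ s : ℂ, w = s • u := by
  by_cases hu : u = 0
  · subst hu
    have := h w (by simp)
    exact ⟨0, by simpa using this⟩
  set s : ℂ := inner ℂ u w / inner ℂ u u with hs
  have huu : inner ℂ u u ≠ 0 := inner_self_ne_zero.2 hu
  have h1 : inner ℂ u (w - s • u) = 0 := by
    rw [inner_sub_right, inner_smul_right, hs, div_mul_cancel₀ _ huu, sub_self]
  have h1' : inner ℂ (w - s • u) u = 0 := by
    rw [← inner_conj_symm, h1, map_zero]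
  have h2 := h _ h1'
  have h3 : inner ℂ (w - s • u) (w - s • u) = 0 := by
    rw [inner_sub_right (w - s • u) w, inner_smul_right, h2, h1']; simp
  exact ⟨s, sub_eq_zero.1 (inner_self_eq_zero.1 h3)⟩

lemma homothety (Q : H →ₗ[ℂ] H) (h : ∀ v, ∃ a : ℂ, Q v = a • v) : ∃ a : ℂ, ∀ v, Q v = a • v := by
  obtain ⟨a, ha⟩ := LinearMap.exists_eq_smul_id_of_forall_notLinearIndependent (f := Q) (by
    intro v hv
    rw [LinearIndependent.pair_iff] at hv
    obtain ⟨a, ha⟩ := h v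
    have := (hv a (-1) (by rw [ha]; simp)).2
    norm_num at this)
  exact ⟨a, fun v => by rw [ha]; rfl⟩

lemma l3 (L : (H →L[ℂ] H) →ₗ[ℂ] (H →L[ℂ] H)) (h : ∀ A ξ, ∃ s : ℂ, L A ξ = s • A ξ) :
    ∃ s : ℂ, ∀ A, L A = s • A := by
  obtain ⟨s, hs⟩ := homothety (L 1 : H →L[ℂ] H).toLinearMap (fun v => by simpa using h 1 v)
  have hs' : ∀ v, L 1 v = s • v := hs
  refine ⟨s, fun A => ?_⟩
  ext ξ
  by_cases hξ : ξ = 0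
  · simp [hξ]
  have hξn : inner ℂ ξ ξ ≠ 0 := inner_self_ne_zero.2 hξ
  let Q : H →ₗ[ℂ] H :=
    { toFun := fun v => L (rankOne ℂ v ξ) ξ
      map_add' := fun v w => by rw [rankOne_add_left, map_add, add_apply]
      map_smul' := fun c v => by rw [rankOne_smul_left, map_smul, smul_apply, RingHom.id_apply] }
  have hQ : ∀ v, Q v = L (rankOne ℂ v ξ) ξ := fun v => rfl
  obtain ⟨a, ha⟩ := homothety Q (fun v => by
    obtain ⟨t, ht⟩ := h (rankOne ℂ v ξ) ξ
    refine ⟨t * inner ℂ ξ ξ, ?_⟩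
    rw [hQ, ht, InnerProductSpace.rankOne_apply, smul_smul])
  have key : ∀ B : H →L[ℂ] H, inner ℂ ξ ξ • L B ξ = a • B ξ := by
    intro B
    obtain ⟨t, ht⟩ := h (inner ℂ ξ ξ • B - rankOne ℂ (B ξ) ξ) ξ
    have : (inner ℂ ξ ξ • B - rankOne ℂ (B ξ) ξ) ξ = 0 := by
      simp [InnerProductSpace.rankOne_apply]
    rw [this, smul_zero, map_sub, map_smul, sub_apply, smul_apply, sub_eq_zero] at ht
    rw [ht, ← hQ, ha]
  have k1 := key 1
  rw [hs', one_apply_eq_self, smul_smul] at k1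
  have ea : inner ℂ ξ ξ * s = a := smul_left_injective ℂ hξ k1
  have kA := key A
  rw [← ea, ← smul_smul] at kA
  have := smul_right_injective H hξn kA
  rw [this, smul_apply]

end I5
end IsoRefl

namespace IsoRefl
open InnerProductSpace
section J5
set_option linter.unusedSectionVars false
set_option linter.unusedSimpArgs false
open scoped BoundedContinuousFunction
open Filter Topology
variable {X : Type*} [TopologicalSpace X] [T2Space X] [LocallyCompactSpace X]
variable {H : Type*} [NormedAddCommGroup H] [InnerProductSpace ℂ H] [CompleteSpace H]
variable {E : Type*} [NormedAddCommGroup E] [NormedSpace ℂ E]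

lemma tens_add (k : C₀(X, ℂ)) (A B : E) : tens k (A + B) = tens k A + tens k B := by
  ext x; simp [smul_add]

lemma tens_smul (k : C₀(X, ℂ)) (c : ℂ) (A : E) : tens k (c • A) = c • tens k A := by
  ext x; simp only [tens_apply, ZeroAtInftyContinuousMap.smul_apply]; exact smul_comm _ _ _

lemma hmul_add (h : C₀(X, ℂ)) (f g : C₀(X, E)) : hmul h (f + g) = hmul h f + hmul h g := by
  ext x; simp [smul_add]

lemma hmul_smul (h : C₀(X, ℂ)) (c : ℂ) (f : C₀(X, E)) : hmul h (c • f) = c • hmul h f := by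
  ext x; simp only [hmul_apply, ZeroAtInftyContinuousMap.smul_apply]; exact smul_comm _ _ _

lemma tens_sub (k : C₀(X, ℂ)) (A B : E) : tens k (A - B) = tens k A - tens k B := by
  ext x; simp [smul_sub]

lemma tens_norm_le (k : C₀(X, ℂ)) (A : E) : ‖tens k A‖ ≤ ‖k‖ * ‖A‖ :=
  n_bd _ (by positivity) fun x => by
    rw [tens_apply, norm_smul]; gcongr; exact n_le k x

lemma hmul_norm_le (k : C₀(X, ℂ)) (f : C₀(X, E)) : ‖hmul k f‖ ≤ ‖k‖ * ‖f‖ :=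
  n_bd _ (by positivity) fun x => by
    rw [hmul_apply, norm_smul]; exact mul_le_mul (n_le k x) (n_le f x) (norm_nonneg _) (norm_nonneg _)

lemma ofR_norm_le {r : C₀(X, ℝ)} (h : ∀ x, 0 ≤ r x ∧ r x ≤ 1) : ‖ofR r‖ ≤ 1 :=
  n_bd _ zero_le_one fun x => by
    rw [ofR_apply, Complex.norm_real, Real.norm_of_nonneg (h x).1]; exact (h x).2

/-- complex unit-norm function equal to one at a point -/
lemma peak (y : X) : ∃ k : C₀(X, ℂ), k y = 1 ∧ ‖k‖ ≤ 1 := by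
  obtain ⟨r, h1, h2, -⟩ := bump_pt y (univ_mem)
  exact ⟨ofR r, by simp [h2], ofR_norm_le h1⟩

lemma norm_le_zero_of {a C : ℝ} (hC : 0 ≤ C) (h : ∀ ε > 0, a ≤ C * ε) : a ≤ 0 := by
  refine le_of_forall_pos_le_add fun δ hδ => ?_
  have := h (δ / (C + 1)) (by positivity)
  refine this.trans ?_
  rw [zero_add, mul_div_assoc', div_le_iff₀ (by positivity)]
  nlinarith

/-- a linear map that vanishes at x on the functions vanishing at y factors -/
lemma l5_scal (S : C₀(X, H →L[ℂ] H) ≃ₗᵢ[ℂ] C₀(X, H →L[ℂ] H)) (h : C₀(X, ℂ)) (x : X) :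
    ∃ s : ℂ, ∀ f, S (hmul h f) x = s • S f x := by
  have hyp : ∀ f (η ξ : H), inner ℂ η (f x ξ) = 0 →
      inner ℂ η (S (hmul h (S.symm f)) x ξ) = 0 := by
    intro f η ξ h0
    refine l2_zero f _ ‖h‖ (norm_nonneg _) ?_ x η ξ h0
    intro g r hr
    have e : g + S (hmul h (S.symm f)) = S (S.symm g + hmul h (S.symm f)) := by simp
    rw [e, S.norm_map]
    have hr0 : 0 ≤ r := (norm_nonneg _).trans (hr 0 (by simp))
    refine n_bd _ hr0 fun y => ?_
    have h1 := hr (h y) (n_le h y)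
    have e2 : g + h y • f = S (S.symm g + h y • S.symm f) := by simp
    rw [e2, S.norm_map] at h1
    exact (n_le (S.symm g + h y • S.symm f) y).trans h1
  have hz : ∀ f, f x = 0 → S (hmul h (S.symm f)) x = 0 := by
    intro f hf
    ext ξ
    have := hyp f (S (hmul h (S.symm f)) x ξ) ξ (by simp [hf])
    simpa using this
  obtain ⟨k, hk, -⟩ := peak x
  let L : (H →L[ℂ] H) →ₗ[ℂ] (H →L[ℂ] H) :=
    { toFun := fun A => S (hmul h (S.symm (tens k A))) x
      map_add' := fun A B => by
        rw [tens_add, map_add, hmul_add, map_add, ZeroAtInftyContinuousMap.add_apply]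
      map_smul' := fun c A => by
        rw [tens_smul, map_smul, hmul_smul, map_smul, RingHom.id_apply,
          ZeroAtInftyContinuousMap.smul_apply] }
  have hL : ∀ A, L A = S (hmul h (S.symm (tens k A))) x := fun _ => rfl
  obtain ⟨s, hs⟩ := l3 L (fun A ξ => by
    refine span_of_perp _ _ fun η hη => ?_
    rw [hL]
    refine hyp _ η ξ ?_
    simpa [hk] using hη)
  refine ⟨s, fun f => ?_⟩
  have h1 := hz (S f - tens k (S f x)) (by simp [hk])
  have e : hmul h (S.symm (S f - tens k (S f x)))
      = hmul h f - hmul h (S.symm (tens k (S f x))) := by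
    rw [map_sub, S.symm_apply_apply]; ext1 y; simp [smul_sub]
  rw [e, map_sub, ZeroAtInftyContinuousMap.sub_apply, sub_eq_zero] at h1
  rw [h1, ← hL, hs]

lemma l5_pt [SigmaCompactSpace X] (hH : ¬ FiniteDimensional ℂ H)
    (S : C₀(X, H →L[ℂ] H) ≃ₗᵢ[ℂ] C₀(X, H →L[ℂ] H)) (x : X) :
    ∃ y, ∀ f, f y = 0 → S f x = 0 := by
  obtain ⟨ξ, hξ, -, -⟩ := exists_unit_orth hH (0 : H) 0
  have : Nontrivial H := ⟨ξ, 0, fun h => by simp [h] at hξ⟩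
  obtain ⟨k, hk, -⟩ := peak x
  choose s hs using fun h => l5_scal S h x
  set F0 := S.symm (tens k (1 : H →L[ℂ] H)) with hF0
  have hF : S F0 x = 1 := by rw [hF0, S.apply_symm_apply]; simp [hk]
  have hsv : ∀ h, s h = inner ℂ ξ (S (hmul h F0) x ξ) := by
    intro h
    rw [hs, hF]
    simp [inner_smul_right, inner_self_eq_norm_sq_to_K, hξ]
  let ℓ : C₀(X, ℂ) →L[ℂ] ℂ := LinearMap.mkContinuous
    { toFun := s
      map_add' := fun a b => by
        rw [hsv, hsv, hsv, ← inner_add_right, ← add_apply, ← ZeroAtInftyContinuousMap.add_apply,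
          ← map_add]
        congr 4; ext1 y; simp [add_smul]
      map_smul' := fun c a => by
        rw [hsv, hsv, RingHom.id_apply, smul_eq_mul, ← inner_smul_right, ← smul_apply,
          ← ZeroAtInftyContinuousMap.smul_apply, ← map_smul]
        congr 4; ext1 y; simp [mul_smul] } ‖F0‖ (by
      intro a
      show ‖s a‖ ≤ _
      rw [hsv]
      refine (norm_inner_le_norm _ _).trans ?_
      rw [hξ, one_mul]
      refine ((S (hmul a F0) x).le_opNorm ξ).trans ?_
      rw [hξ, mul_one]
      refine (n_le _ x).trans ?_
      rw [S.norm_map, mul_comm]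
      exact hmul_norm_le _ _)
  have hℓ : ∀ h, ℓ h = s h := fun _ => rfl
  obtain ⟨y, hy⟩ := l4 ℓ (by
    intro g hg h0
    obtain ⟨b, hb⟩ := approx_h g hg F0 (ε := 1 / 2) (by norm_num)
    have h1 := n_le (S (F0 - hmul g (bmul b F0))) x
    rw [S.norm_map, map_sub, ZeroAtInftyContinuousMap.sub_apply, hs, ← hℓ, h0, zero_smul, sub_zero,
      hF, norm_one] at h1
    linarith)
  refine ⟨y, fun f hf => ?_⟩
  have : ‖S f x‖ ≤ 0 := norm_le_zero_of zero_le_one fun ε hε => by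
    obtain ⟨h, h1, h2⟩ := approx_mul f y hf hε
    have h3 := n_le (S (f - hmul h f)) x
    rw [S.norm_map, map_sub, ZeroAtInftyContinuousMap.sub_apply, hs, ← hℓ, hy h h1, zero_smul,
      sub_zero] at h3
    linarith
  exact norm_le_zero_iff.1 this

lemma cont_of (φ : X → X) (h : ∀ r : C₀(X, ℝ), (∀ x, 0 ≤ r x ∧ r x ≤ 1) →
    Continuous (fun x => r (φ x))) : Continuous φ := by
  rw [continuous_iff_continuousAt]
  intro x U hU
  obtain ⟨r, h1, h2, h3⟩ := bump_pt (φ x) hU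
  have hc : ContinuousAt (fun x => r (φ x)) x := (h r h1).continuousAt
  have : ∀ᶠ z in 𝓝 x, 0 < r (φ z) := hc.eventually (lt_mem_nhds (by show 0 < r (φ x); rw [h2]; norm_num))
  rw [mem_map]
  filter_upwards [this] with z hz
  by_contra hzU
  rw [h3 _ hzU] at hz
  exact lt_irrefl _ hz

lemma pt_eq {y z : X} (A : E) (hA : A ≠ 0) (h : ∀ f : C₀(X, E), f y = 0 → f z = 0) : y = z := by
  by_contra hne
  obtain ⟨r, h1, h2, h3⟩ := bump_pt z (isOpen_compl_singleton.mem_nhds (Ne.symm hne) :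
    ({y}ᶜ : Set X) ∈ 𝓝 z)
  have := h (tens (ofR r) A) (by simp [h3 y (by simp)])
  simp [h2, hA] at this

theorem l5 [SigmaCompactSpace X] (hH : ¬ FiniteDimensional ℂ H)
    (S : C₀(X, H →L[ℂ] H) ≃ₗᵢ[ℂ] C₀(X, H →L[ℂ] H)) :
    ∃ φ : X ≃ₜ X, ∀ x, ∃ R : (H →L[ℂ] H) ≃ₗᵢ[ℂ] (H →L[ℂ] H), ∀ f, S f x = R (f (φ x)) := by
  obtain ⟨ξ, hξ, -, -⟩ := exists_unit_orth hH (0 : H) 0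
  have : Nontrivial H := ⟨ξ, 0, fun h => by simp [h] at hξ⟩
  choose φ hφ using l5_pt hH S
  choose ψ hψ using l5_pt hH S.symm
  have hψφ : ∀ x, ψ (φ x) = x := fun x => pt_eq (1 : H →L[ℂ] H) one_ne_zero fun g hg => by
    have := hφ x _ (hψ (φ x) g hg)
    simpa using this
  have hφψ : ∀ x, φ (ψ x) = x := fun x => pt_eq (1 : H →L[ℂ] H) one_ne_zero fun g hg => by
    have := hψ x _ (hφ (ψ x) g hg)
    simpa using this
  have mk : ∀ (S' : C₀(X, H →L[ℂ] H) ≃ₗᵢ[ℂ] C₀(X, H →L[ℂ] H)) (x y : X)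
      (_ : ∀ f, f y = 0 → S' f x = 0) (_ : ∀ f, f x = 0 → S'.symm f y = 0),
      ∃ R : (H →L[ℂ] H) ≃ₗᵢ[ℂ] (H →L[ℂ] H), ∀ f, S' f x = R (f y) := by
    intro S' x y h1 h2
    obtain ⟨k, hk, hkn⟩ := peak y
    obtain ⟨k', hk', hkn'⟩ := peak x
    have f1 : ∀ f, S' f x = S' (tens k (f y)) x := by
      intro f
      have := h1 (f - tens k (f y)) (by simp [hk])
      rwa [map_sub, ZeroAtInftyContinuousMap.sub_apply, sub_eq_zero] at this
    have f2 : ∀ f, S'.symm f y = S'.symm (tens k' (f x)) y := by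
      intro f
      have := h2 (f - tens k' (f x)) (by simp [hk'])
      rwa [map_sub, ZeroAtInftyContinuousMap.sub_apply, sub_eq_zero] at this
    have g1 : ∀ A, ‖S' (tens k A) x‖ ≤ ‖A‖ := by
      intro A
      refine (n_le _ x).trans ?_
      rw [S'.norm_map]
      refine (tens_norm_le _ _).trans ?_
      nlinarith [norm_nonneg A]
    have g2 : ∀ A, ‖S'.symm (tens k' A) y‖ ≤ ‖A‖ := by
      intro A
      refine (n_le _ y).trans ?_
      rw [S'.symm.norm_map]
      refine (tens_norm_le _ _).trans ?_
      nlinarith [norm_nonneg A]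
    have i1 : ∀ A, S'.symm (tens k' (S' (tens k A) x)) y = A := by
      intro A
      rw [← f2, S'.symm_apply_apply]; simp [hk]
    have i2 : ∀ A, S' (tens k (S'.symm (tens k' A) y)) x = A := by
      intro A
      rw [← f1, S'.apply_symm_apply]; simp [hk']
    let R0 : (H →L[ℂ] H) ≃ₗ[ℂ] (H →L[ℂ] H) :=
      { toFun := fun A => S' (tens k A) x
        map_add' := fun A B => by
          rw [tens_add, map_add, ZeroAtInftyContinuousMap.add_apply]
        map_smul' := fun c A => by
          rw [tens_smul, map_smul, ZeroAtInftyContinuousMap.smul_apply, RingHom.id_apply]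
        invFun := fun A => S'.symm (tens k' A) y
        left_inv := i1
        right_inv := i2 }
    refine ⟨⟨R0, fun A => le_antisymm (g1 A) ?_⟩, fun f => f1 f⟩
    show ‖A‖ ≤ ‖S' (tens k A) x‖
    have := g2 (S' (tens k A) x)
    rwa [i1] at this
  have hR : ∀ x, ∃ R : (H →L[ℂ] H) ≃ₗᵢ[ℂ] (H →L[ℂ] H), ∀ f, S f x = R (f (φ x)) := fun x =>
    mk S x (φ x) (hφ x) (fun f hf => hψ (φ x) f (by rw [hψφ]; exact hf))
  have hR' : ∀ x, ∃ R : (H →L[ℂ] H) ≃ₗᵢ[ℂ] (H →L[ℂ] H), ∀ f, S.symm f x = R (f (ψ x)) := fun x =>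
    mk S.symm x (ψ x) (hψ x) (fun f hf => hφ (ψ x) f (by rw [hφψ]; exact hf))
  have cont : ∀ (S' : C₀(X, H →L[ℂ] H) ≃ₗᵢ[ℂ] C₀(X, H →L[ℂ] H)) (φ' : X → X)
      (_ : ∀ x, ∃ R : (H →L[ℂ] H) ≃ₗᵢ[ℂ] (H →L[ℂ] H), ∀ f, S' f x = R (f (φ' x))),
      Continuous φ' := by
    intro S' φ' h'
    refine cont_of φ' fun r hr => ?_
    have e : (fun x => r (φ' x)) = fun x => ‖S' (tens (ofR r) (1 : H →L[ℂ] H)) x‖ := by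
      funext x
      obtain ⟨R, hR⟩ := h' x
      rw [hR, R.norm_map, tens_apply, norm_smul, norm_one, mul_one, ofR_apply, Complex.norm_real,
        Real.norm_of_nonneg (hr _).1]
    rw [e]
    exact (S' _).continuous.norm
  exact ⟨⟨⟨φ, ψ, hψφ, hφψ⟩, cont S φ hR, cont S.symm ψ hR'⟩, hR⟩

end J5
end IsoRefl

namespace IsoRefl
open InnerProductSpace
section K10
set_option linter.unusedSectionVars false
set_option linter.unusedSimpArgs false
open scoped BoundedContinuousFunction
open Filter Topology
variable {X : Type*} [TopologicalSpace X] [T2Space X] [LocallyCompactSpace X] [SigmaCompactSpace X]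
variable {H : Type*} [NormedAddCommGroup H] [InnerProductSpace ℂ H] [CompleteSpace H]

/-- point-local form -/
def Loc (Λ : C₀(X, H →L[ℂ] H) →ₗ[ℂ] (H →L[ℂ] H)) : Prop :=
  ∀ f, ∃ (y : X) (R : (H →L[ℂ] H) ≃ₗᵢ[ℂ] (H →L[ℂ] H)), Λ f = R (f y)

lemma Loc.norm_le {Λ : C₀(X, H →L[ℂ] H) →ₗ[ℂ] (H →L[ℂ] H)} (h : Loc Λ) (f) : ‖Λ f‖ ≤ ‖f‖ := by
  obtain ⟨y, R, e⟩ := h f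
  rw [e, R.norm_map]
  exact n_le f y

lemma tens_add_left {E : Type*} [NormedAddCommGroup E] [NormedSpace ℂ E] (k l : C₀(X, ℂ)) (A : E) :
    tens (k + l) A = tens k A + tens l A := by
  ext x; simp [add_smul]

lemma tens_smul_left {E : Type*} [NormedAddCommGroup E] [NormedSpace ℂ E] (c : ℂ) (k : C₀(X, ℂ))
    (A : E) : tens (c • k) A = c • tens k A := by
  ext x; simp [mul_smul]

/-- first part: scalar functions -/
lemma Loc.scalar {Λ : C₀(X, H →L[ℂ] H) →ₗ[ℂ] (H →L[ℂ] H)} (h : Loc Λ)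
    (hH : ¬ FiniteDimensional ℂ H) :
    ∃ (U : H →L[ℂ] H) (ℓ : C₀(X, ℂ) →ₗ[ℂ] ℂ) (y0 : X), (∀ z, ‖U z‖ = ‖z‖) ∧ Function.Surjective U ∧
      (∀ g, Λ (tens g 1) = ℓ g • U) ∧ (∀ g, g y0 = 0 → ℓ g = 0) ∧
      (∀ g, g y0 ≠ 0 → ℓ g ≠ 0) := by
  obtain ⟨G, hG⟩ := exists_pos (X := X)
  obtain ⟨ξ, hξ, -, -⟩ := exists_unit_orth hH (0 : H) 0
  have hnt : Nontrivial H := ⟨ξ, 0, fun h => by simp [h] at hξ⟩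
  obtain ⟨y1, R1, e1⟩ := h (tens (ofR G) 1)
  set U := R1 1 with hU
  set c1 := ofR G y1 with hc1
  have hc1' : c1 ≠ 0 := by rw [hc1, ofR_apply]; exact_mod_cast (hG y1).ne'
  have e1' : Λ (tens (ofR G) 1) = c1 • U := by rw [e1, tens_apply, map_smul]
  obtain ⟨hUn, hUs⟩ := (std_isom hH R1).one
  have hd : ∀ g, ∃ d : ℂ, Λ (tens g 1) = d • U := by
    intro g
    refine scaled_isometry hUn hUs 1 one_pos fun c _ => ?_
    have e2 : Λ (tens g 1) + c • U = Λ (tens (g + (c / c1) • ofR G) 1) := by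
      rw [tens_add_left, map_add, tens_smul_left, map_smul, e1', smul_smul, div_mul_cancel₀ _ hc1']
    obtain ⟨y, R, e3⟩ := h (tens (g + (c / c1) • ofR G) 1)
    refine ⟨‖(g + (c / c1) • ofR G) y‖, fun z => ?_⟩
    rw [e2, e3, tens_apply, map_smul, smul_apply, norm_smul, (std_isom hH R).one.1]
  choose d hd using hd
  have hUξ : inner ℂ (U ξ) (U ξ) = 1 := by
    rw [inner_self_eq_norm_sq_to_K, hUn, hξ]; simp
  have hdv : ∀ g, d g = inner ℂ (U ξ) (Λ (tens g 1) ξ) := by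
    intro g
    rw [hd, smul_apply, inner_smul_right, hUξ, mul_one]
  let ℓ : C₀(X, ℂ) →ₗ[ℂ] ℂ :=
    { toFun := d
      map_add' := fun a b => by
        rw [hdv, hdv, hdv, tens_add_left, map_add, add_apply, inner_add_right]
      map_smul' := fun c a => by
        rw [hdv, hdv, tens_smul_left, map_smul, smul_apply, inner_smul_right]; rfl }
  have hℓ : ∀ g, Λ (tens g 1) = ℓ g • U := hd
  have hb : ∀ g, ‖ℓ g‖ ≤ 1 * ‖g‖ := by
    intro g
    have h1 := h.norm_le (tens g 1)
    have h2 : ‖ℓ g‖ = ‖Λ (tens g 1)‖ := by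
      rw [hℓ, norm_smul, hU, R1.norm_map, norm_one, mul_one]
    rw [h2, one_mul]
    refine h1.trans ?_
    have := tens_norm_le g (1 : H →L[ℂ] H)
    rwa [norm_one, mul_one] at this
  have hnz : ∀ g : C₀(X, ℂ), (∀ x, g x ≠ 0) → ℓ g ≠ 0 := by
    intro g hg h0
    obtain ⟨y, R, e⟩ := h (tens g 1)
    rw [hℓ, h0, zero_smul, tens_apply] at e
    have := congrArg norm e
    rw [R.norm_map, norm_zero, norm_smul, norm_one, mul_one] at this
    exact hg y (norm_eq_zero.1 this.symm)
  obtain ⟨y0, hy0⟩ := l4 (ℓ.mkContinuous 1 hb) hnz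
  refine ⟨U, ℓ, y0, hUn, hUs, hℓ, hy0, fun g hg h0 => ?_⟩
  have h1 : ℓ (ofR G - (ofR G y0 / g y0) • g) = 0 := hy0 _ (by simp [hg])
  rw [map_sub, map_smul, h0, smul_zero, sub_zero] at h1
  exact hnz (ofR G) (fun x => by simpa using (hG x).ne') h1

lemma Loc.van {Λ : C₀(X, H →L[ℂ] H) →ₗ[ℂ] (H →L[ℂ] H)} (h : Loc Λ)
    (hH : ¬ FiniteDimensional ℂ H) : ∃ y0, ∀ f, f y0 = 0 → Λ f = 0 := by
  obtain ⟨U, ℓ, y0, hUn, hUs, hℓ, hℓ0, hℓ1⟩ := h.scalar hH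
  obtain ⟨v, hv, -, -⟩ := exists_unit_orth hH (0 : H) 0
  have hnt : Nontrivial H := ⟨v, 0, fun h => by simp [h] at hv⟩
  have hUnorm : ‖U‖ = 1 := by
    refine le_antisymm (U.opNorm_le_bound zero_le_one fun z => by rw [hUn, one_mul]) ?_
    have := U.le_opNorm v
    rw [hUn, hv, mul_one] at this
    exact this
  -- functions vanishing near the point
  have near : ∀ f, (∀ᶠ z in 𝓝 y0, f z = 0) → ∃ d : ℂ, Λ f = d • U := by
    intro f hf
    obtain ⟨r, r1, r2, r3⟩ := bump_pt y0 hf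
    have hk : ℓ (ofR r) ≠ 0 := hℓ1 _ (by simp [r2])
    refine scaled_isometry hUn hUs (2 * ‖f‖ + 1) (by positivity) fun c hc => ?_
    set w := c / ℓ (ofR r) with hw
    have e2 : Λ f + c • U = Λ (f + w • tens (ofR r) 1) := by
      rw [map_add, map_smul, hℓ, smul_smul, hw, div_mul_cancel₀ _ hk]
    obtain ⟨y, R, e3⟩ := h (f + w • tens (ofR r) 1)
    have hfy : f y = 0 := by
      by_contra hne
      have hr : r y = 0 := r3 y hne
      have e4 : (f + w • tens (ofR r) (1 : H →L[ℂ] H)) y = f y := by simp [hr]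
      have h5 : ‖Λ f + c • U‖ ≤ ‖f‖ := by
        rw [e2, e3, e4, R.norm_map]; exact n_le f y
      have h6 : ‖c • U‖ ≤ ‖Λ f + c • U‖ + ‖Λ f‖ := by
        have := norm_sub_le (Λ f + c • U) (Λ f)
        simpa using this
      rw [norm_smul, hc, hUnorm] at h6
      have := h.norm_le f
      linarith
    refine ⟨‖w * ofR r y‖, fun z => ?_⟩
    rw [e2, e3, ZeroAtInftyContinuousMap.add_apply, hfy, zero_add,
      ZeroAtInftyContinuousMap.smul_apply, tens_apply, smul_smul, map_smul, smul_apply, norm_smul,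
      (std_isom hH R).one.1]
  have near0 : ∀ f, (∀ᶠ z in 𝓝 y0, f z = 0) → (∃ z : H, z ≠ 0 ∧ ∀ y, f y z = 0) → Λ f = 0 := by
    rintro f hf ⟨z, hz, hz'⟩
    obtain ⟨d, hd⟩ := near f hf
    by_cases hd0 : d = 0
    · rw [hd, hd0, zero_smul]
    obtain ⟨y, R, e⟩ := h f
    refine absurd ((std_isom hH R).inj_of_bij (A := f y) ?_ ?_ z (hz' y)) hz
    · intro w hw
      rw [← e, hd, smul_apply, smul_eq_zero] at hw
      have := hUn w
      rw [hw.resolve_left hd0, norm_zero] at this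
      exact norm_eq_zero.1 this.symm
    · intro w
      obtain ⟨u, hu⟩ := hUs (d⁻¹ • w)
      exact ⟨u, by rw [← e, hd, smul_apply, hu, smul_smul, mul_inv_cancel₀ hd0, one_smul]⟩
  have near1 : ∀ f, (∀ᶠ z in 𝓝 y0, f z = 0) → Λ f = 0 := by
    intro f hf
    obtain ⟨w, hw, hw1, -⟩ := exists_unit_orth hH v v
    set L : (H →L[ℂ] H) →L[ℂ] (H →L[ℂ] H) :=
      (ContinuousLinearMap.compL ℂ H H H).flip (rankOne ℂ v v) with hL
    have hLa : ∀ A z, L A z = A (rankOne ℂ v v z) := fun A z => rfl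
    have s1 : Λ (pcomp L f) = 0 := by
      refine near0 _ (hf.mono fun z hz => by rw [pcomp_apply, hz, map_zero]) ⟨w, ?_, fun y => ?_⟩
      · intro h0; simp [h0] at hw
      · rw [pcomp_apply, hLa, InnerProductSpace.rankOne_apply, hw1]; simp
    have s2 : Λ (f - pcomp L f) = 0 := by
      refine near0 _ (hf.mono fun z hz => ?_) ⟨v, ?_, fun y => ?_⟩
      · rw [ZeroAtInftyContinuousMap.sub_apply, pcomp_apply, hz, map_zero, sub_zero]
      · intro h0; simp [h0] at hv
      · rw [ZeroAtInftyContinuousMap.sub_apply, sub_apply, pcomp_apply, hLa, rankOne_self hv,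
          sub_self]
    rw [map_sub, s1, sub_zero] at s2
    exact s2
  refine ⟨y0, fun f hf => ?_⟩
  have : ‖Λ f‖ ≤ 0 := norm_le_zero_of zero_le_one fun ε hε => by
    obtain ⟨f', h1, h2⟩ := approx_van f y0 hf hε
    have h3 := h.norm_le (f - f')
    rw [map_sub, near1 f' h2, sub_zero] at h3
    linarith
  exact norm_le_zero_iff.1 this

theorem l10 [TopologicalSpace.SeparableSpace H] {Λ : C₀(X, H →L[ℂ] H) →ₗ[ℂ] (H →L[ℂ] H)}
    (h : Loc Λ) (hH : ¬ FiniteDimensional ℂ H) :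
    ∃ (y0 : X) (R : (H →L[ℂ] H) ≃ₗᵢ[ℂ] (H →L[ℂ] H)), ∀ f, Λ f = R (f y0) := by
  obtain ⟨y0, hy0⟩ := h.van hH
  obtain ⟨k, hk, hkn⟩ := peak y0
  obtain ⟨G, hG⟩ := exists_pos (X := X)
  set a := G y0 with ha
  have ha0 : 0 < a := hG y0
  let Ψ : (H →L[ℂ] H) →ₗ[ℂ] (H →L[ℂ] H) :=
    { toFun := fun A => Λ (tens k A)
      map_add' := fun A B => by rw [tens_add, map_add]
      map_smul' := fun c A => by rw [tens_smul, map_smul, RingHom.id_apply] }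
  have hΨ : ∀ A, Ψ A = Λ (tens k A) := fun _ => rfl
  have hΛ : ∀ f, Λ f = Ψ (f y0) := by
    intro f
    have := hy0 (f - tens k (f y0)) (by simp [hk])
    rwa [map_sub, sub_eq_zero] at this
  have hn : ∀ A, ‖Ψ A‖ ≤ ‖A‖ := by
    intro A
    refine (h.norm_le _).trans ((tens_norm_le _ _).trans ?_)
    nlinarith [norm_nonneg A]
  have hform : ∀ A, ∃ (t : ℝ) (R : (H →L[ℂ] H) ≃ₗᵢ[ℂ] (H →L[ℂ] H)), 0 < t ∧
      Ψ A = R ((t : ℂ) • A) := by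
    intro A
    obtain ⟨y, R, e⟩ := h (tens (((a⁻¹ : ℝ) : ℂ) • ofR G) A)
    refine ⟨a⁻¹ * G y, R, mul_pos (inv_pos.2 ha0) (hG y), ?_⟩
    have e1 : (tens (((a⁻¹ : ℝ) : ℂ) • ofR G) A) y0 = A := by
      rw [tens_apply, ZeroAtInftyContinuousMap.smul_apply, ofR_apply, ← ha, smul_eq_mul,
        ← Complex.ofReal_mul, inv_mul_cancel₀ ha0.ne', Complex.ofReal_one, one_smul]
    rw [hΛ, e1] at e
    rw [e, tens_apply, ZeroAtInftyContinuousMap.smul_apply, ofR_apply, smul_eq_mul,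
      ← Complex.ofReal_mul]
  have hi : ∀ A, Ψ A = 0 → A = 0 := by
    intro A hA
    obtain ⟨t, R, ht, e⟩ := hform A
    rw [hA] at e
    have := (R.map_eq_zero_iff).1 e.symm
    rw [smul_eq_zero] at this
    exact this.resolve_left (by exact_mod_cast ht.ne')
  have hr : ∀ x y : H, ‖x‖ = 1 → ‖y‖ = 1 →
      ∃ u v : H, ‖u‖ = 1 ∧ ‖v‖ = 1 ∧ Ψ (rankOne ℂ x y) = rankOne ℂ u v := by
    intro x y hx hy
    obtain ⟨x', hx', hxx, -⟩ := exists_unit_orth hH x x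
    obtain ⟨y', hy', hyy, -⟩ := exists_unit_orth hH y y
    set b : C₀(X, ℂ) := ((a⁻¹ : ℝ) : ℂ) • ofR G with hb
    have hbv : ∀ z, b z = ((a⁻¹ * G z : ℝ) : ℂ) := by
      intro z
      rw [hb, ZeroAtInftyContinuousMap.smul_apply, ofR_apply, smul_eq_mul, ← Complex.ofReal_mul]
    set q : C₀(X, ℂ) := b * b * b - (b * b + b * b) + b with hq
    have hqv : ∀ z, q z = b z * (b z - 1) ^ 2 := by
      intro z
      rw [hq]
      simp only [ZeroAtInftyContinuousMap.add_apply, ZeroAtInftyContinuousMap.sub_apply,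
        ZeroAtInftyContinuousMap.mul_apply]
      ring
    have hb0 : b y0 = 1 := by rw [hbv, ← ha, inv_mul_cancel₀ ha0.ne', Complex.ofReal_one]
    have hq0 : q y0 = 0 := by rw [hqv, hb0]; simp
    obtain ⟨z, R, e⟩ := h (tens b (rankOne ℂ x y) + tens q (rankOne ℂ x' y'))
    have e1 : (tens b (rankOne ℂ x y) + tens q (rankOne ℂ x' y')) y0 = rankOne ℂ x y := by
      simp [hb0, hq0]
    rw [hΛ, e1, ZeroAtInftyContinuousMap.add_apply, tens_apply, tens_apply] at e
    obtain ⟨t, R', ht, e'⟩ := hform (rankOne ℂ x y)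
    have hbz : b z ≠ 0 := by
      rw [hbv]
      have : 0 < a⁻¹ * G z := mul_pos (inv_pos.2 ha0) (hG z)
      exact_mod_cast this.ne'
    obtain ⟨u, v, hu, hv, e2⟩ := isom_rankOne (R'.trans R.symm) hx hy
    have e3 : b z • rankOne ℂ x y + q z • rankOne ℂ x' y' = rankOne ℂ ((t : ℂ) • u) v := by
      have : R.symm (Ψ (rankOne ℂ x y)) = b z • rankOne ℂ x y + q z • rankOne ℂ x' y' := by
        rw [e, R.symm_apply_apply]
      rw [← this, e', map_smul, map_smul, rankOne_smul_left, ← e2]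
      rfl
    have hw := rank_two hx hx' hy hy' hxx hyy hbz e3
    rw [hqv, mul_eq_zero] at hw
    have hb1 : b z = 1 := by
      have := pow_eq_zero_iff (two_ne_zero) |>.1 (hw.resolve_left hbz)
      exact sub_eq_zero.1 this
    obtain ⟨u', v', hu', hv', e4⟩ := isom_rankOne R hx hy
    refine ⟨u', v', hu', hv', ?_⟩
    rw [e, hb1, hqv, hb1, ← e4]
    simp
  have hRP : RP (Ψ.restrictScalars ℝ) := by
    refine rp_of_unit ?_ hn hi ?_
    · intro c A; exact Ψ.map_smul c A
    · intro x y hx hy; exact hr x y hx hy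
  obtain ⟨K, hK1, hK2, hK3⟩ := exists_K H
  have hstd : Std (Ψ.restrictScalars ℝ) := by
    obtain ⟨t, R, ht, e⟩ := hform K
    have htc : (t : ℂ) ≠ 0 := by exact_mod_cast ht.ne'
    obtain ⟨i1, i2⟩ := (std_isom hH R).surj_inj (K := (t : ℂ) • K)
      (by rw [star_smul, hK1]; simp)
      (by
        intro z hz
        rw [smul_apply, smul_eq_zero] at hz
        exact hK2 z (hz.resolve_left htc))
    refine hRP.std_of_K hH K hK3 ?_ ?_
    · intro z hz
      refine i1 z ?_
      rw [← e]; exact hz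
    · rw [← e] at i2
      exact i2
  have hnorm : ∀ A, ‖Ψ A‖ = ‖A‖ := hstd.norm_eq
  have hsurj : Function.Surjective Ψ := hstd.surjective (fun c A => Ψ.map_smul c A)
  refine ⟨y0, LinearIsometryEquiv.ofSurjective ⟨Ψ, hnorm⟩ hsurj, fun f => hΛ f⟩

end K10
end IsoRefl

namespace IsoRefl
open InnerProductSpace
section L12
set_option linter.unusedSectionVars false
set_option linter.unusedSimpArgs false
open scoped BoundedContinuousFunction
open Filter Topology
variable {X : Type*} [TopologicalSpace X] [T2Space X] [LocallyCompactSpace X] [SigmaCompactSpace X]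
variable {H : Type*} [NormedAddCommGroup H] [InnerProductSpace ℂ H] [CompleteSpace H]

/-- composition with a homeomorphism -/
def cmp {E : Type*} [NormedAddCommGroup E] (σ : X ≃ₜ X) (f : C₀(X, E)) : C₀(X, E) where
  toFun := fun x => f (σ x)
  continuous_toFun := f.continuous.comp σ.continuous
  zero_at_infty' := (zero_at_infty f).comp σ.isClosedEmbedding.tendsto_cocompact

@[simp] lemma cmp_apply {E : Type*} [NormedAddCommGroup E] (σ : X ≃ₜ X) (f : C₀(X, E)) (x : X) :
    cmp σ f x = f (σ x) := rfl

lemma cmp_isom (σ : X ≃ₜ X) :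
    IsSurjectiveLinearIsometry (fun f : C₀(X, ℂ) => cmp σ f) := by
  have hle : ∀ (τ : X ≃ₜ X) (f : C₀(X, ℂ)), ‖cmp τ f‖ ≤ ‖f‖ := fun τ f =>
    n_bd _ (norm_nonneg _) fun x => n_le f (τ x)
  have hinv : ∀ f : C₀(X, ℂ), cmp σ (cmp σ.symm f) = f := fun f => by ext x; simp
  have hinv' : ∀ f : C₀(X, ℂ), cmp σ.symm (cmp σ f) = f := fun f => by ext x; simp
  refine ⟨⟨fun f g => by ext x; simp, fun c f => by ext x; simp⟩, fun f => ⟨_, hinv f⟩, fun f => ?_⟩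
  refine le_antisymm (hle σ f) ?_
  have := hle σ.symm (cmp σ f)
  rwa [hinv'] at this

/-- key comparison of the two points -/
lemma l12 (hH : ¬ FiniteDimensional ℂ H) (g : C₀(X, ℂ)) : ∃ f : C₀(X, H →L[ℂ] H),
    ∀ (y z : X) (R R' : (H →L[ℂ] H) ≃ₗᵢ[ℂ] (H →L[ℂ] H)), R (f y) = R' (f z) → g y = g z := by
  obtain ⟨G, hG⟩ := exists_pos (X := X)
  obtain ⟨e, he⟩ := exists_orthonormal3 hH
  let Gc : C₀(X, ℂ) := ofR G + mk0 (fun x => ((‖g x‖ : ℝ) : ℂ))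
    (Complex.continuous_ofReal.comp g.continuous.norm) g 1 (fun x => by simp)
  let Re : C₀(X, ℂ) := mk0 (fun x => (((g x).re : ℝ) : ℂ))
    (Complex.continuous_ofReal.comp (Complex.continuous_re.comp g.continuous)) g 1
    (fun x => by rw [Complex.norm_real, one_mul]; exact Complex.abs_re_le_norm _)
  let Im : C₀(X, ℂ) := mk0 (fun x => (((g x).im : ℝ) : ℂ))
    (Complex.continuous_ofReal.comp (Complex.continuous_im.comp g.continuous)) g 1
    (fun x => by rw [Complex.norm_real, one_mul]; exact Complex.abs_im_le_norm _)
  let pv : X → Fin 3 → ℝ := fun x => ![16 * (G x + ‖g x‖), 4 * (2 * (G x + ‖g x‖) + (g x).re),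
    2 * (G x + ‖g x‖) + (g x).im]
  have hpv : ∀ x, 0 < pv x 2 ∧ pv x 2 < pv x 1 ∧ pv x 1 < pv x 0 := by
    intro x
    have h1 := abs_le.1 (Complex.abs_re_le_norm (g x))
    have h2 := abs_le.1 (Complex.abs_im_le_norm (g x))
    have h3 := hG x
    simp only [pv, Matrix.cons_val_zero, Matrix.cons_val_one, Matrix.cons_val]
    refine ⟨?_, ?_, ?_⟩ <;> linarith [h1.1, h1.2, h2.1, h2.2, norm_nonneg (g x)]
  refine ⟨tens ((16 : ℂ) • Gc) (rankOne ℂ (e 0) (e 0))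
    + tens ((4 : ℂ) • ((2 : ℂ) • Gc + Re)) (rankOne ℂ (e 1) (e 1))
    + tens ((2 : ℂ) • Gc + Im) (rankOne ℂ (e 2) (e 2)), ?_⟩
  intro y z R R' h
  have hf : ∀ x, (tens ((16 : ℂ) • Gc) (rankOne ℂ (e 0) (e 0))
    + tens ((4 : ℂ) • ((2 : ℂ) • Gc + Re)) (rankOne ℂ (e 1) (e 1))
    + tens ((2 : ℂ) • Gc + Im) (rankOne ℂ (e 2) (e 2))) x = diag e (pv x) := by
    intro x
    rw [diag, Fin.sum_univ_three]
    simp only [ZeroAtInftyContinuousMap.add_apply, tens_apply, ZeroAtInftyContinuousMap.smul_apply,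
      pv, Matrix.cons_val_zero, Matrix.cons_val_one, Matrix.cons_val, Gc, Re, Im, ofR_apply,
      mk0_apply, smul_eq_mul]
    push_cast
    rfl
  rw [hf, hf] at h
  have hstd := std_isom hH (R.trans R'.symm)
  have := diag_eq hstd he (pv y) (pv z) (hpv y) (hpv z) (by
    rw [LinearIsometryEquiv.trans_apply, h, R'.symm_apply_apply])
  have e0 := congrFun this 0
  have e1 := congrFun this 1
  have e2 := congrFun this 2
  simp only [pv, Matrix.cons_val_zero, Matrix.cons_val_one, Matrix.cons_val] at e0 e1 e2
  apply Complex.ext <;> linarith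

/-- homeomorphism from surjective isometric composition -/
lemma homeo_of (φ : X → X) (T : C₀(X, ℂ) →L[ℂ] C₀(X, ℂ)) (hT : ∀ g x, T g x = g (φ x))
    (hs : Function.Surjective T) (hi : ∀ g, ‖T g‖ = ‖g‖) : ∃ σ : X ≃ₜ X, ∀ x, σ x = φ x := by
  have hc : Continuous φ := cont_of φ fun r _ => by
    have : (fun x => r (φ x)) = fun x => (T (ofR r) x).re := by
      funext x; rw [hT]; simp
    rw [this]
    exact Complex.continuous_re.comp (T (ofR r)).continuous
  have hinj : Function.Injective φ := by
    intro x x' hxx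
    refine pt_eq (1 : ℂ) one_ne_zero fun f hf => ?_
    obtain ⟨g, rfl⟩ := hs f
    rw [hT] at hf ⊢
    rwa [← hxx]
  have hprop : IsProperMap φ := by
    rw [isProperMap_iff_tendsto_cocompact]
    refine ⟨hc, ?_⟩
    intro U hU
    obtain ⟨K, hK, hKU⟩ := mem_cocompact.1 hU
    obtain ⟨r, r1, r2, -⟩ := bump hK isOpen_univ (Set.subset_univ _)
    have h1 : ∀ᶠ x in cocompact X, ‖T (ofR r) x‖ < 1 := by
      have := (zero_at_infty (T (ofR r))).norm
      rw [norm_zero] at this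
      exact this.eventually (gt_mem_nhds one_pos)
    rw [mem_map]
    filter_upwards [h1] with x hx
    refine hKU fun hxK => ?_
    rw [hT, ofR_apply, r2 _ hxK] at hx
    simp at hx
  have hcl := hprop.isClosedMap
  have hsurj : Function.Surjective φ := by
    intro y
    by_contra hy
    obtain ⟨r, r1, r2, r3⟩ := bump_pt y (hcl.isClosed_range.isOpen_compl.mem_nhds hy)
    have h0 : T (ofR r) = 0 := by
      ext x
      rw [hT, ofR_apply, r3 _ (by simp)]
      simp
    have h1 := hi (ofR r)
    rw [h0, norm_zero] at h1
    have h2 := n_le (ofR r) y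
    rw [← h1, ofR_apply, r2] at h2
    norm_num at h2
  exact ⟨(Equiv.ofBijective φ ⟨hinj, hsurj⟩).toHomeomorphOfContinuousClosed hc hcl, fun x => rfl⟩

lemma l13 (Φ : C₀(X, H →L[ℂ] H) →L[ℂ] C₀(X, H →L[ℂ] H)) (σ : X ≃ₜ X)
    (R : X → (H →L[ℂ] H) ≃ₗᵢ[ℂ] (H →L[ℂ] H)) (h : ∀ f x, Φ f x = R x (f (σ x))) :
    Function.Surjective Φ := by
  intro F
  have hc : Continuous (fun y => (R (σ.symm y)).symm (F (σ.symm y))) := by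
    rw [continuous_iff_continuousAt]
    intro y0
    set B := (R (σ.symm y0)).symm (F (σ.symm y0)) with hB
    obtain ⟨r, r1, r2, -⟩ := bump_near y0 univ_mem
    set f := tens (ofR r) B with hf
    have hcont : Continuous (fun y => ‖F (σ.symm y) - Φ f (σ.symm y)‖) :=
      ((F.continuous.comp σ.symm.continuous).sub ((Φ f).continuous.comp σ.symm.continuous)).norm
    have heq : ∀ᶠ y in 𝓝 y0, ‖(R (σ.symm y)).symm (F (σ.symm y)) - B‖
        = ‖F (σ.symm y) - Φ f (σ.symm y)‖ := by
      filter_upwards [r2] with y hy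
      rw [h, σ.apply_symm_apply, hf, tens_apply, ofR_apply, hy, Complex.ofReal_one, one_smul,
        ← (R (σ.symm y)).norm_map, map_sub, LinearIsometryEquiv.apply_symm_apply]
    have h0 : ‖F (σ.symm y0) - Φ f (σ.symm y0)‖ = 0 := by
      rw [← heq.self_of_nhds, ← hB, sub_self, norm_zero]
    rw [ContinuousAt, tendsto_iff_norm_sub_tendsto_zero]
    have := hcont.tendsto y0
    rw [h0] at this
    exact this.congr' (heq.mono fun y hy => hy.symm)
  refine ⟨mk0 _ hc (cmp σ.symm F) 1 (fun y => ?_), ?_⟩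
  · rw [LinearIsometryEquiv.norm_map, cmp_apply, one_mul]
  · ext1 x
    rw [h, mk0_apply, σ.symm_apply_apply, LinearIsometryEquiv.apply_symm_apply]

/-- main theorem in bundled form -/
theorem main [TopologicalSpace.SeparableSpace H] (hH : ¬ FiniteDimensional ℂ H)
    (hrefl : ∀ T : C₀(X, ℂ) →L[ℂ] C₀(X, ℂ),
      (∀ f : C₀(X, ℂ), ∃ S : C₀(X, ℂ) → C₀(X, ℂ), IsSurjectiveLinearIsometry S ∧ T f = S f) →
      IsSurjectiveLinearIsometry (⇑T))
    (Φ : C₀(X, H →L[ℂ] H) →L[ℂ] C₀(X, H →L[ℂ] H))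
    (hΦ : ∀ f : C₀(X, H →L[ℂ] H), ∃ S : C₀(X, H →L[ℂ] H) → C₀(X, H →L[ℂ] H),
      IsSurjectiveLinearIsometry S ∧ Φ f = S f) :
    IsSurjectiveLinearIsometry (⇑Φ) := by
  have hloc : ∀ f, ∃ τ : X ≃ₜ X, ∀ x, ∃ R : (H →L[ℂ] H) ≃ₗᵢ[ℂ] (H →L[ℂ] H),
      Φ f x = R (f (τ x)) := by
    intro f
    obtain ⟨S, ⟨hl, hs, hi⟩, e⟩ := hΦ f
    obtain ⟨τ, hτ⟩ := l5 hH (LinearIsometryEquiv.ofSurjective ⟨hl.mk' S, hi⟩ hs)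
    refine ⟨τ, fun x => ?_⟩
    obtain ⟨R, hR⟩ := hτ x
    refine ⟨R, ?_⟩
    rw [e, ← hR]
    rfl
  have hpt : ∀ x, ∃ (y0 : X) (R : (H →L[ℂ] H) ≃ₗᵢ[ℂ] (H →L[ℂ] H)), ∀ f, Φ f x = R (f y0) := by
    intro x
    let Λ : C₀(X, H →L[ℂ] H) →ₗ[ℂ] (H →L[ℂ] H) :=
      { toFun := fun f => Φ f x
        map_add' := fun f g => by rw [map_add, ZeroAtInftyContinuousMap.add_apply]
        map_smul' := fun c f => by
          rw [map_smul, ZeroAtInftyContinuousMap.smul_apply, RingHom.id_apply] }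
    refine l10 (Λ := Λ) ?_ hH
    intro f
    obtain ⟨τ, hτ⟩ := hloc f
    obtain ⟨R, hR⟩ := hτ x
    exact ⟨τ x, R, hR⟩
  choose φ R hR using hpt
  have hcmp : ∀ g : C₀(X, ℂ), ∃ τ : X ≃ₜ X, ∀ x, g (φ x) = g (τ x) := by
    intro g
    obtain ⟨f, hf⟩ := l12 hH g
    obtain ⟨τ, hτ⟩ := hloc f
    refine ⟨τ, fun x => ?_⟩
    obtain ⟨R', hR'⟩ := hτ x
    exact hf _ _ (R x) R' (by rw [← hR x f, hR'])
  choose τ hτ using hcmp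
  let T : C₀(X, ℂ) →L[ℂ] C₀(X, ℂ) := LinearMap.mkContinuous
    { toFun := fun g => cmp (τ g) g
      map_add' := fun a b => by
        ext x
        rw [ZeroAtInftyContinuousMap.add_apply, cmp_apply, cmp_apply, cmp_apply, ← hτ, ← hτ, ← hτ,
          ZeroAtInftyContinuousMap.add_apply]
      map_smul' := fun c a => by
        ext x
        rw [RingHom.id_apply, ZeroAtInftyContinuousMap.smul_apply, cmp_apply, cmp_apply, ← hτ, ← hτ,
          ZeroAtInftyContinuousMap.smul_apply] } 1 (fun g => by
      show ‖cmp (τ g) g‖ ≤ 1 * ‖g‖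
      rw [one_mul]
      exact ((cmp_isom (τ g)).2.2 g).le)
  have hT : ∀ g x, T g x = g (φ x) := fun g x => (hτ g x).symm
  obtain ⟨-, hTs, hTi⟩ := hrefl T (fun g => ⟨_, cmp_isom (τ g), rfl⟩)
  obtain ⟨σ, hσ⟩ := homeo_of φ T hT hTs hTi
  refine ⟨⟨map_add Φ, map_smul Φ⟩, l13 Φ σ R (fun f x => by rw [hσ]; exact hR x f), fun f => ?_⟩
  obtain ⟨S, ⟨-, -, hi⟩, e⟩ := hΦ f
  rw [e, hi]

end L12
end IsoRefl

/-- Let `X` be a σ-compact locally compact Hausdorff space. If the group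
of surjective linear isometries of `C₀(X)` is algebraically reflexive, then so is the
group of surjective linear isometries of `C₀(X, B(H))`. -/
theorem iso_reflexive_of_C0_BH_of_iso_reflexive_C0
    {H : Type*} [NormedAddCommGroup H] [InnerProductSpace ℂ H] [CompleteSpace H]
    [TopologicalSpace.SeparableSpace H] (hH : ¬ FiniteDimensional ℂ H)
    {X : Type*} [TopologicalSpace X] [LocallyCompactSpace X] [T2Space X]
    [SigmaCompactSpace X]
    (hrefl : ∀ T : C₀(X, ℂ) →L[ℂ] C₀(X, ℂ),
      (∀ f : C₀(X, ℂ), ∃ S : C₀(X, ℂ) → C₀(X, ℂ), IsSurjectiveLinearIsometry S ∧ T f = S f) →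
      IsSurjectiveLinearIsometry (⇑T))
    (Φ : C₀(X, H →L[ℂ] H) →L[ℂ] C₀(X, H →L[ℂ] H))
    (hΦ : ∀ f : C₀(X, H →L[ℂ] H), ∃ S : C₀(X, H →L[ℂ] H) → C₀(X, H →L[ℂ] H),
      IsSurjectiveLinearIsometry S ∧ Φ f = S f) :
    IsSurjectiveLinearIsometry (⇑Φ) := by
  exact IsoRefl.main hH hrefl Φ hΦ
end

section
/- Let Ω ⊆ ℝⁿ be a nonempty open convex set. Then the automorphism group of C₀(Ω) is algebraically reflexive: every bounded linear map F on C₀(Ω) such that for each f ∈ C₀(Ω) there exists an automorphism F_f of C₀(Ω) with F(f) = F_f(f), is itself an automorphism of C₀(Ω). -/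
open scoped ZeroAtInfty

/-- An automorphism of a (not necessarily unital) algebra: a multiplicative linear bijection. -/
def IsAlgebraAutomorphism {A : Type*} [NonUnitalNonAssocSemiring A] [Module ℂ A]
    (Φ : A → A) : Prop :=
  IsLinearMap ℂ Φ ∧ (∀ a b : A, Φ (a * b) = Φ a * Φ b) ∧ Function.Bijective Φ

section helpers
open Filter Topology

variable {X : Type*} [TopologicalSpace X]

lemma charRange_aux (L : C₀(X, ℂ) →ₗ[ℂ] ℂ) (hm : ∀ a b, L (a * b) = L a * L b)
    (f : C₀(X, ℂ)) (hf : L f ≠ 0) : ∃ x, L f = f x := by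
  by_contra hcon
  push Not at hcon
  have hne : ∀ x, L f - f x ≠ 0 := fun x => sub_ne_zero.mpr (hcon x)
  let g : C₀(X, ℂ) :=
    { toFun := fun x => f x / (L f - f x)
      continuous_toFun := by
        have := map_continuous f
        exact this.div (continuous_const.sub this) hne
      zero_at_infty' := by
        have h0 : Tendsto f (cocompact X) (𝓝 0) := zero_at_infty f
        have h1 := h0.div ((tendsto_const_nhds (x := L f)).sub h0) (by simpa using hf)
        rw [sub_zero, zero_div] at h1
        exact h1 }
  have hg : (L f) • g - f * g = f := by
    ext x
    have hx := hne x
    change L f * (f x / (L f - f x)) - f x * (f x / (L f - f x)) = f x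
    field_simp
  have := congrArg L hg
  rw [map_sub, map_smul, hm, smul_eq_mul, sub_self] at this
  exact hf this.symm

lemma exists_real_ne (L : C₀(X, ℂ) →ₗ[ℂ] ℂ) (hL : ∃ g, L g ≠ 0) :
    ∃ g : C₀(X, ℂ), (∀ x, (g x).im = 0) ∧ L g ≠ 0 := by
  obtain ⟨g, hg⟩ := hL
  by_contra hcon
  push Not at hcon
  have h1 := hcon (g + star g) (by intro x; simp)
  have h2 := hcon (Complex.I • (g - star g)) (by intro x; simp)
  apply hg
  rw [map_smul, map_sub, smul_eq_mul] at h2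
  rw [map_add] at h1
  have h3 : L g - L (star g) = 0 := by simpa using h2
  linear_combination (h1 + h3) / 2

lemma charRange (L : C₀(X, ℂ) →ₗ[ℂ] ℂ) (hm : ∀ a b, L (a * b) = L a * L b)
    (hL : ∃ g, L g ≠ 0) (f : C₀(X, ℂ)) : ∃ x, L f = f x := by
  by_cases hf : L f = 0
  swap
  · exact charRange_aux L hm f hf
  obtain ⟨g, hg, hg0⟩ := exists_real_ne L hL
  obtain ⟨y, hy⟩ := charRange_aux L hm g hg0
  have hk : L (g - Complex.I • (star f * f)) = L g := by
    rw [map_sub, map_smul, hm, hf]; simp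
  obtain ⟨x, hx⟩ := charRange_aux L hm (g - Complex.I • (star f * f)) (by rwa [hk])
  refine ⟨x, ?_⟩
  rw [hk, hy] at hx
  have := congrArg Complex.im hx
  rw [hg y] at this
  simp [hg x] at this
  rw [hf]
  symm
  rw [← Complex.normSq_eq_zero, Complex.normSq_apply]
  linarith

/-- range-valued functionals: two real functions are evaluated at a common point. -/
lemma common (L : C₀(X, ℂ) →ₗ[ℂ] ℂ) (hL : ∀ f, ∃ x, L f = f x) (a b : C₀(X, ℂ))
    (ha : ∀ x, (a x).im = 0) (hb : ∀ x, (b x).im = 0) : ∃ y, L a = a y ∧ L b = b y := by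
  have ha' : (L a).im = 0 := by obtain ⟨y, hy⟩ := hL a; rw [hy, ha]
  have hb' : (L b).im = 0 := by obtain ⟨y, hy⟩ := hL b; rw [hy, hb]
  obtain ⟨y, hy⟩ := hL (a + Complex.I • b)
  rw [map_add, map_smul] at hy
  have h1 := congrArg Complex.re hy
  have h2 := congrArg Complex.im hy
  simp [ha, hb, ha', hb'] at h1 h2
  exact ⟨y, Complex.ext h1 (by rw [ha, ha']), Complex.ext h2 (by rw [hb, hb'])⟩

lemma evalSum {ι : Type*} (s : Finset ι) (a : ι → C₀(X, ℂ)) (y : X) :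
    (∑ j ∈ s, a j) y = ∑ j ∈ s, a j y := by
  classical
  induction s using Finset.induction_on with
  | empty => simp
  | insert i s hi ih => rw [Finset.sum_insert hi, Finset.sum_insert hi, ← ih]; rfl

lemma sqSum_im {ι : Type*} [Fintype ι] (a : ι → C₀(X, ℂ)) (ha : ∀ j x, (a j x).im = 0) (y : X) :
    ((∑ j, a j * a j) y).im = 0 := by
  rw [evalSum, Complex.im_sum]
  apply Finset.sum_eq_zero
  intro j _
  simp [ha]

lemma sqSum_zero {ι : Type*} [Fintype ι] (a : ι → C₀(X, ℂ)) (ha : ∀ j x, (a j x).im = 0) (y : X)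
    (h : (∑ j, a j * a j) y = 0) (j : ι) : a j y = 0 := by
  rw [evalSum] at h
  have h := congrArg Complex.re h
  rw [Complex.re_sum] at h
  simp only [ZeroAtInftyContinuousMap.coe_mul, Pi.mul_apply, Complex.mul_re, ha, mul_zero, sub_zero, Complex.zero_re] at h
  rw [Finset.sum_eq_zero_iff_of_nonneg (fun i _ => mul_self_nonneg _)] at h
  exact Complex.ext (by simpa using h j (Finset.mem_univ _)) (ha j y)

lemma commonFin {ι : Type*} [Fintype ι] (L : C₀(X, ℂ) →ₗ[ℂ] ℂ) (hL : ∀ f, ∃ x, L f = f x)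
    (p : C₀(X, ℂ)) (hp : ∀ x, (p x).im = 0) (hp0 : ∀ x, p x ≠ 0)
    (g : ι → C₀(X, ℂ)) (hg : ∀ j x, (g j x).im = 0) :
    ∃ y, L p = p y ∧ ∀ j, L (g j) = g j y := by
  have hp' : (L p).im = 0 := by obtain ⟨y, hy⟩ := hL p; rw [hy, hp]
  have hg' : ∀ j, (L (g j)).im = 0 := by
    intro j; obtain ⟨y, hy⟩ := hL (g j); rw [hy, hg]
  let a : ι → C₀(X, ℂ) := fun j => L (g j) • p - L p • g j
  have ha : ∀ j x, (a j x).im = 0 := by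
    intro j x; simp [a, hp, hg, hp', hg']
  have hLa : ∀ j, L (a j) = 0 := by
    intro j; simp [a, mul_comm]
  have hLs : L (∑ j, a j * a j) = 0 := by
    rw [map_sum]
    apply Finset.sum_eq_zero
    intro j _
    obtain ⟨y, h1, h2⟩ := common L hL (a j) (a j * a j) (ha j) (by intro x; simp [ha])
    rw [h2, ZeroAtInftyContinuousMap.mul_apply, ← h1, hLa, mul_zero]
  obtain ⟨y, h1, h2⟩ := common L hL p (∑ j, a j * a j) hp (sqSum_im a ha)
  refine ⟨y, h1, fun j => ?_⟩
  have h3 := sqSum_zero a ha y (by rw [← h2, hLs]) j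
  have h4 : L (g j) * p y - L p * g j y = 0 := h3
  rw [h1] at h4
  have := hp0 y
  apply mul_right_cancel₀ this
  linear_combination h4

/-- A range-valued functional is a point evaluation. -/
lemma isEval {ι : Type*} [Fintype ι] (L : C₀(X, ℂ) →ₗ[ℂ] ℂ) (hL : ∀ f, ∃ x, L f = f x)
    (p : C₀(X, ℂ)) (hp : ∀ x, (p x).im = 0) (hp0 : ∀ x, p x ≠ 0)
    (g : ι → C₀(X, ℂ)) (hg : ∀ j x, (g j x).im = 0)
    (hsep : ∀ x y, (∀ j, g j x * p y = g j y * p x) → x = y) :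
    ∃ y, ∀ f, L f = f y := by
  obtain ⟨y, hy, hy'⟩ := commonFin L hL p hp hp0 g hg
  have hr : ∀ f : C₀(X, ℂ), (∀ x, (f x).im = 0) → L f = f y := by
    intro f hf
    obtain ⟨z, hz, hz'⟩ := commonFin L hL p hp hp0
      (fun o : Option ι => o.elim f g) (by rintro (_ | j) x; exacts [hf x, hg j x])
    have : y = z := by
      apply hsep
      intro j
      have := hz' (some j)
      simp only [Option.elim] at this
      rw [← hy', ← hy, this, hz]
    rw [this]
    exact hz' none
  refine ⟨y, fun f => ?_⟩
  have h1 := hr (f + star f) (by intro x; simp)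
  have h2 := hr (Complex.I • (f - star f)) (by intro x; simp)
  rw [map_smul, map_sub, smul_eq_mul] at h2
  rw [map_add] at h1
  have h3 : L f - L (star f) = f y - star f y := by
    apply mul_left_cancel₀ Complex.I_ne_zero; exact h2
  have h1 : L f + L (star f) = f y + star f y := h1
  linear_combination (h1 + h3) / 2

lemma autRange (S : C₀(X, ℂ) → C₀(X, ℂ)) (hS : IsAlgebraAutomorphism S)
    (hnz : ∀ x, ∃ f : C₀(X, ℂ), f x ≠ 0) (f : C₀(X, ℂ)) (x : X) : ∃ y, S f x = f y := by
  obtain ⟨h1, h2, h3⟩ := hS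
  let L : C₀(X, ℂ) →ₗ[ℂ] ℂ :=
    { toFun := fun f => S f x
      map_add' := by intro a b; rw [h1.map_add]; rfl
      map_smul' := by intro a b; rw [h1.map_smul]; rfl }
  refine charRange L ?_ ?_ f
  · intro a b
    change S (a * b) x = S a x * S b x
    rw [h2]; rfl
  · obtain ⟨k, hk⟩ := hnz x
    obtain ⟨g, rfl⟩ := h3.2 k
    exact ⟨g, hk⟩

lemma autInv (S : C₀(X, ℂ) → C₀(X, ℂ)) (hS : IsAlgebraAutomorphism S) :
    ∃ T, IsAlgebraAutomorphism T ∧ (∀ f, T (S f) = f) ∧ ∀ f, S (T f) = f := by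
  obtain ⟨h1, h2, h3⟩ := hS
  obtain ⟨T, hT, hT'⟩ := Function.bijective_iff_has_inverse.mp h3
  refine ⟨T, ⟨⟨?_, ?_⟩, ?_, ?_⟩, hT, hT'⟩
  · intro a b; apply h3.1; rw [h1.map_add, hT', hT', hT']
  · intro a b; apply h3.1; rw [h1.map_smul, hT', hT']
  · intro a b; apply h3.1; rw [h2, hT', hT', hT']
  · exact Function.bijective_iff_has_inverse.mpr ⟨S, hT', hT⟩

lemma main_abstract [T2Space X] [WeaklyLocallyCompactSpace X] {ι : Type*} [Fintype ι]
    (p : C₀(X, ℂ)) (hp : ∀ x, (p x).im = 0) (hp0 : ∀ x, p x ≠ 0)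
    (g : ι → C₀(X, ℂ)) (hg : ∀ j x, (g j x).im = 0)
    (hsep : ∀ x y, (∀ j, g j x * p y = g j y * p x) → x = y)
    (hcont : ∀ φ : X → X, Continuous (fun x => p (φ x)) →
      (∀ j, Continuous (fun x => g j (φ x))) → Continuous φ)
    (F : C₀(X, ℂ) →ₗ[ℂ] C₀(X, ℂ))
    (hF : ∀ f : C₀(X, ℂ), ∃ S : C₀(X, ℂ) → C₀(X, ℂ),
      IsAlgebraAutomorphism S ∧ F f = S f) :
    IsAlgebraAutomorphism (⇑F) := by
  have hnz : ∀ x, ∃ f : C₀(X, ℂ), f x ≠ 0 := fun x => ⟨p, hp0 x⟩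
  have evl : ∀ G : C₀(X, ℂ) →ₗ[ℂ] C₀(X, ℂ), (∀ f x, ∃ y, G f x = f y) →
      ∃ φ : X → X, ∀ f x, G f x = f (φ x) := by
    intro G hG
    have : ∀ x, ∃ y, ∀ f, G f x = f y := by
      intro x
      let L : C₀(X, ℂ) →ₗ[ℂ] ℂ :=
        { toFun := fun f => G f x
          map_add' := by intro a b; rw [map_add]; rfl
          map_smul' := by intro a b; rw [map_smul]; rfl }
      exact isEval L (fun f => hG f x) p hp hp0 g hg hsep
    choose φ hφ using this
    exact ⟨φ, fun f x => hφ x f⟩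
  obtain ⟨φ, hφ⟩ := evl F (by
    intro f x
    obtain ⟨S, hS, h⟩ := hF f
    rw [h]; exact autRange S hS hnz f x)
  have hφc : Continuous φ := by
    apply hcont
    · simp_rw [← hφ]; exact map_continuous _
    · intro j; simp_rw [← hφ]; exact map_continuous _
  -- peak functions
  have hq : ∀ y : X, ∃ q : C₀(X, ℂ), ∀ x, q x = 0 ↔ x = y := by
    intro y
    let a : ι → C₀(X, ℂ) := fun j => p y • g j - g j y • p
    have ha : ∀ j x, (a j x).im = 0 := by
      intro j x; simp [a, hp, hg]
    refine ⟨∑ j, a j * a j, fun x => ⟨fun h => ?_, ?_⟩⟩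
    · apply hsep
      intro j
      have h3 : p y * g j x - g j y * p x = 0 := sqSum_zero a ha x h j
      linear_combination h3
    · rintro rfl
      rw [evalSum]
      apply Finset.sum_eq_zero
      intro j _
      have : a j x = 0 := by
        change p x * g j x - g j x * p x = 0
        ring
      simp [this]
  have hbij : Function.Bijective φ := by
    rw [Function.bijective_iff_existsUnique]
    intro y
    obtain ⟨q, hq'⟩ := hq y
    obtain ⟨S, hS, h⟩ := hF q
    obtain ⟨T, hT, hTS, hST⟩ := autInv S hS
    obtain ⟨ψ, hψ⟩ := evl hS.1.mk' (autRange S hS hnz)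
    have hψ : ∀ f x, S f x = f (ψ x) := hψ
    have key : ∀ x, φ x = y ↔ ψ x = y := by
      intro x
      rw [← hq', ← hq', ← hφ, ← hψ, h]
    obtain ⟨z, hz⟩ := autRange T hT hnz (S q) y
    rw [hTS, (hq' y).2 rfl, hψ] at hz
    refine ⟨z, (key z).2 ((hq' _).1 hz.symm), fun w hw => ?_⟩
    have h1 : ψ w = y := (key w).1 hw
    have h2 : ψ z = y := (hq' _).1 hz.symm
    obtain ⟨r, hr⟩ := hq z
    rw [← hr, ← hST r, hψ, h1, ← h2, ← hψ, hST, hr]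
  have hprop : Tendsto φ (cocompact X) (cocompact X) := by
    rw [(hasBasis_cocompact).tendsto_right_iff]
    intro K hK
    rcases K.eq_empty_or_nonempty with rfl | hKne
    · simp
    obtain ⟨k, hk, hmin⟩ := hK.exists_isMinOn hKne (f := fun x => ‖p x‖)
      (map_continuous p).norm.continuousOn
    have h0 : Tendsto (F p) (cocompact X) (𝓝 0) := zero_at_infty _
    have h1 := (tendsto_zero_iff_norm_tendsto_zero.mp h0).eventually_lt_const
      (norm_pos_iff.mpr (hp0 k))
    filter_upwards [h1] with x hx hxK
    rw [hφ] at hx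
    exact absurd hx (not_lt.mpr (hmin hxK))
  have hclosed : IsClosedMap φ :=
    ((isProperMap_iff_tendsto_cocompact).2 ⟨hφc, hprop⟩).isClosedMap
  let e : X ≃ₜ X := (Equiv.ofBijective φ hbij).toHomeomorphOfContinuousClosed hφc hclosed
  have he : ∀ x, e x = φ x := fun x => rfl
  refine ⟨F.isLinear, ?_, ?_, ?_⟩
  · intro a b; ext x; simp [hφ]
  · intro a b hab
    ext y
    obtain ⟨x, rfl⟩ := hbij.2 y
    rw [← hφ, ← hφ, hab]
  · intro h
    refine ⟨⟨⟨fun x => h (e.symm x), (map_continuous h).comp e.symm.continuous⟩, ?_⟩, ?_⟩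
    · have h0 : Tendsto h (cocompact X) (𝓝 0) := zero_at_infty _
      exact h0.comp e.symm.isClosedEmbedding.tendsto_cocompact
    · ext x
      rw [hφ]
      change h (e.symm (φ x)) = h x
      rw [← he, e.symm_apply_apply]

lemma restrictC0 {E : Type*} [TopologicalSpace E] [T2Space E] (Ω : Set E) (h : E → ℝ)
    (hc : Continuous h) (h0 : Tendsto h (cocompact E) (𝓝 0)) (hz : ∀ x, x ∉ Ω → h x = 0) :
    ∃ f : C₀(Ω, ℂ), ∀ x : Ω, f x = (h x : ℂ) := by
  refine ⟨⟨⟨fun x => (h x : ℂ), by fun_prop⟩, ?_⟩, fun x => rfl⟩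
  change Tendsto (fun x : Ω => (h x : ℂ)) (cocompact Ω) (𝓝 0)
  rw [Metric.tendsto_nhds]
  intro ε hε
  have h1 := (Metric.tendsto_nhds.mp h0) ε hε
  obtain ⟨K, hK, hKs⟩ := mem_cocompact.mp h1
  rw [Filter.Eventually, mem_cocompact]
  refine ⟨Subtype.val ⁻¹' (K ∩ {x | ε ≤ ‖h x‖}), ?_, ?_⟩
  · rw [Subtype.isCompact_iff, Subtype.image_preimage_coe, Set.inter_eq_self_of_subset_right]
    · exact hK.inter_right (isClosed_le continuous_const hc.norm)
    · rintro x ⟨_, hx⟩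
      by_contra hcon
      simp [hz x hcon] at hx
      linarith
  · intro x hx
    simp only [Set.mem_compl_iff, Set.mem_preimage, Set.mem_inter_iff, not_and, Set.mem_setOf_eq,
      not_le] at hx
    simp only [Set.mem_setOf_eq, dist_zero_right, Complex.norm_real]
    by_cases hxK : (x : E) ∈ K
    · exact hx hxK
    · simpa using hKs hxK

end helpers

/-- For a nonempty open convex set `Ω ⊆ ℝⁿ`, the automorphism group of
`C₀(Ω)` is algebraically reflexive. -/
theorem aut_reflexive_C0_of_open_convex
    (n : ℕ) (Ω : Set (EuclideanSpace ℝ (Fin n)))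
    (hopen : IsOpen Ω) (hconv : Convex ℝ Ω) (hne : Ω.Nonempty)
    (F : C₀(Ω, ℂ) →L[ℂ] C₀(Ω, ℂ))
    (hF : ∀ f : C₀(Ω, ℂ), ∃ S : C₀(Ω, ℂ) → C₀(Ω, ℂ),
      IsAlgebraAutomorphism S ∧ F f = S f) :
    IsAlgebraAutomorphism (⇑F) := by
  obtain ⟨u, huc, hu0, hu1, huz⟩ : ∃ u : EuclideanSpace ℝ (Fin n) → ℝ, Continuous u ∧
      (∀ x, 0 ≤ u x) ∧ (∀ x, u x ≤ 1) ∧ ∀ x, u x = 0 ↔ x ∉ Ω := by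
    by_cases hΩ : Ωᶜ.Nonempty
    · refine ⟨fun x => min 1 (Metric.infDist x Ωᶜ), ?_, ?_, ?_, ?_⟩
      · exact continuous_const.min (Metric.continuous_infDist_pt _)
      · intro x; exact le_min zero_le_one Metric.infDist_nonneg
      · intro x; exact min_le_left _ _
      · intro x
        rw [← Set.mem_compl_iff, hopen.isClosed_compl.mem_iff_infDist_zero hΩ]
        constructor
        · intro h
          rcases min_choice (1 : ℝ) (Metric.infDist x Ωᶜ) with h' | h'
          · simp only [h'] at h; norm_num at h
          · simpa only [h'] using h
        · intro h; simp [h]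
    · rw [Set.not_nonempty_iff_eq_empty, Set.compl_empty_iff] at hΩ
      exact ⟨fun _ => 1, continuous_const, by simp, by simp, by simp [hΩ]⟩
  have hd : ∀ x : EuclideanSpace ℝ (Fin n), 0 < 1 + ‖x‖ ^ 2 := fun x => by positivity
  have hd' : ∀ x : EuclideanSpace ℝ (Fin n), 1 + ‖x‖ ^ 2 ≠ 0 := fun x => (hd x).ne'
  have hinv : Filter.Tendsto (fun x : EuclideanSpace ℝ (Fin n) => 2 * (1 + ‖x‖)⁻¹)
      (Filter.cocompact _) (nhds 0) := by
    have h1 : Filter.Tendsto (fun x : EuclideanSpace ℝ (Fin n) => 1 + ‖x‖)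
      (Filter.cocompact _) Filter.atTop :=
      Filter.tendsto_atTop_add_const_left _ _ (tendsto_norm_cocompact_atTop)
    simpa using h1.inv_tendsto_atTop.const_mul 2
  have hbd : ∀ (c : EuclideanSpace ℝ (Fin n) → ℝ), (∀ x, |c x| ≤ 1 + ‖x‖ ∧ |c x| * (1 + ‖x‖) ≤ 2 * (1 + ‖x‖ ^ 2)) →
      Filter.Tendsto (fun x => c x * (u x / (1 + ‖x‖ ^ 2))) (Filter.cocompact _) (nhds 0) := by
    intro c hc
    refine squeeze_zero_norm (fun x => ?_) hinv
    have hx : 0 < 1 + ‖x‖ := by positivity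
    rw [Real.norm_eq_abs, abs_mul, abs_div, abs_of_pos (hd x), abs_of_nonneg (hu0 x),
      ← div_eq_mul_inv, mul_div_assoc', div_le_div_iff₀ (hd x) hx]
    calc |c x| * u x * (1 + ‖x‖) = (|c x| * (1 + ‖x‖)) * u x := by ring
      _ ≤ (|c x| * (1 + ‖x‖)) * 1 := by
        apply mul_le_mul_of_nonneg_left (hu1 x); positivity
      _ ≤ _ := by rw [mul_one]; exact (hc x).2
  have hpc : Continuous (fun x => u x / (1 + ‖x‖ ^ 2)) := by
    exact huc.div (by fun_prop) hd'
  obtain ⟨p, hp⟩ := restrictC0 Ω (fun x => 1 * (u x / (1 + ‖x‖ ^ 2))) (continuous_const.mul hpc)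
    (hbd (fun _ => 1) (fun x => ⟨by simp, by
      simp only [abs_one]; nlinarith [sq_nonneg (‖x‖ - 1), norm_nonneg x]⟩))
    (fun x hx => by simp [(huz x).2 hx])
  have hg : ∀ j : Fin n, ∃ f : C₀(Ω, ℂ), ∀ x : Ω,
      f x = ((x.1 j * (u x / (1 + ‖x.1‖ ^ 2)) : ℝ) : ℂ) := by
    intro j
    refine restrictC0 Ω (fun x => x j * (u x / (1 + ‖x‖ ^ 2))) (Continuous.mul (by fun_prop) hpc)
      (hbd (fun x => x j) (fun x => ?_)) (fun x hx => by simp [(huz x).2 hx])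
    have h1 : |x j| ≤ ‖x‖ := PiLp.norm_apply_le x j
    have h2 := abs_nonneg (x j)
    have h3 := norm_nonneg x
    exact ⟨by linarith, by nlinarith [sq_nonneg (‖x‖ - 1)]⟩
  choose g hg using hg
  have hw : ∀ x : Ω, u x / (1 + ‖x.1‖ ^ 2) ≠ 0 := by
    intro x
    refine div_ne_zero ?_ (hd' _)
    rw [Ne, huz, not_not]; exact x.2
  have hp0 : ∀ x, p x ≠ 0 := by
    intro x
    rw [hp, one_mul]; exact_mod_cast hw x
  have hgp : ∀ j x, g j x = (x.1 j : ℂ) * p x := by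
    intro j x
    rw [hp, hg]; push_cast; ring
  have : WeaklyLocallyCompactSpace Ω := by
    have : LocallyCompactSpace Ω := hopen.locallyCompactSpace
    infer_instance
  refine main_abstract p (fun x => by rw [hp]; exact Complex.ofReal_im _) hp0 g
    (fun j x => by rw [hg]; exact Complex.ofReal_im _) ?_ ?_ F.toLinearMap hF
  · intro x y h
    ext j
    have := h j
    rw [hgp, hgp] at this
    have h2 : ((x.1 j : ℂ) - y.1 j) * (p x * p y) = 0 := by linear_combination this
    have h3 := (mul_eq_zero.mp h2).resolve_right (mul_ne_zero (hp0 x) (hp0 y))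
    exact_mod_cast sub_eq_zero.mp h3
  · intro φ h1 h2
    rw [continuous_induced_rng]
    have : Continuous fun x => WithLp.ofLp (φ x).1 := by
      apply continuous_pi
      intro j
      have h3 : (fun x => (φ x).1 j) = fun x => (g j (φ x) / p (φ x)).re := by
        ext x
        rw [hgp, mul_div_cancel_right₀ _ (hp0 _), Complex.ofReal_re]
      rw [h3]
      exact Complex.continuous_re.comp ((h2 j).div h1 (fun x => hp0 _))
    exact (PiLp.continuous_toLp 2 _).comp this
end
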